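/- arXiv:2604.08345 — 11 statements merged into one kernel-verified Lean document; each statement's English description precedes it below -/
import Mathlib

section
/- For every bivalued instance there exists an allocation X that is both WEFX and fPO. -/
open Finset

/-- `X` is an allocation: bundles are pairwise disjoint and cover all goods. -/
def IsAllocation {N M : Type*} (X : N → Finset M) : Prop :=
  (∀ i j : N, i ≠ j → Disjoint (X i) (X j)) ∧ ∀ e : M, ∃ i : N, e ∈ X i

/-- A fractional allocation: entries in `[0,1]`, each good fully distributed. -/
def IsFracAlloc {N M : Type*} [Fintype N] (x : N → M → ℝ) : Prop :=
  (∀ i e, 0 ≤ x i e ∧ x i e ≤ 1) ∧ ∀ e : M, ∑ i : N, x i e = 1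

/-- Fractional allocation `x` dominates allocation `X`. -/
def FracDominates {N M : Type*} [Fintype M] (v : N → M → ℝ) (x : N → M → ℝ)
    (X : N → Finset M) : Prop :=
  (∀ i, ∑ e ∈ X i, v i e ≤ ∑ e : M, x i e * v i e) ∧
    ∃ i, ∑ e ∈ X i, v i e < ∑ e : M, x i e * v i e

/-- `X` is fractionally Pareto optimal. -/
def IsfPO {N M : Type*} [Fintype N] [Fintype M] (v : N → M → ℝ) (X : N → Finset M) : Prop :=
  ¬ ∃ x : N → M → ℝ, IsFracAlloc x ∧ FracDominates v x X

/-- `(X, p)` is a Fisher market equilibrium: every agent only holds goods that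
maximize her bang-per-buck ratio. -/
def IsEquilibrium {N M : Type*} (v : N → M → ℝ) (p : M → ℝ) (X : N → Finset M) : Prop :=
  ∀ i : N, ∀ e ∈ X i, ∀ e' : M, v i e' / p e' ≤ v i e / p e

/-- `X` is weighted envy-free up to any good. -/
def IsWEFX {N M : Type*} [DecidableEq M] (v : N → M → ℝ) (w : N → ℝ) (X : N → Finset M) : Prop :=
  ∀ i j : N, ∀ e ∈ X j, (∑ a ∈ (X j).erase e, v i a) / w j ≤ (∑ a ∈ X i, v i a) / w i

/-- `X` is weighted equitable up to any good. -/
def IsWEQX {N M : Type*} [DecidableEq M] (v : N → M → ℝ) (w : N → ℝ) (X : N → Finset M) : Prop :=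
  ∀ i j : N, ∀ e ∈ X j, (∑ a ∈ (X j).erase e, v j a) / w j ≤ (∑ a ∈ X i, v i a) / w i

open Classical in
/-- The number (as a real) of goods satisfying `G` that the assignment `f` gives to agent `j`. -/
noncomputable def goodCount {N M : Type*} [Fintype M] (G : M → Prop) (f : M → N) (j : N) : ℝ :=
  ∑ e : M, if G e ∧ f e = j then 1 else 0

/-- The balancing potential for base loads `u` and loads `c` of unit goods: moving one unit good
from `r` to `i` changes it by twice the difference of the weighted loads. -/
noncomputable def balancePotential {N : Type*} [Fintype N] (w u c : N → ℝ) : ℝ :=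
  ∑ j : N, (2 * u j * c j + c j * (c j - 1)) / w j

section Counting

variable {N M : Type*} [Fintype M]

theorem goodCount_nonneg (G : M → Prop) (f : M → N) (j : N) : 0 ≤ goodCount G f j :=
  Finset.sum_nonneg fun e _ => by split_ifs <;> norm_num

theorem goodCount_pos_iff (G : M → Prop) (f : M → N) (j : N) :
    0 < goodCount G f j ↔ ∃ e, G e ∧ f e = j := by
  classical
  constructor
  · intro h
    by_contra! hne
    have : goodCount G f j = 0 :=
      Finset.sum_eq_zero fun e _ => if_neg fun ⟨h1, h2⟩ => hne e h1 h2
    linarith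
  · rintro ⟨e, he⟩
    refine Finset.sum_pos' (fun e _ => by split_ifs <;> norm_num) ⟨e, mem_univ e, ?_⟩
    rw [if_pos he]
    norm_num

theorem goodCount_congr {G G' : M → Prop} {f f' : M → N} {j : N}
    (h : ∀ e, (G e ∧ f e = j) ↔ (G' e ∧ f' e = j)) : goodCount G f j = goodCount G' f' j := by
  classical
  refine Finset.sum_congr rfl fun e _ => ?_
  simp only [h e]

open Classical in
theorem goodCount_update {G : M → Prop} {f : M → N} {e : M} {i : N} (he : G e) (j : N) :
    goodCount G (Function.update f e i) j =
      goodCount G f j + (if j = i then 1 else 0) - (if j = f e then 1 else 0) := by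
  unfold goodCount
  rw [← Finset.add_sum_erase univ _ (mem_univ e),
    ← Finset.add_sum_erase univ (fun a => if G a ∧ f a = j then (1 : ℝ) else 0) (mem_univ e)]
  have : ∑ a ∈ univ.erase e, (if G a ∧ Function.update f e i a = j then (1 : ℝ) else 0) =
      ∑ a ∈ univ.erase e, if G a ∧ f a = j then (1 : ℝ) else 0 :=
    Finset.sum_congr rfl fun a ha => by
      rw [Function.update_of_ne (Finset.ne_of_mem_erase ha)]
  rw [this]
  simp only [he, true_and, Function.update_self, eq_comm (a := j)]
  ring

open Classical in
theorem balancePotential_shift [Fintype N] (w u c c' : N → ℝ) {r i : N} (hri : r ≠ i)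
    (h : ∀ j, c' j = c j + (if j = i then 1 else 0) - (if j = r then 1 else 0)) :
    balancePotential w u c' =
      balancePotential w u c + 2 * ((u i + c i) / w i - (u r + c r - 1) / w r) := by
  have key : ∀ j, (2 * u j * c' j + c' j * (c' j - 1)) / w j =
      (2 * u j * c j + c j * (c j - 1)) / w j + (if j = i then 2 * ((u j + c j) / w j) else 0)
        - (if j = r then 2 * ((u j + c j - 1) / w j) else 0) := by
    intro j
    rw [h j]
    by_cases h1 : j = i
    · have h2 : j ≠ r := fun h2 => hri (h2.symm.trans h1)
      simp only [h1, h1 ▸ h2, if_true, if_false]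
      ring
    · by_cases h2 : j = r
      · simp only [h2, hri, if_true, if_false]
        ring
      · simp only [h1, h2, if_false]
        ring
  unfold balancePotential
  simp only [key, Finset.sum_add_distrib, Finset.sum_sub_distrib, Finset.sum_ite_eq',
    mem_univ, if_true]
  ring

end Counting

section Balanced

variable {N M : Type*} [Fintype M] (L : N → M → Prop)

/-- `B` gives every good that somebody likes to an agent who likes it. -/
def IsLikerAssignment (B : M → N) : Prop := ∀ e i, L i e → L (B e) e

/-- Agent `a` likes some good that `B` gives to `b`. -/
def CanTransfer (B : M → N) (b a : N) : Prop := ∃ e, B e = b ∧ L a e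

/-- Number of goods liked by somebody that `B` gives to `j`. -/
noncomputable def likedCount (B : M → N) (j : N) : ℝ := goodCount (fun e => ∃ i, L i e) B j

variable {L}

open Classical in
theorem exists_shift_of_nodup_chain (l : List N) : ∀ (B : M → N) (b : N),
    IsLikerAssignment L B → List.IsChain (CanTransfer L B) (b :: l) → (b :: l).Nodup →
    ∃ B', IsLikerAssignment L B' ∧ ∀ j, likedCount L B' j = likedCount L B j +
      (if j = (b :: l).getLast (List.cons_ne_nil b l) then 1 else 0) -
      (if j = b then 1 else 0) := by
  induction l with
  | nil =>
    intro B b hB _ _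
    exact ⟨B, hB, fun j => by rw [List.getLast_singleton]; ring⟩
  | cons a l ih =>
    intro B b hB hc hnd
    obtain ⟨⟨e, heb, hae⟩, hc⟩ := List.isChain_cons_cons.1 hc
    obtain ⟨hb, hnd⟩ := List.nodup_cons.1 hnd
    have hB1 : IsLikerAssignment L (Function.update B e a) := by
      intro e' i hi
      by_cases h : e' = e
      · subst h; simpa using hae
      · rw [Function.update_of_ne h]; exact hB e' i hi
    have hc1 : List.IsChain (CanTransfer L (Function.update B e a)) (a :: l) := by
      refine List.IsChain.imp_of_mem_imp ?_ hc
      rintro x y hx _ ⟨g, hg, hy⟩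
      refine ⟨g, ?_, hy⟩
      rw [Function.update_of_ne, hg]
      rintro rfl
      exact hb (heb ▸ hg ▸ hx)
    obtain ⟨B', hB', hcount⟩ := ih _ a hB1 hc1 hnd
    refine ⟨B', hB', fun j => ?_⟩
    rw [hcount j, likedCount, goodCount_update (G := fun e => ∃ i, L i e) ⟨a, hae⟩ j, heb,
      List.getLast_cons_cons]
    unfold likedCount
    ring

theorem exists_nodup_chain {r : N → N → Prop} {b a : N} (h : Relation.ReflTransGen r b a) :
    ∃ l : List N, List.IsChain r (b :: l) ∧ (b :: l).Nodup ∧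
      (b :: l).getLast (List.cons_ne_nil b l) = a := by
  induction h using Relation.ReflTransGen.head_induction_on with
  | refl => exact ⟨[], by simp⟩
  | @head x y hxy _ ih =>
    obtain ⟨l, hc, hnd, hl⟩ := ih
    by_cases hx : x ∈ y :: l
    · obtain ⟨s, t, hst⟩ := List.append_of_mem hx
      refine ⟨t, ?_, ?_, ?_⟩
      · rw [hst] at hc; exact hc.right_of_append
      · rw [hst] at hnd; exact hnd.of_append_right
      · rw [← hl]; simp only [hst]
        rw [List.getLast_append_of_ne_nil]
    · exact ⟨y :: l, List.isChain_cons_cons.2 ⟨hxy, hc⟩, List.nodup_cons.2 ⟨hx, hnd⟩, by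
        rw [List.getLast_cons_cons]; exact hl⟩

theorem exists_balanced_assignment [Fintype N] [Nonempty N] (w : N → ℝ) (hw : ∀ i, 0 < w i) :
    ∃ B : M → N, IsLikerAssignment L B ∧
      ∀ b a, Relation.ReflTransGen (CanTransfer L B) b a →
        (likedCount L B b - 1) / w b ≤ likedCount L B a / w a := by
  classical
  have hne : {B : M → N | IsLikerAssignment L B}.Nonempty := by
    have : ∀ e, ∃ j, ∀ i, L i e → L j e := by
      intro e
      by_cases h : ∃ i, L i e
      · exact ⟨h.choose, fun _ _ => h.choose_spec⟩
      · exact ⟨Classical.arbitrary N, fun i hi => (h ⟨i, hi⟩).elim⟩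
    choose B hB using this
    exact ⟨B, hB⟩
  obtain ⟨B, hB, hmin⟩ := Set.exists_min_image _ (fun B => balancePotential w 0 (likedCount L B))
    (Set.toFinite _) hne
  refine ⟨B, hB, fun b a hba => ?_⟩
  by_cases hab : b = a
  · subst hab
    exact div_le_div_of_nonneg_right (by linarith) (hw b).le
  obtain ⟨l, hc, hnd, hl⟩ := exists_nodup_chain hba
  obtain ⟨B', hB', hcount⟩ := exists_shift_of_nodup_chain l B b hB hc hnd
  rw [hl] at hcount
  have h1 := hmin B' hB'
  rw [balancePotential_shift w 0 _ _ hab hcount] at h1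
  simp only [Pi.zero_apply, zero_add] at h1
  linarith

end Balanced

section Market

variable {N M : Type*} [Fintype M] (L : N → M → Prop) (k : ℝ) (w : N → ℝ) (B : M → N)

/-- A good is big relative to the set `Q` of lowered agents if an agent outside `Q` likes it. -/
def IsBig (Q : Set N) (e : M) : Prop := ∃ i, i ∉ Q ∧ L i e

/-- Number of goods that are not big held by `j`. -/
noncomputable def smallCount (Q : Set N) (f : M → N) (j : N) : ℝ :=
  goodCount (fun e => ¬ IsBig L Q e) f j

open Classical in
/-- Spending on big goods: agents outside `Q` keep their goods from `B`, at price `k`. -/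
noncomputable def bigSpending (Q : Set N) (j : N) : ℝ :=
  if j ∈ Q then 0 else k * likedCount L B j

/-- Total spending of agent `j`; big goods have price `k`, the other goods have price `1`. -/
noncomputable def spending (Q : Set N) (f : M → N) (j : N) : ℝ :=
  bigSpending L k B Q j + smallCount L Q f j

/-- The assignment `f` is an equilibrium in which the agents in `Q` have been lowered by a factor
`k`, big goods stay as in `B`, and the agents in `Q` remain rich enough. -/
structure IsMarketState (Q : Set N) (f : M → N) : Prop where
  big_eq : ∀ e, IsBig L Q e → f e = B e
  big_owner : ∀ e, IsBig L Q e → B e ∉ Q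
  small_liked : ∀ e, ¬ IsBig L Q e → f e ∈ Q → L (f e) e
  le_spending : ∀ a ∈ Q, ∀ b ∉ Q, (likedCount L B b - 1) / w b ≤ spending L k B Q f a / w a
  small_le : ∀ a ∈ Q, ∀ h, 0 < smallCount L Q f h →
    (spending L k B Q f h - 1) / w h ≤ k * (spending L k B Q f a / w a)

variable {L k w B}

theorem likedCount_nonneg (j : N) : 0 ≤ likedCount L B j := goodCount_nonneg _ _ _

theorem spending_nonneg (hk : 1 < k) (Q : Set N) (f : M → N) (j : N) :
    0 ≤ spending L k B Q f j := by
  have h1 : 0 ≤ smallCount L Q f j := goodCount_nonneg _ _ _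
  have h2 := likedCount_nonneg (L := L) (B := B) j
  unfold spending bigSpending
  split_ifs
  · linarith
  · have : 0 ≤ k * likedCount L B j := mul_nonneg (by linarith) h2
    linarith

theorem ne_of_div_lt_sub_one_div (hw : ∀ i, 0 < w i) {S : N → ℝ} {r i : N}
    (hlt : S i / w i < (S r - 1) / w r) : r ≠ i := by
  rintro rfl
  have := div_le_div_of_nonneg_right (show S r - 1 ≤ S r by linarith) (hw r).le
  linarith

theorem isMarketState_empty : IsMarketState L k w B ∅ B where
  big_eq _ _ := rfl
  big_owner _ _ h := h
  small_liked _ _ h := h.elim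
  le_spending _ h := h.elim
  small_le _ h := h.elim

open Classical in
theorem spending_update {Q : Set N} {f : M → N} {e : M} (i : N) (he : ¬ IsBig L Q e) (j : N) :
    spending L k B Q (Function.update f e i) j =
      spending L k B Q f j + (if j = i then 1 else 0) - (if j = f e then 1 else 0) := by
  unfold spending smallCount
  rw [goodCount_update (G := fun e => ¬ IsBig L Q e) he j]
  ring

open Classical in
/-- Handing a small good to a poorer agent who accepts it preserves market states. -/
theorem IsMarketState.update (hk : 1 < k) (hw : ∀ i, 0 < w i) {Q : Set N} {f : M → N}
    (h : IsMarketState L k w B Q f) {e : M} (he : ¬ IsBig L Q e) {i : N} (hi : i ∈ Q → L i e)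
    (hlt : spending L k B Q f i / w i < (spending L k B Q f (f e) - 1) / w (f e))
    (hsmall : f e ∈ Q → ∀ h, 0 < smallCount L Q f h →
      (spending L k B Q f h - 1) / w h ≤ k * ((spending L k B Q f (f e) - 1) / w (f e)))
    (hbig : f e ∈ Q → ∀ b ∉ Q,
      (likedCount L B b - 1) / w b ≤ (spending L k B Q f (f e) - 1) / w (f e)) :
    IsMarketState L k w B Q (Function.update f e i) := by
  classical
  have hri : f e ≠ i := ne_of_div_lt_sub_one_div hw hlt
  have hS : ∀ j, spending L k B Q (Function.update f e i) j =
      spending L k B Q f j + (if j = i then 1 else 0) - (if j = f e then 1 else 0) :=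
    spending_update i he
  have hSr : spending L k B Q (Function.update f e i) (f e) = spending L k B Q f (f e) - 1 := by
    rw [hS, if_neg hri, if_pos rfl]; ring
  have hSi : spending L k B Q (Function.update f e i) i = spending L k B Q f i + 1 := by
    rw [hS, if_neg hri.symm, if_pos rfl]; ring
  have hSge : ∀ j, j ≠ f e →
      spending L k B Q f j / w j ≤ spending L k B Q (Function.update f e i) j / w j := by
    intro j hj
    refine div_le_div_of_nonneg_right ?_ (hw j).le
    rw [hS, if_neg hj]
    split_ifs <;> linarith
  have hyr : 0 < smallCount L Q f (f e) := (goodCount_pos_iff _ _ _).2 ⟨e, he, rfl⟩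
  have hSi0 : 0 ≤ spending L k B Q f i / w i := div_nonneg (spending_nonneg hk _ _ _) (hw i).le
  refine ⟨fun g hg => ?_, h.big_owner, fun g hg => ?_, fun a ha b hb => ?_, fun a ha j hj => ?_⟩
  · rw [Function.update_of_ne, h.big_eq g hg]
    rintro rfl
    exact he hg
  · by_cases hge : g = e
    · subst hge; simpa using hi
    · rw [Function.update_of_ne hge]; exact h.small_liked g hg
  · by_cases har : a = f e
    · rw [har, hSr]; exact hbig (har ▸ ha) b hb
    · exact (h.le_spending a ha b hb).trans (hSge a har)
  · by_cases hji : j = i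
    · rw [hji, hSi, add_sub_cancel_right]
      by_cases har : a = f e
      · rw [har, hSr]; nlinarith
      · have h1 := h.small_le a ha _ hyr
        have h2 := mul_le_mul_of_nonneg_left (hSge a har) (show 0 ≤ k by linarith)
        linarith
    · have hle : (spending L k B Q (Function.update f e i) j - 1) / w j ≤
          (spending L k B Q f j - 1) / w j := by
        refine div_le_div_of_nonneg_right ?_ (hw j).le
        rw [hS, if_neg hji]
        split_ifs <;> linarith
      have hj' : 0 < smallCount L Q f j := by
        obtain ⟨g, hg, hgj⟩ := (goodCount_pos_iff _ _ _).1 hj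
        refine (goodCount_pos_iff _ _ _).2 ⟨g, hg, ?_⟩
        rwa [Function.update_of_ne] at hgj
        rintro rfl
        exact hji (by simpa using hgj.symm)
      refine hle.trans ?_
      by_cases har : a = f e
      · rw [har, hSr]; exact hsmall (har ▸ ha) j hj'
      · exact (h.small_le a ha j hj').trans
          (mul_le_mul_of_nonneg_left (hSge a har) (by linarith))

/-- If an agent outside `Q` has the most big goods and dwarfs all holders of small goods, then
everybody reachable from that agent can be lowered. -/
theorem IsMarketState.lower (hk : 1 < k) (hw : ∀ i, 0 < w i) (hB : IsLikerAssignment L B)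
    (hbal : ∀ b a, Relation.ReflTransGen (CanTransfer L B) b a →
        (likedCount L B b - 1) / w b ≤ likedCount L B a / w a)
    {Q : Set N} {f : M → N} (h : IsMarketState L k w B Q f) {b : N}
    (hmax : ∀ a ∉ Q, (likedCount L B a - 1) / w a ≤ (likedCount L B b - 1) / w b)
    (hsmall : ∀ j, 0 < smallCount L Q f j →
      (spending L k B Q f j - 1) / w j < k * ((likedCount L B b - 1) / w b)) :
    IsMarketState L k w B (Q ∪ {a | Relation.ReflTransGen (CanTransfer L B) b a}) f := by
  classical
  set R : Set N := {a | Relation.ReflTransGen (CanTransfer L B) b a}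
  have hclosed : ∀ e i, B e ∈ R → L i e → i ∈ R := fun e i he hi =>
    Relation.ReflTransGen.tail he ⟨e, rfl, hi⟩
  have hbig' : ∀ e, IsBig L (Q ∪ R) e → IsBig L Q e := fun e ⟨i, hi, hie⟩ =>
    ⟨i, fun hq => hi (Or.inl hq), hie⟩
  have hpure : ∀ a ∈ R, a ∉ Q → ∀ e, f e = a → IsBig L Q e := by
    intro a ha haQ e hea
    by_contra hne
    have hpos : 0 < smallCount L Q f a := (goodCount_pos_iff _ _ _).2 ⟨e, hne, hea⟩
    have h1 := hsmall a hpos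
    have h2 := mul_le_mul_of_nonneg_left (hbal b a ha) (show 0 ≤ k by linarith)
    have h3 : k * (likedCount L B a / w a) ≤ (spending L k B Q f a - 1) / w a := by
      rw [← mul_div_assoc]
      refine div_le_div_of_nonneg_right ?_ (hw a).le
      have hone : 1 ≤ smallCount L Q f a := by
        unfold smallCount goodCount
        refine le_trans ?_ (Finset.single_le_sum (fun g _ => ?_) (mem_univ e))
        · rw [if_pos ⟨hne, hea⟩]
        · split_ifs <;> norm_num
      rw [spending, bigSpending, if_neg haQ]
      linarith
    linarith
  have hcount : ∀ j, j ∈ Q ∨ j ∉ R → smallCount L (Q ∪ R) f j = smallCount L Q f j := by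
    intro j hj
    refine goodCount_congr fun e => ?_
    refine and_congr_left fun hej => not_congr ⟨hbig' e, fun he => ?_⟩
    have h1 := h.big_eq e he
    have h2 := h.big_owner e he
    rw [← h1, hej] at h2
    obtain ⟨i, -, hi⟩ := he
    refine ⟨j, ?_, ?_⟩
    · rintro (hq | hr)
      · exact h2 hq
      · exact hj.elim h2 fun hnr => hnr hr
    · rw [← hej, h1]; exact hB e i hi
  have hspend : ∀ j, j ∈ Q ∨ j ∉ R → spending L k B (Q ∪ R) f j = spending L k B Q f j := by
    intro j hj
    have : j ∈ Q ∪ R ↔ j ∈ Q :=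
      ⟨fun hm => hm.elim id fun hr => hj.elim id fun hnr => (hnr hr).elim, Or.inl⟩
    unfold spending bigSpending
    rw [hcount j hj]
    simp only [this]
  have hspendR : ∀ j ∈ R, j ∉ Q → spending L k B (Q ∪ R) f j = likedCount L B j := by
    intro j hj hjQ
    rw [spending, bigSpending, if_pos (show j ∈ Q ∪ R from Or.inr hj), zero_add]
    refine goodCount_congr fun e => ⟨fun ⟨_, hej⟩ => ?_, fun ⟨⟨i, hi⟩, hej⟩ => ?_⟩
    · have hbe := hpure j hj hjQ e hej
      rw [← h.big_eq e hbe]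
      exact ⟨hbe.imp fun _ => And.right, hej⟩
    · have hbe : IsBig L Q e := ⟨j, hjQ, hej ▸ hB e i hi⟩
      refine ⟨fun ⟨a, ha, hae⟩ => ha (Or.inr (hclosed e a (hej ▸ hj) hae)), ?_⟩
      rw [h.big_eq e hbe, hej]
  refine ⟨fun e he => h.big_eq e (hbig' e he), fun e he => ?_, fun e he hfe => ?_,
    fun a ha c hc => ?_, fun a ha j hj => ?_⟩
  · rintro (hq | hr)
    · exact h.big_owner e (hbig' e he) hq
    · obtain ⟨i, hi, hie⟩ := he
      exact hi (Or.inr (hclosed e i hr hie))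
  · by_cases hbe : IsBig L Q e
    · rw [h.big_eq e hbe]
      obtain ⟨i, -, hi⟩ := hbe
      exact hB e i hi
    · refine h.small_liked e hbe ?_
      by_contra hq
      exact hbe (hpure (f e) (hfe.resolve_left hq) hq e rfl)
  · have hcQ : c ∉ Q := fun hq => hc (Or.inl hq)
    by_cases haQ : a ∈ Q
    · rw [hspend a (Or.inl haQ)]; exact h.le_spending a haQ c hcQ
    · have haR := ha.resolve_left haQ
      rw [hspendR a haR haQ]
      exact (hmax c hcQ).trans (hbal b a haR)
  · have hnn : 0 ≤ spending L k B (Q ∪ R) f a / w a :=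
      div_nonneg (spending_nonneg hk _ _ _) (hw a).le
    by_cases hjR : j ∈ Q ∨ j ∉ R
    · rw [hcount j hjR] at hj
      rw [hspend j hjR]
      by_cases haQ : a ∈ Q
      · rw [hspend a (Or.inl haQ)]; exact h.small_le a haQ j hj
      · have haR := ha.resolve_left haQ
        rw [hspendR a haR haQ]
        exact (hsmall j hj).le.trans (mul_le_mul_of_nonneg_left (hbal b a haR) (by linarith))
    · push Not at hjR
      rw [hspendR j hjR.2 hjR.1]
      have : (likedCount L B j - 1) / w j ≤ spending L k B (Q ∪ R) f a / w a := by
        by_cases haQ : a ∈ Q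
        · rw [hspend a (Or.inl haQ)]; exact h.le_spending a haQ j hjR.1
        · have haR := ha.resolve_left haQ
          rw [hspendR a haR haQ]
          exact (hmax j hjR.1).trans (hbal b a haR)
      nlinarith

/-- There is a market state in which no small good is desired by a poorer agent and no agent
outside `Q` has too many big goods compared to another agent outside `Q`. -/
theorem exists_stable_marketState [Fintype N] (hk : 1 < k) (hw : ∀ i, 0 < w i)
    (hB : IsLikerAssignment L B)
    (hbal : ∀ b a, Relation.ReflTransGen (CanTransfer L B) b a →
        (likedCount L B b - 1) / w b ≤ likedCount L B a / w a) :
    ∃ (Q : Set N) (f : M → N), IsMarketState L k w B Q f ∧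
      (∀ e i, ¬ IsBig L Q e → (i ∈ Q → L i e) →
        (spending L k B Q f (f e) - 1) / w (f e) ≤ spending L k B Q f i / w i) ∧
      ∀ b ∉ Q, ∀ i ∉ Q, k * ((likedCount L B b - 1) / w b) ≤ spending L k B Q f i / w i := by
  classical
  obtain ⟨Q, ⟨f₀, hf₀⟩, hQmax⟩ := Set.exists_max_image
    {Q : Set N | ∃ f, IsMarketState L k w B Q f} Set.ncard (Set.toFinite _)
    ⟨∅, B, isMarketState_empty⟩
  obtain ⟨f, hf, hfmin⟩ := Set.exists_min_image {f : M → N | IsMarketState L k w B Q f}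
    (fun f => balancePotential w (bigSpending L k B Q) (smallCount L Q f)) (Set.toFinite _)
    ⟨f₀, hf₀⟩
  have hf : IsMarketState L k w B Q f := hf
  have noLower : ∀ b ∉ Q,
      (∀ a ∉ Q, (likedCount L B a - 1) / w a ≤ (likedCount L B b - 1) / w b) →
      ¬ ∀ j, 0 < smallCount L Q f j →
        (spending L k B Q f j - 1) / w j < k * ((likedCount L B b - 1) / w b) := by
    intro b hb hmax hsmall
    have h1 := hQmax _ ⟨f, hf.lower hk hw hB hbal hmax hsmall⟩
    refine absurd h1 (not_le.2 (Set.ncard_lt_ncard ?_ (Set.toFinite _)))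
    exact Set.ssubset_iff_subset_ne.2 ⟨Set.subset_union_left, fun heq =>
      hb (heq ▸ Or.inr Relation.ReflTransGen.refl)⟩
  have noMove : ∀ e i, spending L k B Q f i / w i < (spending L k B Q f (f e) - 1) / w (f e) →
      ¬ IsBig L Q e → ¬ IsMarketState L k w B Q (Function.update f e i) := by
    intro e i hlt he hst
    have hri : f e ≠ i := ne_of_div_lt_sub_one_div hw hlt
    have h1 := hfmin _ hst
    rw [balancePotential_shift w _ (smallCount L Q f)
      (smallCount L Q (Function.update f e i)) hri
      fun j => goodCount_update (G := fun e => ¬ IsBig L Q e) he j] at h1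
    simp only [spending] at hlt
    linarith
  have stableQ : ∀ e, ∀ i ∈ Q, ¬ IsBig L Q e → L i e →
      (spending L k B Q f (f e) - 1) / w (f e) ≤ spending L k B Q f i / w i := by
    intro e i hiQ he hie
    by_contra! hlt
    refine noMove e i hlt he (hf.update hk hw he (fun _ => hie) hlt (fun _ j hj => ?_)
      fun _ b hb => (hf.le_spending i hiQ b hb).trans hlt.le)
    exact (hf.small_le i hiQ j hj).trans (mul_le_mul_of_nonneg_left hlt.le (by linarith))
  have existsMax : ∀ b ∉ Q, ∃ b' ∉ Q,
      (∀ a ∉ Q, (likedCount L B a - 1) / w a ≤ (likedCount L B b' - 1) / w b') := fun b hb =>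
    Set.exists_max_image {b | b ∉ Q} (fun a => (likedCount L B a - 1) / w a) (Set.toFinite _)
      ⟨b, hb⟩
  have stableP : ∀ e, ∀ i ∉ Q, ¬ IsBig L Q e →
      (spending L k B Q f (f e) - 1) / w (f e) ≤ spending L k B Q f i / w i := by
    intro e₀ i hiQ he₀
    by_contra! hlt₀
    obtain ⟨e, he, hemax⟩ := Set.exists_max_image {e | ¬ IsBig L Q e}
      (fun e => (spending L k B Q f (f e) - 1) / w (f e)) (Set.toFinite _) ⟨e₀, he₀⟩
    have he : ¬ IsBig L Q e := he
    have hlt := hlt₀.trans_le (hemax e₀ he₀)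
    have hmax : ∀ j, 0 < smallCount L Q f j → (spending L k B Q f j - 1) / w j ≤
        (spending L k B Q f (f e) - 1) / w (f e) := by
      intro j hj
      obtain ⟨g, hg, rfl⟩ := (goodCount_pos_iff _ _ _).1 hj
      exact hemax g hg
    have hpos : 0 < (spending L k B Q f (f e) - 1) / w (f e) :=
      lt_of_le_of_lt (div_nonneg (spending_nonneg hk _ _ _) (hw i).le) hlt
    refine noMove e i hlt he (hf.update hk hw he (fun h => (hiQ h).elim) hlt (fun _ j hj => ?_)
      fun _ b hb => ?_)
    · have := hmax j hj
      nlinarith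
    · by_contra! hbr
      obtain ⟨b', hb', hb'max⟩ := existsMax b hb
      have h1 := hb'max b hb
      refine noLower b' hb' hb'max fun j hj => ?_
      have := hmax j hj
      nlinarith
  refine ⟨Q, f, hf, fun e i he hi => ?_, fun b hb i hi => ?_⟩
  · by_cases hiQ : i ∈ Q
    · exact stableQ e i hiQ he (hi hiQ)
    · exact stableP e i hiQ he
  · by_contra! hlt
    obtain ⟨b', hb', hb'max⟩ := existsMax b hb
    have h1 := mul_le_mul_of_nonneg_left (hb'max b hb) (show 0 ≤ k by linarith)
    refine noLower b' hb' hb'max fun j hj => ?_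
    obtain ⟨g, hg, rfl⟩ := (goodCount_pos_iff _ _ _).1 hj
    have := stableP g i hi hg
    linarith

open Classical in
theorem IsMarketState.sum_price_eq_spending (hB : IsLikerAssignment L B) {Q : Set N} {f : M → N}
    (h : IsMarketState L k w B Q f) (j : N) :
    ∑ e ∈ univ.filter (fun e => f e = j), (if IsBig L Q e then k else 1) =
      spending L k B Q f j := by
  unfold spending bigSpending smallCount likedCount goodCount
  rw [Finset.sum_filter, Finset.mul_sum]
  by_cases hj : j ∈ Q
  · rw [if_pos hj, zero_add]
    refine Finset.sum_congr rfl fun e _ => ?_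
    by_cases he : IsBig L Q e
    · have hne : f e ≠ j := fun hej => h.big_owner e he (h.big_eq e he ▸ hej ▸ hj)
      simp [hne]
    · simp [he]
  · rw [if_neg hj, ← Finset.sum_add_distrib]
    refine Finset.sum_congr rfl fun e _ => ?_
    by_cases he : IsBig L Q e
    · have hex : ∃ i, L i e := he.imp fun _ => And.right
      simp [he, hex, h.big_eq e he]
    · have hne : ¬ ((∃ i, L i e) ∧ B e = j) := by
        rintro ⟨⟨i, hi⟩, rfl⟩
        exact he ⟨B e, hj, hB e i hi⟩
      simp only [if_neg hne, he, if_false, not_false_eq_true, true_and, mul_zero, zero_add]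

end Market

/-- An allocation supported by positive multipliers and prices is fractionally Pareto optimal. -/
theorem isfPO_of_multipliers {N M : Type*} [Fintype N] [Fintype M] [DecidableEq N]
    (v : N → M → ℝ) (f : M → N) (α : N → ℝ) (p : M → ℝ) (hα : ∀ i, 0 < α i)
    (hle : ∀ i e, α i * v i e ≤ p e) (heq : ∀ e, α (f e) * v (f e) e = p e) :
    IsfPO v fun i => univ.filter fun e => f e = i := by
  rintro ⟨x, ⟨hx01, hx1⟩, hdom, i₀, hi₀⟩
  have hlt : ∑ i, α i * ∑ e ∈ univ.filter (fun e => f e = i), v i e <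
      ∑ i, α i * ∑ e, x i e * v i e :=
    Finset.sum_lt_sum (fun i _ => mul_le_mul_of_nonneg_left (hdom i) (hα i).le)
      ⟨i₀, mem_univ _, mul_lt_mul_of_pos_left hi₀ (hα i₀)⟩
  have hleft : ∑ i, α i * ∑ e ∈ univ.filter (fun e => f e = i), v i e = ∑ e, p e := by
    rw [← Finset.sum_fiberwise univ f p]
    refine Finset.sum_congr rfl fun i _ => ?_
    rw [Finset.mul_sum]
    refine Finset.sum_congr rfl fun e he => ?_
    rw [← (Finset.mem_filter.1 he).2, heq]
  have hright : ∑ i, α i * ∑ e, x i e * v i e ≤ ∑ e, p e := by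
    calc ∑ i, α i * ∑ e, x i e * v i e = ∑ e, ∑ i, x i e * (α i * v i e) := by
          rw [Finset.sum_comm]
          refine Finset.sum_congr rfl fun i _ => ?_
          rw [Finset.mul_sum]
          exact Finset.sum_congr rfl fun e _ => by ring
      _ ≤ ∑ e, ∑ i, x i e * p e := Finset.sum_le_sum fun e _ => Finset.sum_le_sum fun i _ =>
          mul_le_mul_of_nonneg_left (hle i e) (hx01 i e).1
      _ = ∑ e, p e := Finset.sum_congr rfl fun e _ => by rw [← Finset.sum_mul, hx1 e, one_mul]
  linarith

/-- For every bivalued instance there exists an allocation that is both WEFX and fPO. -/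
theorem wefx_fpo_exists {N M : Type*} [Fintype N] [Fintype M] [DecidableEq M] [Nonempty N]
    (k : ℝ) (hk : 1 < k)
    (v : N → M → ℝ) (hv : ∀ i e, v i e = 1 ∨ v i e = k)
    (w : N → ℝ) (hw : ∀ i, 0 < w i) (hws : ∑ i : N, w i = 1) :
    ∃ X : N → Finset M, IsAllocation X ∧ IsWEFX v w X ∧ IsfPO v X := by
  classical
  let L : N → M → Prop := fun i e => v i e = k
  obtain ⟨B, hB, hbal⟩ := exists_balanced_assignment (L := L) w hw
  obtain ⟨Q, f, hf, hstable, hbig⟩ := exists_stable_marketState hk hw hB hbal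
  let p : M → ℝ := fun e => if IsBig L Q e then k else 1
  have hp1 : ∀ e, 1 ≤ p e := fun e => by simp only [p]; split_ifs <;> linarith
  have hpbig : ∀ e, IsBig L Q e → p e = k := fun e he => if_pos he
  have hpsmall : ∀ e, ¬ IsBig L Q e → p e = 1 := fun e he => if_neg he
  have hvk : ∀ i e, v i e ≤ k := fun i e => by rcases hv i e with h | h <;> linarith
  have hv1 : ∀ i e, ¬ L i e → v i e = 1 := fun i e h => (hv i e).resolve_right h
  have hvp : ∀ i e, (L i e → IsBig L Q e) → v i e ≤ p e := by
    intro i e h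
    by_cases he : L i e
    · rw [hpbig e (h he)]; exact hvk i e
    · rw [hv1 i e he]; exact hp1 e
  have hvkp : ∀ i e, v i e ≤ k * p e := fun i e => by nlinarith [hvk i e, hp1 e]
  have hownP : ∀ e, f e ∉ Q → v (f e) e = p e := by
    intro e hQ
    by_cases he : IsBig L Q e
    · obtain ⟨i, -, hi⟩ := id he
      rw [hpbig e he, hf.big_eq e he]
      exact hB e i hi
    · rw [hpsmall e he]
      exact hv1 _ _ fun h => he ⟨f e, hQ, h⟩
  have hownQ : ∀ e, f e ∈ Q → v (f e) e = k * p e := by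
    intro e hQ
    have he : ¬ IsBig L Q e := fun he => hf.big_owner e he (hf.big_eq e he ▸ hQ)
    rw [hpsmall e he, mul_one]
    exact hf.small_liked e he hQ
  let X : N → Finset M := fun i => univ.filter fun e => f e = i
  have hmem : ∀ {e i}, e ∈ X i ↔ f e = i := fun {e i} => by simp [X]
  have hpX : ∀ j, ∑ e ∈ X j, p e = spending L k B Q f j := hf.sum_price_eq_spending hB
  have herase : ∀ j, ∀ e ∈ X j, ∑ a ∈ (X j).erase e, p a = spending L k B Q f j - p e := by
    intro j e he
    rw [← hpX j, ← Finset.add_sum_erase _ _ he]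
    ring
  have hXP : ∀ i ∉ Q, ∑ a ∈ X i, v i a = spending L k B Q f i := by
    intro i hi
    rw [← hpX i]
    refine Finset.sum_congr rfl fun e he => ?_
    obtain rfl := hmem.1 he
    exact hownP e hi
  have hXQ : ∀ i ∈ Q, ∑ a ∈ X i, v i a = k * spending L k B Q f i := by
    intro i hi
    rw [← hpX i, Finset.mul_sum]
    refine Finset.sum_congr rfl fun e he => ?_
    obtain rfl := hmem.1 he
    exact hownQ e hi
  have hpure : ∀ j, ∀ e ∈ X j, ¬ 0 < smallCount L Q f j → j ∉ Q ∧
      spending L k B Q f j - p e = k * (likedCount L B j - 1) := by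
    intro j e he hj
    have hbe : IsBig L Q e := by
      by_contra hbe
      exact hj ((goodCount_pos_iff _ _ _).2 ⟨e, hbe, hmem.1 he⟩)
    have hjQ : j ∉ Q := by
      rw [← hmem.1 he, hf.big_eq e hbe]
      exact hf.big_owner e hbe
    have h0 : smallCount L Q f j = 0 := le_antisymm (not_lt.1 hj) (goodCount_nonneg _ _ _)
    refine ⟨hjQ, ?_⟩
    rw [hpbig e hbe, spending, bigSpending, if_neg hjQ, h0]
    ring
  refine ⟨X, ⟨fun i j hij => ?_, fun e => ⟨f e, hmem.2 rfl⟩⟩, fun i j e he => ?_, ?_⟩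
  · refine Finset.disjoint_left.2 fun e hi hj => hij ?_
    rw [← hmem.1 hi, hmem.1 hj]
  · have hle1 : spending L k B Q f j - p e ≤ spending L k B Q f j - 1 := by linarith [hp1 e]
    by_cases hiQ : i ∈ Q
    · rw [hXQ i hiQ, mul_div_assoc]
      by_cases hg : ∃ g ∈ X j, ¬ IsBig L Q g ∧ L i g
      · obtain ⟨g, hgj, hgs, hgi⟩ := hg
        have h1 := hstable g i hgs fun _ => hgi
        rw [hmem.1 hgj] at h1
        have h2 : ∑ a ∈ (X j).erase e, v i a ≤ k * (spending L k B Q f j - 1) := by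
          calc ∑ a ∈ (X j).erase e, v i a ≤ ∑ a ∈ (X j).erase e, k * p a :=
                Finset.sum_le_sum fun a _ => hvkp i a
            _ = k * (spending L k B Q f j - p e) := by rw [← Finset.mul_sum, herase j e he]
            _ ≤ k * (spending L k B Q f j - 1) :=
                mul_le_mul_of_nonneg_left hle1 (by linarith)
        refine (div_le_div_of_nonneg_right h2 (hw j).le).trans ?_
        rw [mul_div_assoc]
        exact mul_le_mul_of_nonneg_left h1 (by linarith)
      · have h2 : ∑ a ∈ (X j).erase e, v i a ≤ spending L k B Q f j - p e := by
          rw [← herase j e he]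
          refine Finset.sum_le_sum fun a ha => hvp i a fun hia => ?_
          by_contra hab
          exact hg ⟨a, Finset.mem_of_mem_erase ha, hab, hia⟩
        by_cases hj : 0 < smallCount L Q f j
        · exact (div_le_div_of_nonneg_right (h2.trans hle1) (hw j).le).trans
            (hf.small_le i hiQ j hj)
        · obtain ⟨hjQ, hS⟩ := hpure j e he hj
          rw [hS] at h2
          refine (div_le_div_of_nonneg_right h2 (hw j).le).trans ?_
          rw [mul_div_assoc]
          exact mul_le_mul_of_nonneg_left (hf.le_spending i hiQ j hjQ) (by linarith)
    · rw [hXP i hiQ]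
      have h2 : ∑ a ∈ (X j).erase e, v i a ≤ spending L k B Q f j - p e := by
        rw [← herase j e he]
        exact Finset.sum_le_sum fun a _ => hvp i a fun hia => ⟨i, hiQ, hia⟩
      by_cases hj : 0 < smallCount L Q f j
      · obtain ⟨g, hgs, rfl⟩ := (goodCount_pos_iff _ _ _).1 hj
        exact (div_le_div_of_nonneg_right (h2.trans hle1) (hw _).le).trans
          (hstable g i hgs fun h => (hiQ h).elim)
      · obtain ⟨hjQ, hS⟩ := hpure j e he hj
        rw [hS] at h2
        refine (div_le_div_of_nonneg_right h2 (hw j).le).trans ?_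
        rw [mul_div_assoc]
        exact hbig j hjQ i hiQ
  · refine isfPO_of_multipliers v f (fun i => if i ∈ Q then 1 else k) (fun e => k * p e)
      (fun i => ?_) (fun i e => ?_) fun e => ?_
    · split_ifs <;> linarith
    · split_ifs with hi
      · rw [one_mul]; exact hvkp i e
      · exact mul_le_mul_of_nonneg_left (hvp i e fun hie => ⟨i, hi, hie⟩) (by linarith)
    · split_ifs with hi
      · rw [one_mul]; exact hownQ e hi
      · rw [hownP e hi]
end

section
/- For every bivalued instance there exist an allocation X and a price vector p such that (X, p) is a Fisher market equilibrium and X is WEFX. -/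
open Finset

/-- The goods that the assignment `a` gives to `j` and that `j` finds big. -/
noncomputable def bigBundle {N M : Type*} [Fintype M] (big : N → M → Prop) (a : M → N) (j : N) :
    Finset M :=
  open Classical in univ.filter fun e => a e = j ∧ big j e

/-- Every good that is big for some agent is assigned to an agent who finds it big. -/
def RespectsBig {N M : Type*} (big : N → M → Prop) (a : M → N) : Prop :=
  ∀ e i, big i e → big (a e) e

/-- Agent `i` finds big some good in the big bundle of `j`. -/
def Desires {N M : Type*} [Fintype M] (big : N → M → Prop) (a : M → N) (i j : N) : Prop :=
  ∃ e ∈ bigBundle big a j, big i e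

lemma mem_bigBundle {N M : Type*} [Fintype M] {big : N → M → Prop} {a : M → N} {j : N} {e : M} :
    e ∈ bigBundle big a j ↔ a e = j ∧ big j e := by
  simp [bigBundle]

lemma reflTransGen_avoiding_start {α : Type*} {R : α → α → Prop} {i j : α}
    (h : Relation.ReflTransGen R i j) :
    Relation.ReflTransGen (fun x y => R x y ∧ y ≠ i) i j := by
  induction h with
  | refl => exact .refl
  | @tail b c _ hbc ih =>
    by_cases hc : c = i
    · rw [hc]
    · exact ih.tail ⟨hbc, hc⟩

lemma card_bigBundle_update {N M : Type*} [Fintype M] [DecidableEq N] [DecidableEq M]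
    {big : N → M → Prop} {a : M → N} {i u : N} {e : M} (hiu : i ≠ u)
    (he : e ∈ bigBundle big a u) (hie : big i e) (h : N) :
    (bigBundle big (Function.update a e i) h).card + (if h = u then 1 else 0) =
      (bigBundle big a h).card + (if h = i then 1 else 0) := by
  rw [mem_bigBundle] at he
  obtain ⟨rfl, hue⟩ := he
  by_cases h1 : h = a e
  · subst h1
    have : bigBundle big (Function.update a e i) (a e) = (bigBundle big a (a e)).erase e := by
      ext f
      simp only [mem_bigBundle, mem_erase, Function.update_apply]
      by_cases hf : f = e <;> simp [hf, hiu]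
    rw [this, if_pos rfl, if_neg (Ne.symm hiu), card_erase_add_one (by simp [mem_bigBundle, hue])]
    rfl
  · by_cases h2 : h = i
    · subst h2
      have : bigBundle big (Function.update a e h) h = insert e (bigBundle big a h) := by
        ext f
        simp only [mem_bigBundle, mem_insert, Function.update_apply]
        by_cases hf : f = e <;> simp [hf, hie]
      rw [this, if_pos rfl, if_neg h1, card_insert_of_notMem (by simp [mem_bigBundle, Ne.symm h1])]
    · have : bigBundle big (Function.update a e i) h = bigBundle big a h := by
        ext f
        simp only [mem_bigBundle, Function.update_apply]
        by_cases hf : f = e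
        · simp [hf, Ne.symm h1, Ne.symm h2]
        · simp [hf]
      simp [this, h1, h2]

/-- Goods can be shifted along a chain of desires, so that the first agent gains one big good and
the last agent loses one. -/
lemma exists_shift {N M : Type*} [Fintype M] [DecidableEq N] {big : N → M → Prop}
    (W : Finset N) : ∀ (a : M → N) (i j : N), RespectsBig big a → i ∉ W →
    Relation.ReflTransGen (fun x y => Desires big a x y ∧ y ∈ W) i j →
    ∃ a' : M → N, RespectsBig big a' ∧ ∀ h,
      (bigBundle big a' h).card + (if h = j then 1 else 0) =
        (bigBundle big a h).card + (if h = i then 1 else 0) := by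
  classical
  induction W using Finset.strongInduction with
  | H W ih =>
    intro a i j ha hi hij
    rcases hij.cases_head with rfl | ⟨u, ⟨⟨e, he, hie⟩, huW⟩, huj⟩
    · exact ⟨a, ha, fun _ => rfl⟩
    have hiu : i ≠ u := fun h => hi (h ▸ huW)
    have ha' : RespectsBig big (Function.update a e i) := by
      intro f l hl
      rw [Function.update_apply]
      split_ifs with hf
      · rwa [hf]
      · exact ha f l hl
    have hreach : Relation.ReflTransGen
        (fun x y => Desires big (Function.update a e i) x y ∧ y ∈ W.erase u) u j := by
      refine Relation.ReflTransGen.mono ?_ _ _ (reflTransGen_avoiding_start huj)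
      rintro x y ⟨⟨⟨f, hf, hxf⟩, hyW⟩, hyu⟩
      refine ⟨⟨f, ?_, hxf⟩, mem_erase.2 ⟨hyu, hyW⟩⟩
      rw [mem_bigBundle] at he hf ⊢
      have hfe : f ≠ e := by
        rintro rfl
        exact hyu (hf.1.symm.trans he.1)
      rwa [Function.update_of_ne hfe]
    obtain ⟨a', hr, hc⟩ := ih _ (erase_ssubset huW) _ u j ha' (notMem_erase u W) hreach
    exact ⟨a', hr, fun h => (hc h).trans (card_bigBundle_update hiu he hie h)⟩

/-- Some assignment of the big goods is balanced along all chains of desires. -/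
lemma exists_balanced {N M : Type*} [Fintype N] [Fintype M] [Nonempty N]
    (big : N → M → Prop) (w : N → ℝ) (hw : ∀ i, 0 < w i) :
    ∃ a : M → N, RespectsBig big a ∧ ∀ i j, Relation.ReflTransGen (Desires big a) i j →
      (((bigBundle big a j).card : ℝ) - 1) / w j ≤ ((bigBundle big a i).card : ℝ) / w i := by
  classical
  let s : Finset (M → N) := univ.filter (RespectsBig big)
  have hs : s.Nonempty := by
    have h : ∀ e : M, ∃ j, ∀ i, big i e → big j e := fun e => by
      by_cases h : ∃ j, big j e
      · exact ⟨h.choose, fun _ _ => h.choose_spec⟩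
      · exact ⟨Classical.arbitrary N, fun i hi => (h ⟨i, hi⟩).elim⟩
    choose a ha using h
    exact ⟨a, mem_filter.2 ⟨mem_univ a, ha⟩⟩
  let F : (M → N) → ℝ := fun a =>
    ∑ h, ((bigBundle big a h).card : ℝ) * ((bigBundle big a h).card - 1) / w h
  obtain ⟨a, has, hmin⟩ := s.exists_min_image F hs
  have ha : RespectsBig big a := by simpa [s] using has
  refine ⟨a, ha, fun i j hij => ?_⟩
  by_cases hne : i = j
  · subst hne
    have := hw i
    gcongr
    linarith
  obtain ⟨a', ha', hc⟩ := exists_shift (univ.erase i) a i j ha (by simp)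
    (Relation.ReflTransGen.mono (fun x y h => ⟨h.1, by simpa using h.2⟩) _ _
      (reflTransGen_avoiding_start hij))
  have hle := hmin a' (by simpa [s] using ha')
  have hdiff : F a' - F a = 2 * (((bigBundle big a i).card : ℝ) / w i) -
      2 * ((((bigBundle big a j).card : ℝ) - 1) / w j) := by
    have key : ∀ h, ((bigBundle big a' h).card : ℝ) * ((bigBundle big a' h).card - 1) / w h -
        ((bigBundle big a h).card : ℝ) * ((bigBundle big a h).card - 1) / w h =
        (if h = i then 2 * (((bigBundle big a i).card : ℝ) / w i) else 0) -
        (if h = j then 2 * ((((bigBundle big a j).card : ℝ) - 1) / w j) else 0) := by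
      intro h
      have e1 : ((bigBundle big a' h).card : ℝ) + (if h = j then 1 else 0) =
        (bigBundle big a h).card + (if h = i then 1 else 0) := by exact_mod_cast hc h
      by_cases h1 : h = i
      · subst h1
        have e2 : ((bigBundle big a' h).card : ℝ) = (bigBundle big a h).card + 1 := by
          simpa [hne] using e1
        simp only [e2, hne, if_true, if_false]
        ring
      · by_cases h2 : h = j
        · subst h2
          have e2 : ((bigBundle big a' h).card : ℝ) = (bigBundle big a h).card - 1 := by
            simp only [h1, if_true, if_false] at e1
            linarith
          simp only [e2, h1, if_true, if_false]
          ring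
        · have e2 : ((bigBundle big a' h).card : ℝ) = (bigBundle big a h).card := by
            simpa [h1, h2] using e1
          simp [e2, h1, h2]
    simp only [F]
    rw [← sum_sub_distrib, sum_congr rfl fun h _ => key h, sum_sub_distrib]
    simp
  linarith

/-- Greedy distribution of `n` units among agents with monotone marginal costs. -/
lemma exists_greedy {N : Type*} [Fintype N] [Nonempty N] (g : N → ℕ → ℝ)
    (hg : ∀ i, Monotone (g i)) (n : ℕ) :
    ∃ c : N → ℕ, ∑ i, c i = n ∧ ∀ i j, 0 < c j → g j (c j - 1) ≤ g i (c i) := by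
  classical
  induction n with
  | zero => exact ⟨0, by simp, by simp⟩
  | succ n ih =>
    obtain ⟨c, hc, hle⟩ := ih
    obtain ⟨m, -, hm⟩ := univ.exists_min_image (fun i => g i (c i)) univ_nonempty
    refine ⟨fun i => c i + if i = m then 1 else 0, by simp [sum_add_distrib, hc], ?_⟩
    intro i j hj
    have hi : g i (c i) ≤ g i (c i + if i = m then 1 else 0) := hg i (by omega)
    refine le_trans ?_ hi
    by_cases hjm : j = m
    · subst hjm
      simpa using hm i (mem_univ i)
    · simp only [hjm, if_false, add_zero] at hj ⊢
      exact hle i j hj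

/-- A finite set can be distributed with prescribed fiber sizes. -/
lemma exists_fibers {N M : Type*} [Fintype N] [DecidableEq N] [Nonempty N] (R : Finset M) :
    ∀ r : N → ℕ, ∑ i, r i = R.card → ∃ b : M → N, ∀ j, (R.filter (b · = j)).card = r j := by
  classical
  induction R using Finset.induction_on with
  | empty =>
    intro r hr
    refine ⟨fun _ => Classical.arbitrary N, fun j => ?_⟩
    simp only [card_empty, sum_eq_zero_iff, mem_univ, true_imp_iff] at hr
    simp [hr j]
  | insert e R he ih =>
    intro r hr
    rw [card_insert_of_notMem he] at hr
    obtain ⟨m, -, hm⟩ : ∃ m ∈ univ, r m ≠ 0 := exists_ne_zero_of_sum_ne_zero (by omega)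
    have hsplit : ∀ j, (r j - if j = m then 1 else 0) + (if j = m then 1 else 0) = r j := by
      intro j
      split_ifs with h
      · subst h
        omega
      · rfl
    obtain ⟨b, hb⟩ := ih (fun j => r j - if j = m then 1 else 0) (by
      have := sum_congr rfl fun j (_ : j ∈ univ) => hsplit j
      rw [sum_add_distrib] at this
      rw [sum_ite_eq' univ m fun _ => 1, if_pos (mem_univ m), hr] at this
      exact Nat.add_right_cancel this)
    refine ⟨Function.update b e m, fun j => ?_⟩
    have hR : R.filter (Function.update b e m · = j) = R.filter (b · = j) :=
      filter_congr fun f hf => by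
        rw [Function.update_of_ne (ne_of_mem_of_not_mem hf he)]
    rw [filter_insert, hR, Function.update_self]
    have h1 := hsplit j
    have h2 := hb j
    by_cases hj : j = m
    · subst hj
      rw [if_pos rfl, card_insert_of_notMem (by simp [he])]
      simp only [if_true] at h1 h2
      omega
    · rw [if_neg (Ne.symm hj)]
      simp only [hj, if_false] at h1 h2
      omega

/-- Prescribed bundle sizes are realised by shrinking or enlarging disjoint given bundles. -/
lemma exists_resized {N M : Type*} [Fintype N] [Fintype M] [DecidableEq N] [Nonempty N]
    (A : N → Finset M) (hA : ∀ i j, i ≠ j → Disjoint (A i) (A j)) (c : N → ℕ)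
    (hc : ∑ i, c i = Fintype.card M) :
    ∃ b : M → N, ∀ j, (univ.filter (b · = j)).card = c j ∧
      (c j ≤ (A j).card → univ.filter (b · = j) ⊆ A j) ∧
      ((A j).card ≤ c j → A j ⊆ univ.filter (b · = j)) := by
  classical
  have hY : ∀ j, ∃ Y ⊆ A j, Y.card = min (c j) (A j).card := fun j =>
    exists_subset_card_eq (min_le_right _ _)
  choose Y hYA hYc using hY
  have hYd : ∀ i j, i ≠ j → Disjoint (Y i) (Y j) := fun i j h =>
    (hA i j h).mono (hYA i) (hYA j)
  have huniq : ∀ {e i j}, e ∈ Y i → e ∈ Y j → i = j := by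
    intro e i j hi hj
    by_contra h
    exact disjoint_left.1 (hYd i j h) hi hj
  let U := univ.biUnion Y
  have hUc : U.card = ∑ j, (Y j).card := card_biUnion fun i _ j _ h => hYd i j h
  obtain ⟨b, hb⟩ := exists_fibers Uᶜ (fun j => c j - (Y j).card) (by
    have h1 : ∑ j, (c j - (Y j).card) + ∑ j, (Y j).card = ∑ j, c j := by
      rw [← sum_add_distrib]
      refine sum_congr rfl fun j _ => ?_
      have := hYc j
      omega
    have h2 := card_add_card_compl U
    omega)
  let b' : M → N := fun e => if h : ∃ j, e ∈ Y j then h.choose else b e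
  have hfib : ∀ j, univ.filter (b' · = j) = Y j ∪ Uᶜ.filter (b · = j) := by
    intro j
    ext e
    simp only [mem_filter, mem_univ, true_and, mem_union, mem_compl, mem_biUnion, U, b']
    by_cases h : ∃ j, e ∈ Y j
    · simp only [h, dif_pos, not_true, false_and, or_false]
      exact ⟨fun hj => hj ▸ h.choose_spec, fun hj => huniq h.choose_spec hj⟩
    · have hj : e ∉ Y j := fun hj => h ⟨j, hj⟩
      simp [h, hj]
  have hcard : ∀ j, (univ.filter (b' · = j)).card = c j := by
    intro j
    rw [hfib, card_union_of_disjoint, hb]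
    · have := hYc j
      omega
    · refine disjoint_left.2 fun e he he' => ?_
      simp only [mem_filter, mem_compl, mem_biUnion, mem_univ, true_and, U] at he'
      exact he'.1 ⟨j, he⟩
  refine ⟨b', fun j => ⟨hcard j, fun h => ?_, fun h => ?_⟩⟩
  · have : Y j = univ.filter (b' · = j) := eq_of_subset_of_card_le
      (by rw [hfib]; exact subset_union_left) (by rw [hcard, hYc]; omega)
    rw [← this]
    exact hYA j
  · have : Y j = A j := eq_of_subset_of_card_le (hYA j) (by rw [hYc]; omega)
    rw [← this, hfib]
    exact subset_union_left

/-- The cost of giving one more good to an agent of weight `w` who holds `n` goods and was assigned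
`x` big ones, where a big good is worth `k` small ones: below `x` goods every good
counts once (the first one is cheapest of all), from `x` goods on the big ones count `k` times. -/
noncomputable def marginalCost (k x w : ℝ) (n : ℕ) : ℝ :=
  if (n : ℝ) < x then (if n = 0 then -1 else n / w) else (k * x + n - x) / w

lemma marginalCost_monotone {k x w : ℝ} (hk : 1 < k) (hx : 0 ≤ x) (hw : 0 < w) :
    Monotone (marginalCost k x w) := by
  intro m n hmn
  have hmn' : (m : ℝ) ≤ n := by exact_mod_cast hmn
  have hm : (0 : ℝ) ≤ m := m.cast_nonneg
  have hkx : 0 ≤ (k - 1) * x := mul_nonneg (by linarith) hx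
  unfold marginalCost
  by_cases h1 : (n : ℝ) < x
  · rw [if_pos h1, if_pos (hmn'.trans_lt h1)]
    split_ifs with h2 h3 h3
    · rfl
    · have : (0 : ℝ) ≤ n / w := by positivity
      linarith
    · omega
    · gcongr
  · rw [if_neg h1]
    split_ifs with h2 h3
    · have : 0 ≤ (k * x + n - x) / w := div_nonneg (by linarith) hw.le
      linarith
    · gcongr
      linarith
    · gcongr

/-- For every bivalued instance there exist an allocation `X` and a positive price
vector `p` such that `(X, p)` is a Fisher market equilibrium and `X` is WEFX. -/
theorem wefx_equilibrium_exists {N M : Type*} [Fintype N] [Fintype M] [DecidableEq M] [Nonempty N]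
    (k : ℝ) (hk : 1 < k)
    (v : N → M → ℝ) (hv : ∀ i e, v i e = 1 ∨ v i e = k)
    (w : N → ℝ) (hw : ∀ i, 0 < w i) (hws : ∑ i : N, w i = 1) :
    ∃ (X : N → Finset M) (p : M → ℝ),
      IsAllocation X ∧ (∀ e, 0 < p e) ∧ IsEquilibrium v p X ∧ IsWEFX v w X := by
  classical
  have hk0 : 0 < k := by linarith
  have hv1 : ∀ i e, 1 ≤ v i e := fun i e => by rcases hv i e with h | h <;> rw [h]; exact hk.le
  have hvk : ∀ i e, v i e ≤ k := fun i e => by rcases hv i e with h | h <;> rw [h]; exact hk.le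
  obtain ⟨a, ha, hbal⟩ := exists_balanced (fun i e => v i e = k) w hw
  set A : N → Finset M := bigBundle (fun i e => v i e = k) a
  have hAk : ∀ {j e}, e ∈ A j → v j e = k := fun h => (mem_bigBundle.1 h).2
  have hAdisj : ∀ {i j e}, e ∈ A i → e ∈ A j → i = j := fun hi hj =>
    (mem_bigBundle.1 hi).1.symm.trans (mem_bigBundle.1 hj).1
  have hAcov : ∀ {i e}, v i e = k → ∃ j, e ∈ A j := fun {i e} h =>
    ⟨a e, mem_bigBundle.2 ⟨rfl, ha e i h⟩⟩
  set D : N → N → Prop := Desires (fun i e => v i e = k) a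
  have hD : ∀ {i j e}, e ∈ A j → v i e = k → D i j := fun he h => ⟨_, he, h⟩
  set x : N → ℝ := fun j => ((A j).card : ℝ)
  have hx0 : ∀ j, 0 ≤ x j := fun j => (A j).card.cast_nonneg
  obtain ⟨c, hcsum, hc⟩ := exists_greedy (fun j => marginalCost k (x j) (w j))
    (fun j => marginalCost_monotone hk (hx0 j) (hw j)) (Fintype.card M)
  obtain ⟨m, -, hm⟩ :=
    univ.exists_min_image (fun j => marginalCost k (x j) (w j) (c j)) univ_nonempty
  obtain ⟨b, hb⟩ := exists_resized A
    (fun i j h => disjoint_left.2 fun e hi hj => h (hAdisj hi hj)) c hcsum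
  set X : N → Finset M := fun j => univ.filter (b · = j) with hX
  have hXc : ∀ j, (X j).card = c j := fun j => (hb j).1
  have hXA : ∀ j, (c j : ℝ) ≤ x j → X j ⊆ A j := fun j h => (hb j).2.1 (Nat.cast_le.1 h)
  have hAX : ∀ j, x j ≤ c j → A j ⊆ X j := fun j h => (hb j).2.2 (Nat.cast_le.1 h)
  set L : ℝ := marginalCost k (x m) (w m) (c m) with hL
  have hlow : ∀ j, L ≤ marginalCost k (x j) (w j) (c j) := fun j => hm j (mem_univ j)
  have hnat : ∀ j, (c j : ℝ) < x j → (c j : ℝ) ≤ x j - 1 := fun j h => by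
    have h' : ((c j + 1 : ℕ) : ℝ) ≤ x j := Nat.cast_le.2 (Nat.cast_lt.1 h)
    push_cast at h'
    linarith
  have hnat' : ∀ j, x j < c j → x j + 1 ≤ c j := fun j h => by
    have hle : (((A j).card + 1 : ℕ) : ℝ) ≤ c j := Nat.cast_le.2 (Nat.cast_lt.1 h)
    rwa [Nat.cast_succ] at hle
  -- Bounds on the threshold `L` in terms of the bundle sizes.
  have hgain : ∀ j, x j < c j → k * x j + c j - 1 - x j ≤ L * w j := by
    intro j h
    have h' := hnat' j h
    have hpos : 0 < c j := by
      have : (0 : ℝ) < c j := (hx0 j).trans_lt h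
      exact_mod_cast this
    have := hc m j hpos
    rw [← hL] at this
    unfold marginalCost at this
    rw [Nat.cast_pred hpos, if_neg (by linarith), div_le_iff₀ (hw j)] at this
    linarith
  have hkeep : ∀ j, x j ≤ c j → L * w j ≤ k * x j + c j - x j := by
    intro j h
    have := hlow j
    unfold marginalCost at this
    rwa [if_neg (not_lt.2 h), le_div_iff₀ (hw j)] at this
  have hlose : ∀ j, (c j : ℝ) < x j → L * w j ≤ c j ∧ (0 ≤ L → 0 < c j) := by
    intro j h
    have h1 := hlow j
    unfold marginalCost at h1
    rw [if_pos h] at h1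
    split_ifs at h1 with h2
    · rw [h2]
      refine ⟨?_, fun h3 => by linarith⟩
      have := hw j
      push_cast
      nlinarith
    · exact ⟨(le_div_iff₀ (hw j)).1 h1, fun _ => Nat.pos_of_ne_zero h2⟩
  have hheld : ∀ j, (c j : ℝ) ≤ x j → 1 < c j → (c j : ℝ) - 1 ≤ L * w j := by
    intro j h h1
    have := hc m j (by omega)
    rw [← hL] at this
    unfold marginalCost at this
    rw [Nat.cast_pred (by omega), if_pos (by linarith), if_neg (by omega),
      div_le_iff₀ (hw j)] at this
    exact this
  -- The agents who may hold small goods, and everyone they reach.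
  let S : N → Prop := fun j =>
    ∃ i, (x i < c i ∨ k * x i < L * w i) ∧ Relation.ReflTransGen D i j
  have hSD : ∀ {i j}, S i → D i j → S j := fun ⟨l, hl, hli⟩ hij => ⟨l, hl, hli.tail hij⟩
  have hSx : ∀ {j}, S j → 0 ≤ L ∧ k * (x j - 1) ≤ L * w j := by
    rintro j ⟨i, hi, hij⟩
    have h1 : k * x i ≤ L * w i := by
      rcases hi with hi | hi
      · linarith [hgain i hi, hnat' i hi]
      · exact hi.le
    have h2 : (x j - 1) / w j ≤ x i / w i := hbal i j hij
    have h3 : k * (x i / w i) ≤ L := by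
      rw [← mul_div_assoc]
      exact (div_le_iff₀ (hw i)).2 h1
    refine ⟨le_trans (mul_nonneg hk0.le (div_nonneg (hx0 i) (hw i).le)) h3, ?_⟩
    rw [← div_le_iff₀ (hw j), mul_div_assoc]
    exact (mul_le_mul_of_nonneg_left h2 hk0.le).trans h3
  have hSc : ∀ {j}, S j → x j ≤ c j := by
    intro j hj
    obtain ⟨hL0, h1⟩ := hSx hj
    by_contra! h
    obtain ⟨h2, h3⟩ := hlose j h
    have h4 : (1 : ℝ) ≤ c j := by exact_mod_cast h3 hL0
    have h5 := hnat j h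
    nlinarith
  have hTc : ∀ {j}, ¬ S j → (c j : ℝ) ≤ x j ∧ L * w j ≤ k * x j := by
    intro j hj
    constructor
    · by_contra! h
      exact hj ⟨j, .inl h, .refl⟩
    · by_contra! h
      exact hj ⟨j, .inr h, .refl⟩
  have hTval : ∀ {i}, ¬ S i → ∑ e ∈ X i, v i e = k * c i := by
    intro i hi
    rw [sum_congr rfl fun e he => hAk (hXA i (hTc hi).1 he), sum_const, hXc, nsmul_eq_mul, mul_comm]
  have hval : ∀ i, L * w i ≤ ∑ e ∈ X i, v i e := by
    intro i
    by_cases hi : S i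
    · have hsub := hAX i (hSc hi)
      have h1 := sum_sdiff (f := v i) hsub
      have h2 : ∑ e ∈ A i, v i e = k * x i := by
        rw [sum_congr rfl fun e he => hAk he, sum_const, nsmul_eq_mul, mul_comm]
      have h3 : ((X i \ A i).card : ℝ) ≤ ∑ e ∈ X i \ A i, v i e := by
        simpa using card_nsmul_le_sum (X i \ A i) (v i) 1 fun e _ => hv1 i e
      have h4 : ((X i \ A i).card : ℝ) = c i - x i := by
        rw [cast_card_sdiff hsub, hXc]
      linarith [hkeep i (hSc hi)]
    · rw [hTval hi]
      rcases (hTc hi).1.lt_or_eq with h | h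
      · have h0 : (0 : ℝ) ≤ c i := (c i).cast_nonneg
        nlinarith [(hlose i h).1]
      · rw [h]
        exact (hTc hi).2
  have hextra : ∀ {j h e}, e ∈ X j → e ∉ A j → e ∈ A h → (c h : ℝ) < x h := by
    intro j h e hej hnj heh
    by_contra! hle
    have h1 := hAX h hle heh
    simp only [hX, mem_filter, mem_univ, true_and] at hej h1
    exact hnj ((h1.symm.trans hej) ▸ heh)
  let p : M → ℝ := fun e => if ∃ j, S j ∧ e ∈ A j then k else 1
  have hp1 : ∀ e, 1 ≤ p e := fun e => by
    simp only [p]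
    split_ifs <;> linarith
  refine ⟨X, p, ⟨fun i j hij => ?_, fun e => ⟨b e, by simp [hX]⟩⟩,
    fun e => one_pos.trans_le (hp1 e), ?_, ?_⟩
  · refine disjoint_left.2 fun e hi hj => hij ?_
    simp only [hX, mem_filter, mem_univ, true_and] at hi hj
    exact hi.symm.trans hj
  · intro i e he e'
    have hp' := hp1 e'
    by_cases hi : S i
    · have h1 : v i e' / p e' ≤ 1 := by
        rw [div_le_one (by linarith)]
        rcases hv i e' with h | h
        · rwa [h]
        · obtain ⟨j, hj⟩ := hAcov h
          have : p e' = k := if_pos ⟨j, hSD hi (hD hj h), hj⟩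
          rw [h, this]
      have h2 : 1 ≤ v i e / p e := by
        rw [one_le_div (by linarith [hp1 e])]
        by_cases hA : e ∈ A i
        · have : p e = k := if_pos ⟨i, hi, hA⟩
          rw [hAk hA, this]
        · have : p e = 1 := if_neg fun ⟨h, hh, heh⟩ =>
            absurd (hSc hh) (not_le.2 (hextra he hA heh))
          rw [this]
          exact hv1 i e
      exact h1.trans h2
    · have hA := hXA i (hTc hi).1 he
      have : p e = 1 := if_neg fun ⟨h, hh, heh⟩ => hi (hAdisj heh hA ▸ hh)
      rw [this, hAk hA, div_one]
      exact (div_le_self (by linarith [hv1 i e']) hp').trans (hvk i e')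
  · intro i j e he
    have hvi := hval i
    have hcj : 0 < c j := by
      rw [← hXc]
      exact card_pos.2 ⟨e, he⟩
    have hcard : (((X j).erase e).card : ℝ) = c j - 1 := by
      rw [card_erase_of_mem he, hXc, Nat.cast_pred hcj]
    have hupper : ∑ f ∈ (X j).erase e, v i f ≤ k * (c j - 1) := by
      have := sum_le_card_nsmul ((X j).erase e) (v i) k fun f _ => hvk i f
      rwa [nsmul_eq_mul, hcard, mul_comm] at this
    have hsuff : ∑ f ∈ (X j).erase e, v i f ≤ L * w j →
        (∑ f ∈ (X j).erase e, v i f) / w j ≤ (∑ f ∈ X i, v i f) / w i := fun h =>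
      ((div_le_iff₀ (hw j)).2 h).trans ((le_div_iff₀ (hw i)).2 hvi)
    have hsuff' : ∀ y : ℝ, ¬ S i → c j - 1 ≤ y * w j → y * w i ≤ c i →
        (∑ f ∈ (X j).erase e, v i f) / w j ≤ (∑ f ∈ X i, v i f) / w i := by
      intro y hi h1 h2
      rw [hTval hi]
      refine le_trans ((div_le_iff₀ (hw j)).2 (?_ : _ ≤ k * y * w j))
        ((le_div_iff₀ (hw i)).2 ?_)
      · nlinarith
      · nlinarith
    by_cases hcj1 : c j = 1
    · have h0 : (X j).erase e = ∅ := by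
        rw [← card_eq_zero, card_erase_of_mem he, hXc, hcj1]
      rw [h0, sum_empty, zero_div]
      exact div_nonneg (sum_nonneg fun f _ => by linarith [hv1 i f]) (hw i).le
    by_cases hj : S j
    · rcases (hSc hj).lt_or_eq with hlt | heq
      · by_cases hex : ∃ f ∈ X j, f ∉ A j ∧ v i f = k
        · obtain ⟨f, hfX, hfA, hfk⟩ := hex
          obtain ⟨h, hfh⟩ := hAcov hfk
          have hch := hextra hfX hfA hfh
          have hi : ¬ S i := fun hi => absurd (hSc (hSD hi (hD hfh hfk))) (not_le.2 hch)
          have h1 : (x h - 1) / w h ≤ x i / w i := hbal i h (.single (hD hfh hfk))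
          have h2 : L ≤ (x h - 1) / w h :=
            (le_div_iff₀ (hw h)).2 ((hlose h hch).1.trans (hnat h hch))
          have h3 : L * w i ≤ x i := (le_div_iff₀ (hw i)).1 (h2.trans h1)
          refine hsuff' L hi ?_ ?_
          · nlinarith [hgain j hlt, hx0 j]
          · rcases (hTc hi).1.lt_or_eq with hl | hl
            · exact (hlose i hl).1
            · rwa [hl]
        · push Not at hex
          apply hsuff
          have hsub := hAX j (hSc hj)
          have h1 := sum_sdiff (f := v i) hsub
          have h2 : ∑ f ∈ A j, v i f ≤ x j * k := by
            simpa using sum_le_card_nsmul (A j) (v i) k fun f _ => hvk i f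
          have h3 : ∑ f ∈ X j \ A j, v i f = c j - x j := by
            rw [sum_congr rfl fun f hf => ((hv i f).resolve_right
              (hex f (mem_sdiff.1 hf).1 (mem_sdiff.1 hf).2)), sum_const, nsmul_one,
              cast_card_sdiff hsub, hXc]
          have h4 := sum_erase_add (X j) (v i) he
          linarith [hgain j hlt, hv1 i e]
      · apply hsuff
        rw [← heq] at hupper
        exact hupper.trans (hSx hj).2
    · have hcx := (hTc hj).1
      have hcL := hheld j hcx (by omega)
      by_cases hex : ∃ f ∈ X j, v i f = k
      · obtain ⟨f, hfX, hfk⟩ := hex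
        have hij := hD (hXA j hcx hfX) hfk
        have hi : ¬ S i := fun hi => hj (hSD hi hij)
        rcases (hTc hi).1.lt_or_eq with hl | hl
        · exact hsuff' L hi hcL (hlose i hl).1
        · have h1 : (x j - 1) / w j ≤ x i / w i := hbal i j (.single hij)
          refine hsuff' (x i / w i) hi ?_ ?_
          · linarith [(div_le_iff₀ (hw j)).1 h1]
          · rw [div_mul_cancel₀ _ (hw i).ne', hl]
      · push Not at hex
        apply hsuff
        rw [sum_congr rfl fun f hf => ((hv i f).resolve_right (hex f (mem_of_mem_erase hf))),
          sum_const, nsmul_one, hcard]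
        exact hcL
end

section
/- For every bivalued instance there exists an allocation X that is both WEQX and fPO. -/
open Finset

section OwnerMaps

variable {N M : Type*} [Fintype M]

open Classical in
/-- The utility of agent `i` when every good `e` is given to agent `a e`. -/
noncomputable def ownerUtility (v : N → M → ℝ) (a : M → N) (i : N) : ℝ :=
  ∑ e : M, if a e = i then v i e else 0

open Classical in
/-- The bundles described by an owner map. -/
noncomputable def ownerBundle (a : M → N) (i : N) : Finset M :=
  univ.filter fun e => a e = i

theorem mem_ownerBundle (a : M → N) (i : N) (e : M) : e ∈ ownerBundle a i ↔ a e = i := by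
  simp [ownerBundle]

theorem sum_ownerBundle (v : N → M → ℝ) (a : M → N) (i : N) :
    ∑ e ∈ ownerBundle a i, v i e = ownerUtility v a i := by
  simp [ownerBundle, ownerUtility, Finset.sum_filter]

theorem isAllocation_ownerBundle (a : M → N) : IsAllocation (ownerBundle a) := by
  refine ⟨fun i j hij => Finset.disjoint_left.2 fun e hi hj => hij ?_,
    fun e => ⟨a e, (mem_ownerBundle a _ e).2 rfl⟩⟩
  rw [mem_ownerBundle] at hi hj
  exact hi.symm.trans hj

open Classical in
theorem ownerUtility_update [DecidableEq M] (v : N → M → ℝ) (a : M → N) (f : M) (j i : N) :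
    ownerUtility v (Function.update a f j) i =
      ownerUtility v a i - (if a f = i then v i f else 0) + (if j = i then v i f else 0) := by
  unfold ownerUtility
  rw [← Finset.add_sum_erase univ _ (mem_univ f),
    ← Finset.add_sum_erase univ (fun e => if a e = i then v i e else 0) (mem_univ f)]
  have h : ∑ e ∈ univ.erase f, (if Function.update a f j e = i then v i e else 0) =
      ∑ e ∈ univ.erase f, (if a e = i then v i e else 0) := by
    refine Finset.sum_congr rfl fun e he => ?_
    rw [Function.update_of_ne (Finset.ne_of_mem_erase he)]
  rw [h, Function.update_self]
  ring

/-- `a` is Pareto optimal among owner maps. -/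
def IsOwnerPO (v : N → M → ℝ) (a : M → N) : Prop :=
  ∀ b : M → N, (∀ i, ownerUtility v a i ≤ ownerUtility v b i) →
    ∀ i, ownerUtility v b i ≤ ownerUtility v a i

/-- An allocation giving each good to an agent of maximal scaled value is fPO. -/
theorem isfPO_of_scaling [Fintype N] (v : N → M → ℝ) (a : M → N) (c : N → ℝ)
    (hc : ∀ i, 0 < c i) (h : ∀ e j, c j * v j e ≤ c (a e) * v (a e) e) :
    IsfPO v (ownerBundle a) := by
  classical
  rintro ⟨x, ⟨hx01, hx1⟩, hle, i₀, hlt⟩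
  have hstrict : ∑ i, c i * ownerUtility v a i < ∑ i, c i * ∑ e, x i e * v i e := by
    refine Finset.sum_lt_sum (fun i _ => ?_) ⟨i₀, mem_univ _, ?_⟩
    · exact mul_le_mul_of_nonneg_left (sum_ownerBundle v a i ▸ hle i) (hc i).le
    · exact mul_lt_mul_of_pos_left (sum_ownerBundle v a i₀ ▸ hlt) (hc i₀)
  have hupper : ∑ i, c i * ∑ e, x i e * v i e ≤ ∑ e, c (a e) * v (a e) e := by
    simp_rw [Finset.mul_sum]
    rw [Finset.sum_comm]
    refine Finset.sum_le_sum fun e _ => ?_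
    calc ∑ i, c i * (x i e * v i e) ≤ ∑ i, x i e * (c (a e) * v (a e) e) := by
          refine Finset.sum_le_sum fun i _ => ?_
          have := mul_le_mul_of_nonneg_left (h e i) (hx01 i e).1
          linarith
      _ = c (a e) * v (a e) e := by rw [← Finset.sum_mul, hx1, one_mul]
  have hself : ∑ i, c i * ownerUtility v a i = ∑ e, c (a e) * v (a e) e := by
    unfold ownerUtility
    simp_rw [Finset.mul_sum]
    rw [Finset.sum_comm]
    refine Finset.sum_congr rfl fun e _ => ?_
    rw [Finset.sum_eq_single (a e)]
    · simp
    · intro i _ hi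
      simp [hi.symm]
    · simp
  linarith

open Classical in
/-- Every agent `t ∈ T` can be given `k` extra units of utility at the cost of one unit for the
owner of a single good `e`, without touching the goods of `t` or of agents outside `T`, save `e`. -/
def IsCheaplyRaisable (v : N → M → ℝ) (k : ℝ) (a : M → N) (T : Finset N) : Prop :=
  ∀ t ∈ T, ∃ (e : M) (b : M → N), v (a e) e = 1 ∧
    (∀ i, ownerUtility v b i =
      ownerUtility v a i - (if a e = i then 1 else 0) + (if t = i then k else 0)) ∧
    ∀ g, b g ≠ a g → g = e ∨ (a g ∈ T ∧ a g ≠ t)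

/-- Agents of a cheaply raisable set own no good that they value at `1`. -/
theorem IsCheaplyRaisable.value_eq {v : N → M → ℝ} {k : ℝ} {a : M → N} {T : Finset N}
    (hT : IsCheaplyRaisable v k a T) (hk : 1 < k) (hv : ∀ i e, v i e = 1 ∨ v i e = k)
    (ha : IsOwnerPO v a) (g : M) (hg : a g ∈ T) : v (a g) g = k := by
  classical
  refine (hv (a g) g).resolve_left fun hg1 => ?_
  obtain ⟨e, b, he, hb, hmove⟩ := hT _ hg
  by_cases hq : a e = a g
  · have h := ha b (fun i => by rw [hb, hq]; split_ifs <;> linarith) (a g)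
    rw [hb, if_pos hq, if_pos rfl] at h
    linarith
  · have hbg : b g = a g := by
      by_contra hne
      rcases hmove g hne with rfl | ⟨-, h⟩
      · exact hq rfl
      · exact h rfl
    have hge : 1 ≤ v (a e) g := by rcases hv (a e) g with h | h <;> linarith
    have hu := fun i => ownerUtility_update v b g (a e) i
    have h := ha (Function.update b g (a e)) (fun i => by
      rw [hu, hb, hbg]
      by_cases h1 : a e = i
      · subst h1
        simp only [if_true, if_neg (Ne.symm hq)]
        linarith
      · by_cases h2 : a g = i
        · subst h2
          simp only [if_true, if_neg hq]
          linarith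
        · simp [h1, h2]) (a g)
    rw [hu, hb, hbg] at h
    simp only [if_true, if_neg hq] at h
    linarith

open Classical in
/-- Adding the agents that value a `1`-good of somebody at `k`. -/
theorem IsCheaplyRaisable.insert_of_gain {v : N → M → ℝ} {k : ℝ} {a : M → N} {T : Finset N}
    (hT : IsCheaplyRaisable v k a T) {t : N} {e : M} (he : v (a e) e = 1)
    (hte : v t e = k) : IsCheaplyRaisable v k a (insert t T) := by
  intro s hs
  rcases Finset.mem_insert.1 hs with rfl | hs
  · refine ⟨e, Function.update a e s, he, fun i => ?_, fun g hg => Or.inl ?_⟩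
    · rw [ownerUtility_update]
      congr 1
      · congr 1
        split_ifs with h
        · rw [← h, he]
        · rfl
      · split_ifs with h
        · rw [← h, hte]
        · rfl
    · by_contra hne
      exact hg (Function.update_of_ne hne _ _)
  · obtain ⟨e', b, h1, h2, h3⟩ := hT s hs
    exact ⟨e', b, h1, h2, fun g hg => (h3 g hg).imp_right
      fun h => ⟨Finset.mem_insert_of_mem h.1, h.2⟩⟩

open Classical in
/-- Adding the agents that value at `k` some `k`-good of a member of `T`. -/
theorem IsCheaplyRaisable.insert_of_transfer {v : N → M → ℝ} {k : ℝ} {a : M → N} {T : Finset N}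
    (hT : IsCheaplyRaisable v k a T) (hk : 1 < k) {t : N} (ht : t ∉ T) {f : M} (hf : a f ∈ T)
    (hfk : v (a f) f = k) (htf : v t f = k) : IsCheaplyRaisable v k a (insert t T) := by
  intro s hs
  rcases Finset.mem_insert.1 hs with rfl | hs
  · obtain ⟨e, b, h1, h2, h3⟩ := hT _ hf
    have hbf : b f = a f := by
      by_contra hne
      rcases h3 f hne with rfl | ⟨-, h⟩
      · linarith
      · exact h rfl
    refine ⟨e, Function.update b f s, h1, fun i => ?_, fun g hg => ?_⟩
    · rw [ownerUtility_update, h2, hbf]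
      have h4 : (if a f = i then v i f else 0) = if a f = i then k else 0 := by
        split_ifs with h
        · rw [← h, hfk]
        · rfl
      have h5 : (if s = i then v i f else 0) = if s = i then k else 0 := by
        split_ifs with h
        · rw [← h, htf]
        · rfl
      rw [h4, h5]
      ring
    · have hmem : ∀ {g}, a g ∈ T → a g ∈ insert s T ∧ a g ≠ s := fun hg =>
        ⟨Finset.mem_insert_of_mem hg, fun h => ht (h ▸ hg)⟩
      by_cases hgf : g = f
      · exact Or.inr (hmem (hgf ▸ hf))
      · rw [Function.update_of_ne hgf] at hg
        exact (h3 g hg).imp_right fun h => hmem h.1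
  · obtain ⟨e', b, h1, h2, h3⟩ := hT s hs
    exact ⟨e', b, h1, h2, fun g hg => (h3 g hg).imp_right
      fun h => ⟨Finset.mem_insert_of_mem h.1, h.2⟩⟩

/-- For bivalued valuations, Pareto optimality implies fractional Pareto optimality. -/
theorem IsOwnerPO.isfPO [Fintype N] {v : N → M → ℝ} {k : ℝ} {a : M → N} (ha : IsOwnerPO v a)
    (hk : 1 < k) (hv : ∀ i e, v i e = 1 ∨ v i e = k) : IsfPO v (ownerBundle a) := by
  classical
  obtain ⟨T, hT⟩ := (Set.toFinite {T : Finset N | IsCheaplyRaisable v k a T}).exists_maximal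
    ⟨∅, fun t ht => absurd ht (Finset.notMem_empty t)⟩
  have hTr : IsCheaplyRaisable v k a T := hT.prop
  have hclosed : ∀ t, IsCheaplyRaisable v k a (insert t T) → t ∈ T := fun t ht =>
    hT.le_of_ge ht (Finset.subset_insert t T) (Finset.mem_insert_self t T)
  have hgain : ∀ e t, v (a e) e = 1 → v t e = k → t ∈ T := fun e t he hte =>
    hclosed t (hTr.insert_of_gain he hte)
  have htransfer : ∀ f t, a f ∈ T → v t f = k → t ∈ T := fun f t hf htf => by
    by_contra ht
    exact ht (hclosed t (hTr.insert_of_transfer hk ht hf (hTr.value_eq hk hv ha f hf) htf))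
  refine isfPO_of_scaling v a (fun i => if i ∈ T then 1 else k)
    (fun i => by split_ifs <;> linarith) fun e j => ?_
  by_cases hi : a e ∈ T
  · rw [if_pos hi, hTr.value_eq hk hv ha e hi]
    rcases hv j e with h | h
    · rw [h]
      split_ifs <;> linarith
    · rw [if_pos (htransfer e j hi h), h]
  · rw [if_neg hi]
    rcases hv (a e) e with h | h
    · rw [h]
      rcases hv j e with h' | h'
      · rw [h']
        split_ifs <;> linarith
      · rw [if_pos (hgain e j h h'), h']
        linarith
    · rw [h]
      rcases hv j e with h' | h' <;> rw [h'] <;> split_ifs <;> nlinarith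

end OwnerMaps

/-- For finitely many reals, `exp (-t * ·)` with a large `t` more than halves from each value to
every larger one. -/
theorem exists_exp_gap {ι : Type*} [Finite ι] (x : ι → ℝ) :
    ∃ t : ℝ, 0 < t ∧ ∀ i j, x i < x j → 2 * Real.exp (-(t * x j)) < Real.exp (-(t * x i)) := by
  have h : ∀ᶠ t : ℝ in Filter.atTop, 0 < t ∧
      ∀ i j, x i < x j → 2 * Real.exp (-(t * x j)) < Real.exp (-(t * x i)) := by
    refine (Filter.eventually_gt_atTop 0).and
      (Filter.eventually_all.2 fun i => Filter.eventually_all.2 fun j => ?_)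
    by_cases hij : x i < x j
    · have hd : 0 < x j - x i := sub_pos.2 hij
      filter_upwards [Filter.eventually_gt_atTop (Real.log 2 / (x j - x i))] with t ht _
      rw [div_lt_iff₀ hd] at ht
      rw [← Real.exp_log (zero_lt_two (α := ℝ)), ← Real.exp_add, Real.exp_lt_exp]
      linarith
    · exact Filter.Eventually.of_forall fun t h => absurd h hij
  exact h.exists

/-- For every bivalued instance there exists an allocation that is both WEQX and fPO. -/
theorem weqx_fpo_exists {N M : Type*} [Fintype N] [Fintype M] [DecidableEq M] [Nonempty N]
    (k : ℝ) (hk : 1 < k)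
    (v : N → M → ℝ) (hv : ∀ i e, v i e = 1 ∨ v i e = k)
    (w : N → ℝ) (hw : ∀ i, 0 < w i) (hws : ∑ i : N, w i = 1) :
    ∃ X : N → Finset M, IsAllocation X ∧ IsWEQX v w X ∧ IsfPO v X := by
  classical
  let x : (M → N) × N → ℝ := fun q => ownerUtility v q.1 q.2 / w q.2
  obtain ⟨t, ht, hgap⟩ := exists_exp_gap x
  obtain ⟨a, ha⟩ := Finite.exists_min fun a : M → N => ∑ i, Real.exp (-(t * x (a, i)))
  have hvpos : ∀ i e, 0 < v i e := fun i e => by rcases hv i e with h | h <;> linarith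
  refine ⟨ownerBundle a, isAllocation_ownerBundle a, ?_, IsOwnerPO.isfPO (k := k) ?_ hk hv⟩
  · intro i j e he
    have hej := (mem_ownerBundle a j e).1 he
    rw [sum_ownerBundle, Finset.sum_erase_eq_sub he, sum_ownerBundle]
    by_contra! hlt
    have hij : i ≠ j := by
      rintro rfl
      rw [div_lt_div_iff_of_pos_right (hw i)] at hlt
      linarith [hvpos i e]
    let b := Function.update a e i
    have hu := fun l => ownerUtility_update v a e i l
    have hbj : x (b, j) = (ownerUtility v a j - v j e) / w j := by
      simp [x, b, hu, hej, hij]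
    have hbi : x (a, i) < x (b, i) := by
      simp only [x, b, hu, hej, if_neg hij.symm, if_true]
      rw [div_lt_div_iff_of_pos_right (hw i)]
      linarith [hvpos i e]
    have h1 := hgap _ _ hbi
    have h2 := hgap (a, i) (b, j) (hbj ▸ hlt)
    have hmin := ha b
    have hsplit : ∀ c : M → N, ∑ l, Real.exp (-(t * x (c, l))) =
        Real.exp (-(t * x (c, i))) + (Real.exp (-(t * x (c, j))) +
          ∑ l ∈ (univ.erase i).erase j, Real.exp (-(t * x (c, l)))) := fun c => by
      rw [Finset.add_sum_erase _ (fun l => Real.exp (-(t * x (c, l))))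
          (Finset.mem_erase.2 ⟨hij.symm, mem_univ j⟩),
        Finset.add_sum_erase _ (fun l => Real.exp (-(t * x (c, l)))) (mem_univ i)]
    have hrest : ∑ l ∈ (univ.erase i).erase j, Real.exp (-(t * x (b, l))) =
        ∑ l ∈ (univ.erase i).erase j, Real.exp (-(t * x (a, l))) := by
      refine Finset.sum_congr rfl fun l hl => ?_
      simp only [Finset.mem_erase] at hl
      simp [x, b, hu, hej, Ne.symm hl.1, Ne.symm hl.2.1]
    rw [hsplit, hsplit, hrest] at hmin
    linarith [Real.exp_pos (-(t * x (a, j)))]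
  · intro b hb i
    by_contra! hlt
    refine absurd (ha b) (not_le.2 (Finset.sum_lt_sum (fun l _ => ?_) ⟨i, mem_univ i, ?_⟩))
    · have := div_le_div_of_nonneg_right (hb l) (hw l).le
      exact Real.exp_le_exp.2 (neg_le_neg (mul_le_mul_of_nonneg_left this ht.le))
    · have := div_lt_div_of_pos_right hlt (hw i)
      exact Real.exp_lt_exp.2 (neg_lt_neg (mul_lt_mul_of_pos_left this ht))
end

section
/- For every bivalued instance there exist an allocation X and a price vector p such that (X, p) is a Fisher market equilibrium and X is WEQX. -/
open Finset

/-- The goods owned by `i` when `f` sends each good to its owner, if it has one. -/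
def ownedGoods {N M : Type*} [Fintype M] [DecidableEq N] (f : M → Option N) (i : N) : Finset M :=
  univ.filter fun e => f e = some i

/-- The value agent `i` has for the goods she owns. -/
def ownWorth {N M : Type*} [Fintype M] [DecidableEq N] (v : N → M → ℝ) (f : M → Option N)
    (i : N) : ℝ :=
  ∑ e ∈ ownedGoods f i, v i e

/-- Agent `a` values highly some good that `b` owns and values highly. -/
def HighEdge {N M : Type*} (k : ℝ) (v : N → M → ℝ) (f : M → Option N) (a b : N) : Prop :=
  ∃ e, v a e = k ∧ f e = some b ∧ v b e = k

/-- Every owned good is valued highly by its owner, and goods in the pool by nobody. -/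
def IsHighAssignment {N M : Type*} (k : ℝ) (v : N → M → ℝ) (f : M → Option N) : Prop :=
  (∀ e j, f e = some j → v j e = k) ∧ ∀ e, f e = none → ∀ a, v a e ≠ k

/-- Giving a good to an agent who does not value it highly creates no new edge. -/
lemma HighEdge.of_update {N M : Type*} [DecidableEq M] {k : ℝ} {v : N → M → ℝ}
    {f : M → Option N} {e : M} {i a b : N} (hi : v i e ≠ k) (h : HighEdge k v (Function.update f e (some i)) a b) :
    HighEdge k v f a b := by
  obtain ⟨c, hc, hcb, hb⟩ := h
  by_cases hce : c = e
  · subst hce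
    simp only [Function.update_self, Option.some.injEq] at hcb
    exact absurd (hcb ▸ hb) hi
  · exact ⟨c, hc, by simpa [Function.update_apply, hce] using hcb, hb⟩

/-- There is a walk of exactly `n` edges in the graph `HighEdge`. -/
def HighWalk {N M : Type*} (k : ℝ) (v : N → M → ℝ) (f : M → Option N) : ℕ → N → N → Prop
  | 0, x, y => x = y
  | n + 1, x, y => ∃ z, HighEdge k v f x z ∧ HighWalk k v f n z y

lemma HighWalk.update {N M : Type*} [DecidableEq M] {k : ℝ} {v : N → M → ℝ}
    {f : M → Option N} {e : M} {a : N} (hea : f e = some a) (x : N) {n : ℕ} {z y : N} (h : HighWalk k v f n z y) :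
    ∃ m ≤ n, HighWalk k v (Function.update f e (some x)) m z y ∨
      HighWalk k v (Function.update f e (some x)) m a y := by
  induction n generalizing z with
  | zero => exact ⟨0, le_rfl, Or.inl h⟩
  | succ n ih =>
    obtain ⟨z', ⟨c, hc, hcz, hzc⟩, h⟩ := h
    obtain ⟨m, hm, h | h⟩ := ih h
    · by_cases hce : c = e
      · subst hce
        obtain rfl : a = z' := by simpa [hea] using hcz
        exact ⟨m, by omega, Or.inr h⟩
      · exact ⟨m + 1, by omega, Or.inl ⟨z', ⟨c, hc, by rwa [Function.update_of_ne hce], hzc⟩, h⟩⟩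
    · exact ⟨m, by omega, Or.inr h⟩

lemma exists_highWalk {N M : Type*} {k : ℝ} {v : N → M → ℝ} {f : M → Option N} {x y : N}
    (h : Relation.ReflTransGen (HighEdge k v f) x y) : ∃ n, HighWalk k v f n x y := by
  induction h using Relation.ReflTransGen.head_induction_on with
  | refl => exact ⟨0, rfl⟩
  | head h _ ih => exact ⟨ih.choose + 1, _, h, ih.choose_spec⟩

/-- The loop invariant of the allocation procedure. Goods without an owner form the pool. The
agents in `H` are those that may own goods they value at `1`; agents outside `H` own only goods
they value at `k`. -/
structure MarketInvariant {N M : Type*} [Fintype M] [DecidableEq N] (k : ℝ) (v : N → M → ℝ)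
    (w : N → ℝ) (f : M → Option N) (H : Finset N) : Prop where
  closed : ∀ a ∈ H, ∀ e, v a e = k → ∃ b ∈ H, f e = some b ∧ v b e = k
  high_outside : ∀ e b, f e = some b → b ∉ H → v b e = k
  pool_low : ∀ e, f e = none → ∀ a, v a e ≠ k
  eqx : ∀ l ∈ H, ∀ e, f e = some l → ∀ x,
    (ownWorth v f l - v l e) / w l ≤ ownWorth v f x / w x
  balanced : ∀ x ∉ H, ∀ y ∉ H, Relation.ReflTransGen (HighEdge k v f) x y →
    (ownWorth v f y - k) / w y ≤ ownWorth v f x / w x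
  misplaced : ∀ x ∉ H, ∀ a e b, Relation.ReflTransGen (HighEdge k v f) x a → v a e = k →
    f e = some b → v b e ≠ k →
    (∀ e', f e' ≠ none) ∧ ∀ l ∉ H, (ownWorth v f l - k) / w l ≤ ownWorth v f x / w x

section BivaluedMarket

variable {N M : Type*} [Fintype M] [DecidableEq N]

lemma mem_ownedGoods {f : M → Option N} {i : N} {e : M} :
    e ∈ ownedGoods f i ↔ f e = some i := by
  simp [ownedGoods]

lemma ownedGoods_update_self [DecidableEq M] (f : M → Option N) (e : M) (i : N) :
    ownedGoods (Function.update f e (some i)) i = insert e (ownedGoods f i) := by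
  ext a
  by_cases h : a = e <;> simp [mem_ownedGoods, h]

lemma ownedGoods_update_of_ne [DecidableEq M] (f : M → Option N) (e : M) {i l : N} (h : l ≠ i) :
    ownedGoods (Function.update f e (some i)) l = (ownedGoods f l).erase e := by
  ext a
  by_cases ha : a = e <;> simp [mem_ownedGoods, ha, h.symm]

lemma ownWorth_update_self [DecidableEq M] (v : N → M → ℝ) {f : M → Option N} {e : M} {i : N}
    (h : f e ≠ some i) :
    ownWorth v (Function.update f e (some i)) i = ownWorth v f i + v i e := by
  rw [ownWorth, ownedGoods_update_self, sum_insert (by simpa [mem_ownedGoods] using h), add_comm,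
    ownWorth]

lemma ownWorth_update_of_owner [DecidableEq M] (v : N → M → ℝ) {f : M → Option N} {e : M}
    {i l : N} (hl : l ≠ i) (h : f e = some l) :
    ownWorth v (Function.update f e (some i)) l = ownWorth v f l - v l e := by
  rw [ownWorth, ownedGoods_update_of_ne f e hl, sum_erase_eq_sub (mem_ownedGoods.2 h), ownWorth]

lemma ownWorth_update_of_not_owner [DecidableEq M] (v : N → M → ℝ) {f : M → Option N} {e : M}
    {i l : N} (hl : l ≠ i) (h : f e ≠ some l) :
    ownWorth v (Function.update f e (some i)) l = ownWorth v f l := by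
  rw [ownWorth, ownedGoods_update_of_ne f e hl, erase_eq_of_notMem (by simpa [mem_ownedGoods]),
    ownWorth]

lemma ownWorth_nonneg {v : N → M → ℝ} (hv : ∀ i e, 0 ≤ v i e) (f : M → Option N) (i : N) :
    0 ≤ ownWorth v f i :=
  sum_nonneg fun e _ => hv i e

/-- Adding everything reachable from a poorest agent to `H` preserves the invariant as long as
there is something left to do. -/
lemma MarketInvariant.union_reachable {k : ℝ} {v : N → M → ℝ} {w : N → ℝ} {f : M → Option N}
    {H C : Finset N} (inv : MarketInvariant k v w f H) {i : N} (hi : i ∉ H)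
    (hmin : ∀ x, ownWorth v f i / w i ≤ ownWorth v f x / w x)
    (hC : ∀ x, x ∈ C ↔ Relation.ReflTransGen (HighEdge k v f) i x)
    (hopen : ¬ ((∀ e, f e ≠ none) ∧
      ∀ l ∉ H, (ownWorth v f l - k) / w l ≤ ownWorth v f i / w i)) :
    MarketInvariant k v w f (H ∪ C) where
  closed a ha e hae := by
    by_cases haH : a ∈ H
    · obtain ⟨b, hb, h⟩ := inv.closed a haH e hae
      exact ⟨b, mem_union_left _ hb, h⟩
    have haC : Relation.ReflTransGen (HighEdge k v f) i a := by
      rw [← hC]; exact (mem_union.1 ha).resolve_left haH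
    rcases hfe : f e with _ | b
    · exact absurd hae (inv.pool_low e hfe a)
    by_cases hb : v b e = k
    · exact ⟨b, mem_union_right _ ((hC b).2 (haC.tail ⟨e, hae, hfe, hb⟩)), rfl, hb⟩
    · exact absurd (inv.misplaced i hi a e b haC hae hfe hb) hopen
  high_outside e b hf hb := inv.high_outside e b hf fun h => hb (mem_union_left _ h)
  pool_low := inv.pool_low
  eqx l hl e hf x := by
    by_cases hlH : l ∈ H
    · exact inv.eqx l hlH e hf x
    · rw [inv.high_outside e l hf hlH]
      exact (inv.balanced i hi l hlH ((hC l).1 ((mem_union.1 hl).resolve_left hlH))).trans (hmin x)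
  balanced x hx y hy h :=
    inv.balanced x (fun h => hx (mem_union_left _ h)) y (fun h => hy (mem_union_left _ h)) h
  misplaced x hx a e b h₁ h₂ h₃ h₄ := by
    obtain ⟨h, h'⟩ := inv.misplaced x (fun h => hx (mem_union_left _ h)) a e b h₁ h₂ h₃ h₄
    exact ⟨h, fun l hl => h' l fun h => hl (mem_union_left _ h)⟩

/-- Giving a good from the pool, or from the richest agent outside `H`, to a poorest agent in `H`
preserves the invariant. -/
lemma MarketInvariant.move [DecidableEq M] {k : ℝ} (hk : 1 < k) {v : N → M → ℝ}
    (hv : ∀ i e, v i e = 1 ∨ v i e = k) {w : N → ℝ} (hw : ∀ i, 0 < w i) {f : M → Option N}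
    {H : Finset N} (inv : MarketInvariant k v w f H) {i : N} (hi : i ∈ H)
    (hmin : ∀ x, ownWorth v f i / w i ≤ ownWorth v f x / w x) {e : M}
    (he : ∀ h ∈ H, f e ≠ some h)
    (hsrc : ∀ j, f e = some j → (∀ e', f e' ≠ none) ∧
      ownWorth v f i / w i < (ownWorth v f j - k) / w j ∧
      ∀ l ∉ H, (ownWorth v f l - k) / w l ≤ (ownWorth v f j - k) / w j) :
    MarketInvariant k v w (Function.update f e (some i)) H := by
  have hlow : ∀ a ∈ H, v a e ≠ k := fun a ha hae => by
    obtain ⟨b, hb, hfb, -⟩ := inv.closed a ha e hae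
    exact he b hb hfb
  have hpos : ∀ i e, 1 ≤ v i e := fun i e => by rcases hv i e with h | h <;> linarith
  have hie : v i e = 1 := (hv i e).resolve_right (hlow i hi)
  have hself := ownWorth_update_self v (he i hi)
  have howner : ∀ j, f e = some j → j ∉ H ∧ j ≠ i ∧
      ownWorth v (Function.update f e (some i)) j = ownWorth v f j - k := fun j hj => by
    have hjH : j ∉ H := fun h => he j h hj
    have hji : j ≠ i := fun h => hjH (h ▸ hi)
    exact ⟨hjH, hji, by rw [ownWorth_update_of_owner v hji hj, inv.high_outside e j hj hjH]⟩
  have hsame : ∀ l, l ≠ i → f e ≠ some l →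
      ownWorth v (Function.update f e (some i)) l = ownWorth v f l :=
    fun l hl h => ownWorth_update_of_not_owner v hl h
  have hmin' : ∀ x, ownWorth v f i / w i ≤
      ownWorth v (Function.update f e (some i)) x / w x := fun x => by
    by_cases hx : x = i
    · subst hx
      rw [hself]
      exact div_le_div_of_nonneg_right (by linarith) (hw x).le
    by_cases hfx : f e = some x
    · rw [(howner x hfx).2.2]
      exact (hsrc x hfx).2.1.le
    · rw [hsame x hx hfx]
      exact hmin x
  have hout : ∀ l ∉ H, (ownWorth v (Function.update f e (some i)) l - k) / w l ≤
      (ownWorth v f l - k) / w l := fun l hl => by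
    refine div_le_div_of_nonneg_right ?_ (hw l).le
    have hli : l ≠ i := fun h => hl (h ▸ hi)
    by_cases hfl : f e = some l
    · rw [(howner l hfl).2.2]; linarith
    · rw [hsame l hli hfl]
  have hreach : ∀ {a b}, Relation.ReflTransGen (HighEdge k v (Function.update f e (some i))) a b →
      Relation.ReflTransGen (HighEdge k v f) a b :=
    fun h => Relation.ReflTransGen.mono (fun _ _ h => h.of_update (hlow i hi)) _ _ h
  constructor
  · intro a ha c hac
    obtain ⟨b, hb, hfc, hbc⟩ := inv.closed a ha c hac
    have hce : c ≠ e := fun h => he b hb (h ▸ hfc)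
    exact ⟨b, hb, by rwa [Function.update_of_ne hce], hbc⟩
  · intro c b hc hb
    by_cases hce : c = e
    · subst hce
      simp only [Function.update_self, Option.some.injEq] at hc
      exact absurd (hc ▸ hi) hb
    · exact inv.high_outside c b (by rwa [Function.update_of_ne hce] at hc) hb
  · intro c hc
    by_cases hce : c = e
    · subst hce
      simp at hc
    · exact inv.pool_low c (by rwa [Function.update_of_ne hce] at hc)
  · intro l hl c hc x
    refine le_trans ?_ (hmin' x)
    by_cases hli : l = i
    · subst hli
      rw [hself, hie]
      exact div_le_div_of_nonneg_right (by linarith [hpos l c]) (hw l).le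
    · have hce : c ≠ e := fun h => by
        subst h
        simp only [Function.update_self, Option.some.injEq] at hc
        exact hli hc.symm
      rw [hsame l hli (he l hl)]
      exact inv.eqx l hl c (by rwa [Function.update_of_ne hce] at hc) i
  · intro x hx y hy hxy
    have hxi : x ≠ i := fun h => hx (h ▸ hi)
    refine (hout y hy).trans ?_
    by_cases hfx : f e = some x
    · rw [(howner x hfx).2.2]
      exact (hsrc x hfx).2.2 y hy
    · rw [hsame x hxi hfx]
      exact inv.balanced x hx y hy (hreach hxy)
  · intro x hx a c b hxa hac hfc hbc
    have hxi : x ≠ i := fun h => hx (h ▸ hi)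
    have hpool : (∀ e', f e' ≠ none) → ∀ e', Function.update f e (some i) e' ≠ none := by
      intro g e'
      by_cases h : e' = e
      · subst h; simp
      · rw [Function.update_of_ne h]; exact g e'
    have key : (∀ e', f e' ≠ none) ∧
        ∀ l ∉ H, (ownWorth v f l - k) / w l ≤ ownWorth v f x / w x := by
      by_cases hce : c = e
      · subst hce
        rcases hfe : f c with _ | j
        · exact absurd hac (inv.pool_low c hfe a)
        obtain ⟨h₁, -, h₂⟩ := hsrc j hfe
        obtain ⟨hjH, -, -⟩ := howner j hfe
        have hxj := (hreach hxa).tail ⟨c, hac, hfe, inv.high_outside c j hfe hjH⟩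
        exact ⟨h₁, fun l hl => (h₂ l hl).trans (inv.balanced x hx j hjH hxj)⟩
      · rw [Function.update_of_ne hce] at hfc
        exact inv.misplaced x hx a c b (hreach hxa) hac hfc hbc
    refine ⟨hpool key.1, fun l hl => (hout l hl).trans ?_⟩
    by_cases hfx : f e = some x
    · rw [(howner x hfx).2.2]
      exact (hsrc x hfx).2.2 l hl
    · rw [hsame x hxi hfx]
      exact key.2 l hl

/-- Running the procedure to its end. -/
lemma MarketInvariant.exists_final [Fintype N] [Nonempty N] [DecidableEq M] {k : ℝ} (hk : 1 < k)
    {v : N → M → ℝ} (hv : ∀ i e, v i e = 1 ∨ v i e = k) {w : N → ℝ} (hw : ∀ i, 0 < w i)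
    {f : M → Option N} {H : Finset N} (inv : MarketInvariant k v w f H) :
    ∃ f' H', MarketInvariant k v w f' H' ∧ (∀ e, f' e ≠ none) ∧
      ∀ l ∉ H', ∀ x, (ownWorth v f' l - k) / w l ≤ ownWorth v f' x / w x := by
  classical
  induction hn : #(Hᶜ) + #{e | ∀ h ∈ H, f e ≠ some h} using Nat.strong_induction_on
    generalizing f H with
  | _ n ih =>
  obtain ⟨i, -, hmin⟩ := exists_min_image univ (fun i => ownWorth v f i / w i) univ_nonempty
  replace hmin := fun x => hmin x (mem_univ x)
  by_cases hdone : (∀ e, f e ≠ none) ∧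
      ∀ l ∉ H, (ownWorth v f l - k) / w l ≤ ownWorth v f i / w i
  · exact ⟨f, H, inv, hdone.1, fun l hl x => (hdone.2 l hl).trans (hmin x)⟩
  by_cases hi : i ∈ H
  · have hstep : ∀ e, (∀ h ∈ H, f e ≠ some h) → (∀ j, f e = some j → (∀ e', f e' ≠ none) ∧
        ownWorth v f i / w i < (ownWorth v f j - k) / w j ∧
        ∀ l ∉ H, (ownWorth v f l - k) / w l ≤ (ownWorth v f j - k) / w j) →
        ∃ f' H', MarketInvariant k v w f' H' ∧ (∀ e, f' e ≠ none) ∧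
          ∀ l ∉ H', ∀ x, (ownWorth v f' l - k) / w l ≤ ownWorth v f' x / w x := by
      intro e he hsrc
      refine ih _ ?_ (inv.move hk hv hw hi hmin he hsrc) rfl
      rw [← hn]
      refine Nat.add_lt_add_left (card_lt_card ?_) _
      rw [Finset.ssubset_iff_of_subset]
      · exact ⟨e, by simpa using he, by simpa using hi⟩
      · intro c hc
        have hce : c ≠ e := fun h => by
          subst h
          simp only [mem_filter, mem_univ, true_and, Function.update_self] at hc
          exact hc i hi rfl
        simpa [Function.update_of_ne hce] using hc
    by_cases hpool : ∀ e, f e ≠ none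
    · have hex : ∃ l ∉ H, ownWorth v f i / w i < (ownWorth v f l - k) / w l := by
        by_contra! h
        exact hdone ⟨hpool, h⟩
      obtain ⟨l, hl, hlt⟩ := hex
      obtain ⟨j, hj, hmax⟩ := exists_max_image Hᶜ (fun l => (ownWorth v f l - k) / w l)
        ⟨l, by simpa using hl⟩
      have hjlt := hlt.trans_le (hmax l (by simpa using hl))
      have hnn : ∀ x, 0 ≤ ownWorth v f x :=
        ownWorth_nonneg (fun i e => by rcases hv i e with h | h <;> rw [h] <;> linarith) f
      have hjpos : 0 < ownWorth v f j := by
        have h := (div_nonneg (hnn i) (hw i).le).trans_lt hjlt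
        rw [div_pos_iff_of_pos_right (hw j)] at h
        linarith
      have hne : (ownedGoods f j).Nonempty := by
        rw [nonempty_iff_ne_empty]
        intro h
        simp [ownWorth, h] at hjpos
      obtain ⟨e, he⟩ := hne
      rw [mem_ownedGoods] at he
      refine hstep e (fun h hh hfe => ?_) fun j' hj' => ?_
      · rw [he, Option.some.injEq] at hfe
        exact (mem_compl.1 hj) (hfe ▸ hh)
      · obtain rfl : j = j' := by simpa [he] using hj'
        exact ⟨hpool, hjlt, fun l hl => hmax l (by simpa using hl)⟩
    · push Not at hpool
      obtain ⟨e, he⟩ := hpool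
      exact hstep e (by simp [he]) (by simp [he])
  · refine ih _ ?_ (inv.union_reachable (C := {x | Relation.ReflTransGen (HighEdge k v f) i x}) hi
      hmin (by simp) hdone) rfl
    rw [← hn]
    refine Nat.add_lt_add_of_lt_of_le (card_lt_card ?_) (card_le_card ?_)
    · rw [Finset.ssubset_iff_of_subset]
      · refine ⟨i, by simpa using hi, ?_⟩
        simp [Relation.ReflTransGen.refl]
      · exact compl_subset_compl.2 subset_union_left
    · intro c hc
      simp only [mem_filter, mem_univ, true_and] at hc ⊢
      exact fun h hh => hc h (mem_union_left _ hh)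

/-- Shifting goods along a walk from `x` to `y` moves one good from `y` to `x`. -/
lemma IsHighAssignment.exists_shift [DecidableEq M] {k : ℝ} {v : N → M → ℝ} {f : M → Option N}
    (hf : IsHighAssignment k v f) {n : ℕ} {x y : N} (h : HighWalk k v f n x y) :
    ∃ f', IsHighAssignment k v f' ∧ ∀ z, #(ownedGoods f' z) + (if z = y then 1 else 0) =
      #(ownedGoods f z) + (if z = x then 1 else 0) := by
  induction n using Nat.strong_induction_on generalizing f x with
  | _ n ih =>
  cases n with
  | zero =>
    obtain rfl : x = y := h
    exact ⟨f, hf, fun _ => rfl⟩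
  | succ n =>
    obtain ⟨a, ⟨e, hxe, hea, -⟩, h⟩ := h
    have hf₁ : IsHighAssignment k v (Function.update f e (some x)) := by
      refine ⟨fun c j hc => ?_, fun c hc => ?_⟩ <;> by_cases hce : c = e
      · subst hce
        obtain rfl : x = j := by simpa using hc
        exact hxe
      · exact hf.1 c j (by rwa [Function.update_of_ne hce] at hc)
      · subst hce
        simp at hc
      · exact hf.2 c (by rwa [Function.update_of_ne hce] at hc)
    obtain ⟨m, hm, h⟩ := h.update hea x
    obtain ⟨f', hf', hcard⟩ := ih m (by omega) hf₁ (h.elim id id)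
    refine ⟨f', hf', fun z => ?_⟩
    rw [hcard]
    by_cases hxa : x = a
    · subst hxa
      rw [Function.update_eq_self_iff.2 hea.symm]
    by_cases hzx : z = x
    · subst hzx
      rw [ownedGoods_update_self, card_insert_of_notMem]
      · simp [hxa]
      · simpa [mem_ownedGoods, hea] using Ne.symm hxa
    · rw [ownedGoods_update_of_ne f e hzx, card_erase_eq_ite]
      by_cases hza : z = a
      · subst hza
        have hmem := mem_ownedGoods.2 hea
        have := card_pos.2 ⟨e, hmem⟩
        simp only [hmem, if_true, hzx, if_false]
        omega
      · have : e ∉ ownedGoods f z := by simpa [mem_ownedGoods, hea] using Ne.symm hza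
        simp [this, hza, hzx]

lemma IsHighAssignment.ownWorth_eq {k : ℝ} {v : N → M → ℝ} {f : M → Option N}
    (hf : IsHighAssignment k v f) (i : N) : ownWorth v f i = #(ownedGoods f i) * k := by
  rw [ownWorth, sum_congr rfl fun e he => hf.1 e i (mem_ownedGoods.1 he), sum_const, nsmul_eq_mul]

/-- A high assignment minimizing a convex potential satisfies the invariant. -/
lemma exists_marketInvariant_empty [Fintype N] [DecidableEq M] {k : ℝ} (hk : 1 < k)
    (v : N → M → ℝ) {w : N → ℝ} (hw : ∀ i, 0 < w i) :
    ∃ f : M → Option N, MarketInvariant k v w f ∅ := by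
  classical
  have hne : (univ.filter fun f : M → Option N => IsHighAssignment k v f).Nonempty := by
    refine ⟨fun e => if h : ∃ a, v a e = k then some h.choose else none, ?_⟩
    simp only [mem_filter, mem_univ, true_and]
    refine ⟨fun e j h => ?_, fun e h a ha => ?_⟩
    · dsimp only at h
      split_ifs at h with hex
      · obtain rfl : hex.choose = j := by simpa using h
        exact hex.choose_spec
    · dsimp only at h
      rw [dif_pos ⟨a, ha⟩] at h
      simp at h
  obtain ⟨f, hf, hmin⟩ := exists_min_image _ (fun f : M → Option N =>
    ∑ z, (#(ownedGoods f z) : ℝ) * (#(ownedGoods f z) - 1) / (2 * w z)) hne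
  simp only [mem_filter, mem_univ, true_and] at hf hmin
  refine ⟨f, by simp, fun e b h _ => hf.1 e b h, hf.2, by simp, fun x _ y _ hxy => ?_,
    fun x _ a e b _ _ h h' => absurd (hf.1 e b h) h'⟩
  rw [hf.ownWorth_eq, hf.ownWorth_eq]
  by_cases hne : x = y
  · subst hne
    exact div_le_div_of_nonneg_right (by linarith) (hw x).le
  obtain ⟨n, hn⟩ := exists_highWalk hxy
  obtain ⟨f', hf', hcard⟩ := hf.exists_shift hn
  have hle := hmin f' hf'
  rw [← sub_nonneg, ← sum_sub_distrib] at hle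
  have hterm : ∀ z, (#(ownedGoods f' z) : ℝ) * (#(ownedGoods f' z) - 1) / (2 * w z) -
      (#(ownedGoods f z) : ℝ) * (#(ownedGoods f z) - 1) / (2 * w z) =
      (if z = x then (#(ownedGoods f z) : ℝ) / w z else 0) -
      (if z = y then ((#(ownedGoods f z) : ℝ) - 1) / w z else 0) := fun z => by
    have hz := congrArg (Nat.cast (R := ℝ)) (hcard z)
    have hwz := (hw z).ne'
    push_cast at hz
    rw [← eq_sub_iff_add_eq] at hz
    rw [hz]
    by_cases hzx : z = x
    · have hzy : z ≠ y := fun h => hne (hzx.symm.trans h)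
      simp only [hzx, hne, if_true, if_false]
      rw [hzx] at hwz
      field_simp
      ring
    · by_cases hzy : z = y
      · simp only [hzy, Ne.symm hne, if_true, if_false]
        rw [hzy] at hwz
        field_simp
        ring
      · simp [hzx, hzy]
  rw [sum_congr rfl fun z _ => hterm z, sum_sub_distrib, sum_ite_eq', sum_ite_eq'] at hle
  simp only [mem_univ, if_true, sub_nonneg] at hle
  calc ((#(ownedGoods f y) : ℝ) * k - k) / w y = k * ((#(ownedGoods f y) - 1) / w y) := by ring
    _ ≤ k * (#(ownedGoods f x) / w x) := by gcongr
    _ = #(ownedGoods f x) * k / w x := by ring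

end BivaluedMarket

/-- For every bivalued instance there exist an allocation `X` and a positive price
vector `p` such that `(X, p)` is a Fisher market equilibrium and `X` is WEQX. -/
theorem weqx_equilibrium_exists {N M : Type*} [Fintype N] [Fintype M] [DecidableEq M] [Nonempty N]
    (k : ℝ) (hk : 1 < k)
    (v : N → M → ℝ) (hv : ∀ i e, v i e = 1 ∨ v i e = k)
    (w : N → ℝ) (hw : ∀ i, 0 < w i) (hws : ∑ i : N, w i = 1) :
    ∃ (X : N → Finset M) (p : M → ℝ),
      IsAllocation X ∧ (∀ e, 0 < p e) ∧ IsEquilibrium v p X ∧ IsWEQX v w X := by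
  classical
  obtain ⟨f₀, inv₀⟩ := exists_marketInvariant_empty hk v hw
  obtain ⟨f, H, inv, hfull, hout⟩ := inv₀.exists_final hk hv hw
  have hk0 : 0 < k := by linarith
  refine ⟨ownedGoods f, fun e => if ∃ a ∈ H, v a e = k then k * k else k, ⟨?_, ?_⟩, ?_, ?_, ?_⟩
  · intro i j hij
    rw [Finset.disjoint_left]
    intro e hi hj
    rw [mem_ownedGoods] at hi hj
    exact hij (Option.some.inj (hi.symm.trans hj))
  · intro e
    obtain ⟨i, hi⟩ := Option.ne_none_iff_exists'.1 (hfull e)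
    exact ⟨i, mem_ownedGoods.2 hi⟩
  · intro e
    dsimp only
    split_ifs <;> positivity
  · intro i e he c
    rw [mem_ownedGoods] at he
    dsimp only
    by_cases hi : i ∈ H
    · have hown : v i e / (if ∃ a ∈ H, v a e = k then k * k else k) = 1 / k := by
        split_ifs with h
        · obtain ⟨a, ha, hae⟩ := h
          obtain ⟨b, -, hb, hbe⟩ := inv.closed a ha e hae
          obtain rfl : i = b := Option.some.inj (he.symm.trans hb)
          rw [hbe]
          field_simp
        · rw [(hv i e).resolve_right fun h' => h ⟨i, hi, h'⟩]
      rw [hown]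
      split_ifs with h
      · rw [div_le_div_iff₀ (by positivity) hk0]
        rcases hv i c with h | h <;> rw [h] <;> nlinarith
      · rw [(hv i c).resolve_right fun h' => h ⟨i, hi, h'⟩]
    · have hown : v i e / (if ∃ a ∈ H, v a e = k then k * k else k) = 1 := by
        rw [if_neg, inv.high_outside e i he hi, div_self hk0.ne']
        rintro ⟨a, ha, hae⟩
        obtain ⟨b, hbH, hb, -⟩ := inv.closed a ha e hae
        obtain rfl : i = b := Option.some.inj (he.symm.trans hb)
        exact hi hbH
      rw [hown]
      split_ifs
      · rw [div_le_one (by positivity)]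
        rcases hv i c with h | h <;> rw [h] <;> nlinarith
      · rw [div_le_one hk0]
        rcases hv i c with h | h <;> rw [h]
        exact hk.le
  · intro i j e he
    rw [sum_erase_eq_sub he]
    have hfe := mem_ownedGoods.1 he
    by_cases hj : j ∈ H
    · exact inv.eqx j hj e hfe i
    · rw [inv.high_outside e j hfe hj]
      exact hout j hj i
end

section
/- Let N be a finite nonempty set of agents with weights w_i > 0, M a finite set of goods, and for each agent i an additive valuation v_i with v_i(e) > 0 for every good e. Let (X, p) be a Fisher market equilibrium. If agent i is pWEFX, i.e. for every agent j and every good e ∈ X_j, p(X_i)/w_i ≥ p(X_j ∖ {e})/w_j, then agent i is WEFX, i.e. for every agent j and every good e ∈ X_j, v_i(X_i)/w_i ≥ v_i(X_j ∖ {e})/w_j. -/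
open Finset

/-- In an equilibrium each agent has an MBB ratio `α`, attained on all of her goods. -/
theorem IsEquilibrium.exists_mbb_ratio {N M : Type*} [Finite M] [Nonempty M] {v : N → M → ℝ}
    {p : M → ℝ} {X : N → Finset M} (heq : IsEquilibrium v p X) (hv : ∀ i e, 0 < v i e)
    (hp : ∀ e, 0 < p e) (i : N) :
    ∃ α : ℝ, 0 < α ∧ (∀ a, v i a ≤ α * p a) ∧ ∀ a ∈ X i, v i a = α * p a := by
  obtain ⟨b, hb⟩ := Finite.exists_max fun a => v i a / p a
  refine ⟨v i b / p b, div_pos (hv i b) (hp b), fun a => (div_le_iff₀ (hp a)).1 (hb a),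
    fun a ha => (div_eq_iff (hp a).ne').1 (le_antisymm (hb a) (heq i a ha b))⟩

/-- In an equilibrium, if agent `i` is pWEFX then `i` is WEFX. -/
theorem pWEFX_implies_WEFX {N M : Type*} [Fintype N] [Fintype M] [DecidableEq M] [Nonempty N]
    (v : N → M → ℝ) (hv : ∀ i e, 0 < v i e)
    (w : N → ℝ) (hw : ∀ i, 0 < w i)
    (X : N → Finset M) (hX : IsAllocation X)
    (p : M → ℝ) (hp : ∀ e, 0 < p e)
    (heq : IsEquilibrium v p X) (i : N)
    (hpwefx : ∀ j : N, ∀ e ∈ X j,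
      (∑ a ∈ (X j).erase e, p a) / w j ≤ (∑ a ∈ X i, p a) / w i) :
    ∀ j : N, ∀ e ∈ X j,
      (∑ a ∈ (X j).erase e, v i a) / w j ≤ (∑ a ∈ X i, v i a) / w i := by
  intro j e he
  have : Nonempty M := ⟨e⟩
  obtain ⟨α, hα, hle, hmbb⟩ := heq.exists_mbb_ratio hv hp i
  calc (∑ a ∈ (X j).erase e, v i a) / w j
      ≤ (∑ a ∈ (X j).erase e, α * p a) / w j :=
        div_le_div_of_nonneg_right (sum_le_sum fun a _ => hle a) (hw j).le
    _ = α * ((∑ a ∈ (X j).erase e, p a) / w j) := by rw [← mul_sum, mul_div_assoc]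
    _ ≤ α * ((∑ a ∈ X i, p a) / w i) := mul_le_mul_of_nonneg_left (hpwefx j e he) hα.le
    _ = (∑ a ∈ X i, v i a) / w i := by rw [sum_congr rfl hmbb, ← mul_sum, mul_div_assoc]
end

section
/- Let N be a finite nonempty set of agents with weights w_i > 0, M a finite set of goods, k > 1 a real number, and for each agent a valuation with values in {1, k}; let p be a price vector with p(e) ∈ {1, k} for every good e, extended additively to bundles. Let i, j, h be agents, X_i and X_j disjoint bundles, and suppose MBB_h ∩ X_j ≠ ∅ and p(X_j ∖ {e})/w_j ≤ p(X_i)/w_i for every good e ∈ MBB_h ∩ X_j. Then p(X_j ∖ {e'})/w_j ≤ p(X_i)/w_i for every good e' ∈ X_j. -/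
open Finset

/-- Good `e` is in the MBB set of an agent with valuation `v` at prices `p`:
its bang-per-buck ratio is maximal. -/
def InMBB {M : Type*} (v p : M → ℝ) (e : M) : Prop :=
  ∀ e' : M, v e' / p e' ≤ v e / p e

/-- If the price-EFX condition holds for every MBB good of agent `h` in bundle `X_j`,
then it holds for every good of `X_j`. -/
theorem pwefx_from_mbb_goods {N M : Type*} [Fintype N] [Fintype M] [DecidableEq M] [Nonempty N]
    (k : ℝ) (hk : 1 < k)
    (v : N → M → ℝ) (hv : ∀ i e, v i e = 1 ∨ v i e = k)
    (w : N → ℝ) (hw : ∀ i, 0 < w i)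
    (p : M → ℝ) (hp : ∀ e, p e = 1 ∨ p e = k)
    (i j h : N) (Xi Xj : Finset M) (hdisj : Disjoint Xi Xj)
    (hne : ∃ e ∈ Xj, InMBB (v h) p e)
    (hyp : ∀ e ∈ Xj, InMBB (v h) p e →
      (∑ a ∈ Xj.erase e, p a) / w j ≤ (∑ a ∈ Xi, p a) / w i) :
    ∀ e' ∈ Xj, (∑ a ∈ Xj.erase e', p a) / w j ≤ (∑ a ∈ Xi, p a) / w i := by
  intro e' he'
  obtain ⟨e, he, hmbb⟩ := hne
  have price_le (a : M) : p a ≤ k := by rcases hp a with ha | ha <;> linarith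
  have of_price_le (hle : p e ≤ p e') :
      (∑ a ∈ Xj.erase e', p a) / w j ≤ (∑ a ∈ Xi, p a) / w i := by
    refine le_trans ?_ (hyp e he hmbb)
    refine div_le_div_of_nonneg_right ?_ (hw j).le
    linarith [add_sum_erase Xj p he, add_sum_erase Xj p he']
  rcases hp e' with hp' | hp'
  · rcases hp e with hpe | hpe
    · exact of_price_le (by rw [hp', hpe])
    · -- An MBB good of price `k` has ratio at most `1`, so a unit-price good is MBB too.
      refine hyp e' he' fun a => (hmbb a).trans ?_
      have hle : v h e ≤ k := by rcases hv h e with hve | hve <;> linarith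
      have hge : 1 ≤ v h e' := by rcases hv h e' with hve | hve <;> linarith
      rw [hpe, hp', div_one]
      exact ((div_le_one (by linarith)).mpr hle).trans hge
  · exact of_price_le (hp' ▸ price_le e)
end

section
/- Let N be a finite nonempty set of agents with weights w_i > 0, M a finite set of goods, k > 1 a real number, and for each agent i an additive valuation v_i with v_i(e) ∈ {1, k} for every good e; let p be a price vector with p(e) ∈ {1, k} for every good e. Let i, j, h be agents and X_i, X_j disjoint bundles such that p(e) = v_j(e) for every e ∈ X_j. Suppose MBB_h ∩ X_j ≠ ∅ and v_j(X_j ∖ {e})/w_j ≤ v_i(X_i)/w_i for every good e ∈ MBB_h ∩ X_j. Then v_j(X_j ∖ {e'})/w_j ≤ v_i(X_i)/w_i for every good e' ∈ X_j. -/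
open Finset

/-- With values and prices in `{1, k}`, a good strictly cheaper than some MBB good is itself
an MBB good. -/
lemma InMBB.of_price_lt {M : Type*} {k : ℝ} (hk : 1 < k) {v p : M → ℝ}
    (hv : ∀ e, v e = 1 ∨ v e = k) (hp : ∀ e, p e = 1 ∨ p e = k) {e e' : M}
    (he : InMBB v p e) (hlt : p e' < p e) : InMBB v p e' := by
  have hpe : p e = k := by
    rcases hp e with h | h <;> rcases hp e' with h' | h' <;> linarith
  have hpe' : p e' = 1 := by
    rcases hp e' with h' | h' <;> linarith
  have hle : v e / p e ≤ v e' / p e' := by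
    have h_ratio : v e / k ≤ 1 := by
      rw [div_le_one (by linarith)]
      rcases hv e with h | h <;> linarith
    rw [hpe, hpe', div_one]
    rcases hv e' with h | h <;> linarith
  exact fun a => (he a).trans hle

/-- If the value-EQX condition holds for every MBB good of agent `h` in bundle `X_j`,
then it holds for every good of `X_j`. -/
theorem weqx_from_mbb_goods {N M : Type*} [Fintype N] [Fintype M] [DecidableEq M] [Nonempty N]
    (k : ℝ) (hk : 1 < k)
    (v : N → M → ℝ) (hv : ∀ i e, v i e = 1 ∨ v i e = k)
    (w : N → ℝ) (hw : ∀ i, 0 < w i)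
    (p : M → ℝ) (hp : ∀ e, p e = 1 ∨ p e = k)
    (i j h : N) (Xi Xj : Finset M) (hdisj : Disjoint Xi Xj)
    (hpv : ∀ e ∈ Xj, p e = v j e)
    (hne : ∃ e ∈ Xj, InMBB (v h) p e)
    (hyp : ∀ e ∈ Xj, InMBB (v h) p e →
      (∑ a ∈ Xj.erase e, v j a) / w j ≤ (∑ a ∈ Xi, v i a) / w i) :
    ∀ e' ∈ Xj, (∑ a ∈ Xj.erase e', v j a) / w j ≤ (∑ a ∈ Xi, v i a) / w i := by
  intro e' he'
  obtain ⟨e, he, hmbb⟩ := hne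
  rcases lt_or_ge (p e') (p e) with hlt | hge
  · exact hyp e' he' (hmbb.of_price_lt hk (hv h) hp hlt)
  · refine le_trans ?_ (hyp e he hmbb)
    rw [hpv e he, hpv e' he'] at hge
    have h_sum := Finset.add_sum_erase Xj (v j) he
    have h_sum' := Finset.add_sum_erase Xj (v j) he'
    exact div_le_div_of_nonneg_right (by linarith) (hw j).le
end

section
/- Let a bivalued instance be given, and assume that for every agent i there exists a good e such that either v_i(e) = k or e is consistently small (i.e. v_{i'}(e) = 1 for all agents i'). Then there exist an allocation X, a price vector p with p(e) ∈ {1, k} for every good e, an integer R ≥ 1, and a partition of N into nonempty groups N_1, …, N_R such that: (1) (X, p) is a Fisher market equilibrium and the MBB ratio α_i = 1 for every agent i; (2) for all r < r', every i ∈ N_r, j ∈ N_{r'} and every e ∈ X_j, v_i(e) = 1; (3) every consistently small good belongs to ∪_{i∈N_1} X_i; (4) for every r, all i, j ∈ N_r and every e ∈ X_j, p(X_i)/w_i ≥ p(X_j ∖ {e})/w_j. -/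
open Finset

open Function Relation

section Load

variable {N M : Type*} [DecidableEq N]

/-- The number of goods of `K` that the assignment `f` gives to agent `x`, as a real number. -/
noncomputable def load (K : Finset M) (f : M → N) (x : N) : ℝ :=
  ∑ e ∈ K, if f e = x then 1 else 0

/-- Some good of `K` assigned to `j` by `f` is acceptable for `i`. -/
def Wants (K : Finset M) (A : N → M → Prop) (f : M → N) (i j : N) : Prop :=
  ∃ e ∈ K, f e = j ∧ A i e

lemma one_le_load {K : Finset M} (f : M → N) {e : M} (he : e ∈ K) : 1 ≤ load K f (f e) := by
  have h := single_le_sum (s := K) (f := fun a => if f a = f e then (1 : ℝ) else 0)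
    (fun a _ => by split_ifs <;> norm_num) he
  rwa [if_pos rfl] at h

lemma load_nonneg (K : Finset M) (f : M → N) (x : N) : 0 ≤ load K f x :=
  sum_nonneg fun a _ => by split_ifs <;> norm_num

lemma load_eq_zero {K : Finset M} {f : M → N} {x : N} (h : ∀ e ∈ K, f e ≠ x) :
    load K f x = 0 :=
  sum_eq_zero fun e he => if_neg (h e he)

lemma load_update [DecidableEq M] {K : Finset M} (f : M → N) {e : M} (he : e ∈ K) (m x : N) :
    load K (update f e m) x =
      load K f x + (if x = m then 1 else 0) - (if x = f e then 1 else 0) := by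
  unfold load
  rw [← add_sum_erase K _ he, ← add_sum_erase K (fun a => if f a = x then (1 : ℝ) else 0) he]
  have h : ∑ a ∈ K.erase e, (if update f e m a = x then (1 : ℝ) else 0) =
      ∑ a ∈ K.erase e, (if f a = x then (1 : ℝ) else 0) :=
    sum_congr rfl fun a ha => by rw [update_of_ne (ne_of_mem_erase ha)]
  rw [h, update_self]
  simp only [eq_comm (a := x)]
  ring

/-- Cut a path at its first visit of the end point. -/
lemma reflTransGen_first_visit {T : Finset N} {E : N → N → Prop} {i j : N}
    (h : ReflTransGen (fun a b => b ∈ T ∧ E a b) i j) :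
    i = j ∨ ∃ m, ReflTransGen (fun a b => b ∈ T.erase j ∧ E a b) i m ∧ j ∈ T ∧ E m j := by
  induction h using ReflTransGen.head_induction_on with
  | refl => exact Or.inl rfl
  | @head a b hab _ ih =>
    right
    by_cases hb : b = j
    · subst hb
      exact ⟨a, .refl, hab⟩
    · obtain rfl | ⟨m, hm, hj⟩ := ih
      · exact absurd rfl hb
      · exact ⟨m, .head ⟨mem_erase.2 ⟨hb, hab.1⟩, hab.2⟩ hm, hj⟩

/-- Along a path of `Wants`, one unit of load can be transferred from the end to the start. -/
lemma exists_transfer_of_path_within [DecidableEq M] {K : Finset M} {A : N → M → Prop}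
    (i : N) (T : Finset N) :
    ∀ (f : M → N) (j : N), (∀ e ∈ K, A (f e) e) →
      ReflTransGen (fun a b => b ∈ T ∧ Wants K A f a b) i j →
      ∃ f' : M → N, (∀ e ∈ K, A (f' e) e) ∧
        ∀ x, load K f' x = load K f x + (if x = i then 1 else 0) - (if x = j then 1 else 0) := by
  induction T using Finset.strongInduction with
  | H T ih =>
    intro f j hf hp
    obtain rfl | ⟨m, hm, hjT, e, he, rfl, hme⟩ := reflTransGen_first_visit hp
    · exact ⟨f, hf, fun x => by ring⟩
    · have hf₁ : ∀ a ∈ K, A (update f e m a) a := by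
        intro a ha
        by_cases hae : a = e
        · subst hae
          simpa using hme
        · simpa [update_of_ne hae] using hf a ha
      obtain ⟨f', hf', hload⟩ := ih (T.erase (f e)) (erase_ssubset hjT) (update f e m) m hf₁
        (ReflTransGen.mono (fun a b hab => by
          obtain ⟨hb, c, hc, rfl, hac⟩ := hab
          refine ⟨hb, c, hc, ?_, hac⟩
          rw [update_of_ne]
          rintro rfl
          exact (mem_erase.1 hb).1 rfl) _ _ hm)
      refine ⟨f', hf', fun x => ?_⟩
      rw [hload, load_update f he]
      ring

variable [Fintype N]

lemma exists_transfer [DecidableEq M] {K : Finset M} {A : N → M → Prop} {f : M → N} {i j : N}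
    (hf : ∀ e ∈ K, A (f e) e) (hp : ReflTransGen (Wants K A f) i j) :
    ∃ f' : M → N, (∀ e ∈ K, A (f' e) e) ∧
      ∀ x, load K f' x = load K f x + (if x = i then 1 else 0) - (if x = j then 1 else 0) :=
  exists_transfer_of_path_within i univ f j hf (ReflTransGen.mono (fun _ _ h => ⟨mem_univ _, h⟩) _ _ hp)

/-- An acceptable assignment in which no agent envies, by more than one good,
an agent that she reaches along `Wants`. -/
lemma exists_balanced_assignment_s10 [DecidableEq M] [Fintype M] (K : Finset M) (A : N → M → Prop)
    (w : N → ℝ) (hw : ∀ i, 0 < w i) (hA : ∃ f : M → N, ∀ e ∈ K, A (f e) e) :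
    ∃ f : M → N, (∀ e ∈ K, A (f e) e) ∧
      ∀ i j, ReflTransGen (Wants K A f) i j → (load K f j - 1) / w j ≤ load K f i / w i := by
  let potential : (M → N) → ℝ := fun f => ∑ x, load K f x * (load K f x - 1) / w x
  obtain ⟨f, hf, hmin⟩ := Set.exists_min_image {f : M → N | ∀ e ∈ K, A (f e) e} potential
    (Set.toFinite _) hA
  refine ⟨f, hf, fun i j hij => ?_⟩
  rcases eq_or_ne i j with rfl | hne
  · have := (hw i).le
    gcongr
    linarith
  obtain ⟨f', hf', hload⟩ := exists_transfer hf hij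
  have hle : potential f ≤ potential f' := hmin f' hf'
  have hdiff : potential f' - potential f =
      2 * (load K f i / w i) - 2 * ((load K f j - 1) / w j) := by
    have hterm : ∀ x, load K f' x * (load K f' x - 1) / w x -
        load K f x * (load K f x - 1) / w x =
        (if x = i then 2 * (load K f x / w x) else 0) -
          (if x = j then 2 * ((load K f x - 1) / w x) else 0) := by
      intro x
      rw [hload]
      by_cases hi : x = i
      · simp only [hi, if_true, if_neg hne]
        ring
      · by_cases hj : x = j
        · simp only [hj, if_true, if_neg hne.symm]
          ring
        · simp only [if_neg hi, if_neg hj]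
          ring
    simp only [potential]
    rw [← sum_sub_distrib, sum_congr rfl fun x _ => hterm x, sum_sub_distrib]
    simp
  linarith

/-- Greedy assignment of unit goods on top of initial values `a`. -/
lemma exists_greedy_assignment [DecidableEq M] [Nonempty N] (a w : N → ℝ) (hw : ∀ i, 0 < w i)
    (S : Finset M) :
    ∃ g : M → N, ∀ e ∈ S, ∀ i,
      (a (g e) + load S g (g e) - 1) / w (g e) ≤ (a i + load S g i) / w i := by
  induction S using Finset.induction_on with
  | empty => exact ⟨fun _ => Classical.arbitrary N, by simp⟩
  | insert b S hb ih =>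
    obtain ⟨g, hg⟩ := ih
    obtain ⟨m, hm⟩ := Finite.exists_min fun i => (a i + load S g i) / w i
    have hload : ∀ x, load (insert b S) (update g b m) x =
        (if m = x then 1 else 0) + load S g x := by
      intro x
      unfold load
      rw [sum_insert hb, update_self]
      congr 1
      exact sum_congr rfl fun c hc => by rw [update_of_ne (ne_of_mem_of_not_mem hc hb)]
    have hmono : ∀ i, (a i + load S g i) / w i ≤
        (a i + load (insert b S) (update g b m) i) / w i := by
      intro i
      have := (hw i).le
      rw [hload]
      gcongr
      split_ifs <;> linarith
    have hstep : ∀ j, (j = m ∨ ∃ e ∈ S, g e = j) → ∀ i,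
        (a j + load (insert b S) (update g b m) j - 1) / w j ≤
          (a i + load (insert b S) (update g b m) i) / w i := by
      intro j hj i
      refine le_trans ?_ (hmono i)
      rw [hload]
      by_cases hjm : m = j
      · subst hjm
        rw [if_pos rfl]
        convert hm i using 2
        ring
      · obtain ⟨e, he, rfl⟩ := hj.resolve_left (Ne.symm hjm)
        rw [if_neg hjm, zero_add]
        exact hg e he i
    refine ⟨update g b m, fun e he i => hstep _ ?_ i⟩
    by_cases heb : e = b
    · subst heb
      exact Or.inl (update_self ..)
    · rw [update_of_ne heb]
      exact Or.inr ⟨e, mem_of_mem_insert_of_ne he heb, rfl⟩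

end Load

/-- The classes of a finite preorder, enumerated along a linear extension. -/
lemma exists_topological_ranking {α : Type*} [Finite α] [Nonempty α] (r : α → α → Prop)
    (hrefl : ∀ a, r a a) (htrans : ∀ a b c, r a b → r b c → r a c) :
    ∃ (R : ℕ) (_ : 0 < R) (rank : α → Fin R), Surjective rank ∧
      (∀ a b, r a b → rank a ≤ rank b) ∧ ∀ a b, rank a = rank b → r a b := by
  classical
  let _ : Preorder α := { le := r, le_refl := hrefl, le_trans := htrans }
  let L := LinearExtension (Antisymmetrization α (· ≤ ·))
  have : Finite L := inferInstanceAs (Finite (Quotient _))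
  let _ : Fintype L := Fintype.ofFinite L
  let cls : α → L := fun a => toLinearExtension (toAntisymmetrization (· ≤ ·) a)
  let iso : Fin (Fintype.card L) ≃o L := monoEquivOfFin L rfl
  have hcls : Surjective cls := fun q => Quotient.exists_rep q
  have : Nonempty L := ⟨cls (Classical.arbitrary α)⟩
  refine ⟨Fintype.card L, Fintype.card_pos, fun a => iso.symm (cls a),
    iso.symm.surjective.comp hcls, fun a b hab => ?_, fun a b hab => ?_⟩
  · exact iso.symm.monotone (toLinearExtension.monotone hab)
  · exact (Quotient.exact (iso.symm.injective hab) : AntisymmRel (· ≤ ·) a b).1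

/-- Properties of the initial equilibrium and agent groups (price version):
there exist an allocation, a price vector with prices in `{1, k}`, and a partition
of the agents into groups `N_1, …, N_R` such that (1) `(X,p)` is an equilibrium with
all MBB ratios equal to `1`, (2) agents in lower groups value goods of higher groups
at `1`, (3) consistently small goods all lie in the first group, and (4) each group is
pWEFX. -/
theorem initial_equilibrium_pwefx {N M : Type*} [Fintype N] [Fintype M] [DecidableEq M] [Nonempty N]
    (k : ℝ) (hk : 1 < k)
    (v : N → M → ℝ) (hv : ∀ i e, v i e = 1 ∨ v i e = k)
    (w : N → ℝ) (hw : ∀ i, 0 < w i) (hws : ∑ i : N, w i = 1)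
    (hgood : ∀ i : N, ∃ e : M, v i e = k ∨ ∀ i' : N, v i' e = 1) :
    ∃ (X : N → Finset M) (p : M → ℝ) (R : ℕ) (hR : 0 < R) (Ngrp : Fin R → Finset N),
      IsAllocation X ∧
      (∀ e, p e = 1 ∨ p e = k) ∧
      (∀ r, (Ngrp r).Nonempty) ∧
      (∀ r r', r ≠ r' → Disjoint (Ngrp r) (Ngrp r')) ∧
      (∀ i : N, ∃ r, i ∈ Ngrp r) ∧
      IsEquilibrium v p X ∧
      (∀ i e, v i e / p e ≤ 1) ∧
      (∀ i : N, ∃ e : M, v i e / p e = 1) ∧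
      (∀ r r' : Fin R, r < r' → ∀ i ∈ Ngrp r, ∀ j ∈ Ngrp r', ∀ e ∈ X j, v i e = 1) ∧
      (∀ e : M, (∀ i, v i e = 1) → ∃ i ∈ Ngrp ⟨0, hR⟩, e ∈ X i) ∧
      (∀ r : Fin R, ∀ i ∈ Ngrp r, ∀ j ∈ Ngrp r, ∀ e ∈ X j,
        (∑ a ∈ (X j).erase e, p a) / w j ≤ (∑ a ∈ X i, p a) / w i) := by
  classical
  let S : Finset M := {e | ∀ i, v i e = 1}
  let K : Finset M := {e | ¬ ∀ i, v i e = 1}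
  have hS : ∀ e, e ∈ S ↔ ∀ i, v i e = 1 := fun e => by simp [S]
  have hK : ∀ e, e ∈ K ↔ e ∉ S := fun e => by simp [K, S]
  let p : M → ℝ := fun e => if e ∈ S then 1 else k
  have hpS : ∀ e ∈ S, p e = 1 := fun e he => if_pos he
  have hpK : ∀ e ∉ S, p e = k := fun e he => if_neg he
  have hp1 : ∀ e, 1 ≤ p e := by
    intro e
    by_cases he : e ∈ S
    · exact (hpS e he).ge
    · exact hk.le.trans (hpK e he).ge
  have hvp : ∀ i e, v i e ≤ p e := by
    intro i e
    by_cases he : e ∈ S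
    · rw [hpS e he, (hS e).1 he i]
    · rw [hpK e he]
      rcases hv i e with h | h <;> linarith
  have hne : ∀ e, p e ≠ 0 := fun e => (one_pos.trans_le (hp1 e)).ne'
  obtain ⟨f, hf, hbal⟩ := exists_balanced_assignment_s10 K (fun i e => v i e = k) w hw (by
    have hex : ∀ e, ∃ i, e ∈ K → v i e = k := by
      intro e
      by_cases he : e ∈ S
      · exact ⟨Classical.arbitrary N, fun h => absurd he ((hK e).1 h)⟩
      · rw [hS] at he
        push Not at he
        obtain ⟨i, hi⟩ := he
        exact ⟨i, fun _ => (hv i e).resolve_left hi⟩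
    choose f hf using hex
    exact ⟨f, hf⟩)
  obtain ⟨g, hg⟩ := exists_greedy_assignment (fun i => k * load K f i) w hw S
  let h : M → N := fun e => if e ∈ S then g e else f e
  have hhS : ∀ e ∈ S, h e = g e := fun e he => if_pos he
  have hhK : ∀ e ∉ S, h e = f e := fun e he => if_neg he
  have hhp : ∀ e, v (h e) e = p e := by
    intro e
    by_cases he : e ∈ S
    · rw [hpS e he, (hS e).1 he]
    · rw [hpK e he, hhK e he, hf e ((hK e).2 he)]
  let X : N → Finset M := fun i => {e | h e = i}
  have hX : ∀ i e, e ∈ X i ↔ h e = i := fun i e => by simp [X]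
  have hprice : ∀ i, ∑ e ∈ X i, p e = k * load K f i + load S g i := by
    intro i
    have hdisj : Disjoint K S := disjoint_left.2 fun e he => (hK e).1 he
    have hunion : (univ : Finset M) = K ∪ S := by
      ext e
      simp [hK, em']
    simp only [X]
    rw [sum_filter, hunion, sum_union hdisj, load, load, mul_sum]
    congr 1
    · refine sum_congr rfl fun e he => ?_
      rw [hhK e ((hK e).1 he), hpK e ((hK e).1 he), mul_ite, mul_one, mul_zero]
    · refine sum_congr rfl fun e he => ?_
      rw [hhS e he, hpS e he]
  let E : N → N → Prop := fun i j => ∃ e, h e = j ∧ v i e = p e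
  have hreach : ∀ i j, ReflTransGen E i j →
      ReflTransGen (Wants K (fun i e => v i e = k) f) i j ∨
        ∃ e ∈ S, ReflTransGen (Wants K (fun i e => v i e = k) f) (g e) j := by
    intro i j hij
    induction hij with
    | refl => exact Or.inl .refl
    | tail _ hbc ih =>
      obtain ⟨e, rfl, hve⟩ := hbc
      by_cases he : e ∈ S
      · rw [hhS e he]
        exact Or.inr ⟨e, he, .refl⟩
      · have hstep := (⟨e, (hK e).2 he, (hhK e he).symm, hve.trans (hpK e he)⟩ :
          Wants K (fun i e => v i e = k) f _ (h e))
        exact ih.imp (·.tail hstep) fun ⟨s, hs, hr⟩ => ⟨s, hs, hr.tail hstep⟩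
  have henvy : ∀ i j, ReflTransGen E i j → ∀ e ∈ X j,
      (∑ a ∈ (X j).erase e, p a) / w j ≤ (∑ a ∈ X i, p a) / w i := by
    intro i j hij e he
    have herase : ∑ a ∈ (X j).erase e, p a = k * load K f j + load S g j - p e := by
      rw [← hprice, ← add_sum_erase _ _ he]
      ring
    have hwi := (hw i).le
    have hwj := (hw j).le
    rw [herase, hprice]
    by_cases hj : ∃ s ∈ S, g s = j
    · obtain ⟨s, hs, rfl⟩ := hj
      refine le_trans ?_ (hg s hs i)
      gcongr
      exact hp1 e
    · push Not at hj
      have heS : e ∉ S := fun hs => hj e hs ((hhS e hs).symm.trans ((hX j e).1 he))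
      rw [load_eq_zero hj, hpK e heS]
      have hscale : ∀ i', ReflTransGen (Wants K (fun i e => v i e = k) f) i' j →
          (k * load K f j + 0 - k) / w j ≤ k * load K f i' / w i' := by
        intro i' hi'
        have := mul_le_mul_of_nonneg_left (hbal i' j hi') (one_pos.trans hk).le
        calc _ = k * ((load K f j - 1) / w j) := by ring
          _ ≤ k * (load K f i' / w i') := this
          _ = _ := by ring
      obtain hr | ⟨s, hs, hr⟩ := hreach i j hij
      · refine (hscale i hr).trans ?_
        gcongr
        linarith [load_nonneg S g i]
      · refine (hscale _ hr).trans (le_trans ?_ (hg s hs i))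
        have := (hw (g s)).le
        gcongr
        linarith [one_le_load g hs]
  obtain ⟨R, hR, rank, hsurj, hmono, hinj⟩ := exists_topological_ranking
    (fun a b => ReflTransGen E b a) (fun _ => .refl) (fun _ _ _ hab hbc => hbc.trans hab)
  have hmbb : ∀ i e, v i e / p e ≤ 1 := fun i e =>
    div_le_one_of_le₀ (hvp i e) (zero_le_one.trans (hp1 e))
  refine ⟨X, p, R, hR, fun r => {i | rank i = r}, ⟨?_, fun e => ⟨h e, by simp [hX]⟩⟩, ?_, ?_, ?_,
    fun i => ⟨rank i, by simp⟩, ?_, hmbb, ?_, ?_, ?_, ?_⟩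
  · intro i j hij
    rw [disjoint_left]
    intro e hi hj
    exact hij (((hX i e).1 hi).symm.trans ((hX j e).1 hj))
  · intro e
    by_cases he : e ∈ S
    · exact Or.inl (hpS e he)
    · exact Or.inr (hpK e he)
  · intro r
    obtain ⟨i, hi⟩ := hsurj r
    exact ⟨i, by simpa using hi⟩
  · intro r r' hrr
    rw [disjoint_left]
    intro i hi hi'
    simp only [mem_filter, mem_univ, true_and] at hi hi'
    exact hrr (hi.symm.trans hi')
  · intro i e he e'
    obtain rfl := (hX i e).1 he
    rw [hhp e, div_self (hne e)]
    exact hmbb _ e'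
  · intro i
    obtain ⟨e, he | he⟩ := hgood i
    · refine ⟨e, ?_⟩
      have heS : e ∉ S := fun hs => by linarith [(hS e).1 hs i]
      rw [he, ← hpK e heS, div_self (hne e)]
    · refine ⟨e, ?_⟩
      rw [he i, hpS e ((hS e).2 he), div_one]
  · intro r r' hrr i hi j hj e he
    simp only [mem_filter, mem_univ, true_and] at hi hj
    refine (hv i e).resolve_right fun hvk => ?_
    have heS : e ∉ S := fun hs => by linarith [(hS e).1 hs i]
    have := hmono j i (.single ⟨e, (hX j e).1 he, hvk.trans (hpK e heS).symm⟩)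
    rw [hi, hj] at this
    exact absurd hrr this.not_gt
  · intro e he
    refine ⟨h e, ?_, (hX _ e).2 rfl⟩
    obtain ⟨i, hi⟩ := hsurj ⟨0, hR⟩
    have := hmono (h e) i (.single ⟨e, rfl, (he i).trans (hpS e ((hS e).2 he)).symm⟩)
    rw [hi] at this
    simp only [mem_filter, mem_univ, true_and]
    exact le_antisymm this (Nat.zero_le _)
  · intro r i hi j hj e he
    simp only [mem_filter, mem_univ, true_and] at hi hj
    exact henvy i j (hinj j i (hj.trans hi.symm)) e he
end

section
/- Let a bivalued instance be given, and assume that for every agent i there exists a good e such that either v_i(e) = k or e is consistently small (i.e. v_{i'}(e) = 1 for all agents i'). Then there exist an allocation X, a price vector p with p(e) ∈ {1, k} for every good e, an integer R ≥ 1, and a partition of N into nonempty groups N_1, …, N_R such that: (1) (X, p) is a Fisher market equilibrium and the MBB ratio α_i = 1 for every agent i; (2) for all r < r', every i ∈ N_r, j ∈ N_{r'} and every e ∈ X_j, v_i(e) = 1; (3) every consistently small good belongs to ∪_{i∈N_1} X_i; (4) for every r, all i, j ∈ N_r and every e ∈ X_j, v_i(X_i)/w_i ≥ v_j(X_j ∖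 {e})/w_j. -/
open Finset

/-- Along a path reaching `j`, one may stop at the first visit to `j`. -/
theorem exists_reflTransGen_avoiding {N : Type*} {r : N → N → Prop} {i j : N}
    (h : Relation.ReflTransGen r i j) (hij : i ≠ j) :
    ∃ m, Relation.ReflTransGen (fun x y => r x y ∧ y ≠ j) i m ∧ r m j := by
  induction h using Relation.ReflTransGen.head_induction_on with
  | refl => exact absurd rfl hij
  | @head b c hbc _ ih =>
    by_cases hc : c = j
    · exact ⟨b, .refl, hc ▸ hbc⟩
    · obtain ⟨m, hm, hmj⟩ := ih hc
      exact ⟨m, hm.head ⟨hbc, hc⟩, hmj⟩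

/-- A relation on a finite nonempty type admits a ranking of its strongly connected components
along which edges never go up. -/
theorem exists_rank_of_relation {N : Type*} [Finite N] [Nonempty N] (r : N → N → Prop) :
    ∃ (R : ℕ) (_ : 0 < R) (f : N → Fin R), Function.Surjective f ∧
      (∀ i j, r i j → f j ≤ f i) ∧ ∀ i j, f i = f j → Relation.ReflTransGen r i j := by
  classical
  let : Preorder N :=
    { le := fun j i => Relation.ReflTransGen r i j
      le_refl := fun _ => .refl
      le_trans := fun _ _ _ hab hbc => hbc.trans hab }
  let L := LinearExtension (Antisymmetrization N (· ≤ ·))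
  have : Finite (Antisymmetrization N (· ≤ ·)) := Quotient.finite _
  let : Fintype L := Fintype.ofFinite (Antisymmetrization N (· ≤ ·))
  let g : N → L := fun i => toLinearExtension (toAntisymmetrization (· ≤ ·) i)
  have hg : Function.Surjective g := fun x => by
    obtain ⟨i, hi⟩ := Quotient.exists_rep (s := AntisymmRel.setoid N (· ≤ ·)) x
    exact ⟨i, hi⟩
  have hL : Nonempty L := ⟨g (Classical.arbitrary N)⟩
  let o := monoEquivOfFin L rfl
  refine ⟨Fintype.card L, Fintype.card_pos, fun i => o.symm (g i),
    o.symm.surjective.comp hg, fun i j hij => ?_, fun i j hij => ?_⟩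
  · refine o.symm.monotone (toLinearExtension.monotone ?_)
    exact toAntisymmetrization_mono (show j ≤ i from .single hij)
  · have h : g i = g j := o.symm.injective hij
    have h' : AntisymmRel (· ≤ ·) i j :=
      Quotient.exact (s := AntisymmRel.setoid N (· ≤ ·)) h
    exact h'.2

section Load

variable {N M : Type*} [Fintype M]

open Classical in
/-- The total weight under `q` of the goods that the owner function `a` gives to agent `i`. -/
noncomputable def ownerLoad (q : M → ℝ) (a : M → N) (i : N) : ℝ :=
  ∑ e with a e = i, q e

open Classical in
theorem ownerLoad_update [DecidableEq M] (q : M → ℝ) (a : M → N) (e : M) (i l : N) :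
    ownerLoad q (Function.update a e i) l =
      ownerLoad q a l + (if l = i then q e else 0) - (if l = a e then q e else 0) := by
  have key : ∀ b : M → N, ownerLoad q b l =
      (if l = b e then q e else 0) + ∑ x ∈ univ.erase e, if b x = l then q x else 0 := by
    intro b
    rw [ownerLoad, sum_filter, ← add_sum_erase _ _ (mem_univ e)]
    simp only [eq_comm]
  rw [key, key a, Function.update_self]
  have : ∑ x ∈ univ.erase e, (if Function.update a e i x = l then q x else 0) =
      ∑ x ∈ univ.erase e, if a x = l then q x else 0 :=
    sum_congr rfl fun x hx => by rw [Function.update_of_ne (ne_of_mem_erase hx)]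
  rw [this]
  ring

/-- A potential that decreases when `c` units move to an agent that stays behind the donor. -/
noncomputable def transferPotential [Fintype N] (w : N → ℝ) (c : ℝ) (V : N → ℝ) : ℝ :=
  ∑ l, V l * (V l - c) / w l

open Classical in
/-- If no transfer of `c` units from `j` to `i` improves the potential, then `j` minus `c` units
is weighted at most as much as `i`. -/
theorem div_le_div_of_transferPotential_le [Fintype N] {w : N → ℝ} {c : ℝ} (hc : 0 < c)
    {V V' : N → ℝ} {i j : N} (hij : i ≠ j)
    (hV : ∀ l, V' l = V l + (if l = i then c else 0) - (if l = j then c else 0))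
    (hle : transferPotential w c V ≤ transferPotential w c V') :
    (V j - c) / w j ≤ V i / w i := by
  have hdiff : transferPotential w c V' - transferPotential w c V =
      2 * c * (V i / w i - (V j - c) / w j) := by
    have hterm : ∀ l, V' l * (V' l - c) / w l - V l * (V l - c) / w l =
        (if l = i then 2 * c * (V i / w i) else 0) -
          (if l = j then 2 * c * ((V j - c) / w j) else 0) := by
      intro l
      rw [hV]
      by_cases hi : l = i
      · subst hi
        simp only [if_true, if_neg hij]
        ring
      · by_cases hj : l = j
        · subst hj
          simp only [if_true, if_neg hi]
          ring
        · simp [hi, hj]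
    rw [transferPotential, transferPotential, ← sum_sub_distrib, sum_congr rfl fun l _ => hterm l,
      sum_sub_distrib]
    simp only [sum_ite_eq', mem_univ, if_true]
    ring
  have : 0 ≤ c * (V i / w i - (V j - c) / w j) := by linarith
  linarith [nonneg_of_mul_nonneg_right this hc]

open Classical in
/-- If `i` reaches `j` by agents that want a good of the next one, then shifting goods along the
path moves one unit from `j` to `i`. -/
theorem exists_shift_along_path [Finite N] (P : N → M → Prop) {q : M → ℝ} {c : ℝ}
    (hq : ∀ i e, P i e → q e = c) (S : Set N) {i j : N} (a : M → N)
    (hP : ∀ e, (∃ l, P l e) → P (a e) e)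
    (h : Relation.ReflTransGen (fun x y => (∃ e, a e = y ∧ P x e) ∧ y ∉ S) i j) (hij : i ≠ j) :
    ∃ a' : M → N, (∀ e, (∃ l, P l e) → P (a' e) e) ∧ ∀ l,
      ownerLoad q a' l = ownerLoad q a l + (if l = i then c else 0) - (if l = j then c else 0) := by
  induction hn : (Sᶜ).ncard using Nat.strong_induction_on generalizing S a j with
  | _ n ih =>
  obtain ⟨m, hm, ⟨e, rfl, hme⟩, hS⟩ := exists_reflTransGen_avoiding h hij
  have hP' : ∀ x, (∃ l, P l x) → P (Function.update a e m x) x := by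
    intro x hx
    by_cases hxe : x = e
    · subst hxe
      simpa using hme
    · simpa [hxe] using hP x hx
  by_cases him : i = m
  · subst him
    refine ⟨_, hP', fun l => ?_⟩
    rw [ownerLoad_update, hq _ _ hme]
  have hpath : Relation.ReflTransGen
      (fun x y => (∃ z, Function.update a e m z = y ∧ P x z) ∧ y ∉ insert (a e) S) i m := by
    refine Relation.ReflTransGen.mono ?_ _ _ hm
    rintro x y ⟨⟨⟨z, rfl, hz⟩, hyS⟩, hne⟩
    refine ⟨⟨z, ?_, hz⟩, by simp [hyS, hne]⟩
    exact Function.update_of_ne (fun hze => hne (by rw [hze])) _ _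
  have hcard : ((insert (a e) S)ᶜ).ncard < n := by
    subst hn
    refine Set.ncard_lt_ncard ⟨Set.compl_subset_compl.2 (Set.subset_insert _ _), fun hsub => ?_⟩
    exact hsub hS (Set.mem_insert _ _)
  obtain ⟨a', ha', hload⟩ := ih _ hcard _ _ hP' hpath him rfl
  refine ⟨a', ha', fun l => ?_⟩
  rw [hload, ownerLoad_update, hq _ _ hme]
  ring

end Load

/-- Properties of the initial equilibrium and agent groups (value version):
as in the pWEFX version, but each group is WEQX. -/
theorem initial_equilibrium_weqx {N M : Type*} [Fintype N] [Fintype M] [DecidableEq M] [Nonempty N]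
    (k : ℝ) (hk : 1 < k)
    (v : N → M → ℝ) (hv : ∀ i e, v i e = 1 ∨ v i e = k)
    (w : N → ℝ) (hw : ∀ i, 0 < w i) (hws : ∑ i : N, w i = 1)
    (hgood : ∀ i : N, ∃ e : M, v i e = k ∨ ∀ i' : N, v i' e = 1) :
    ∃ (X : N → Finset M) (p : M → ℝ) (R : ℕ) (hR : 0 < R) (Ngrp : Fin R → Finset N),
      IsAllocation X ∧
      (∀ e, p e = 1 ∨ p e = k) ∧
      (∀ r, (Ngrp r).Nonempty) ∧
      (∀ r r', r ≠ r' → Disjoint (Ngrp r) (Ngrp r')) ∧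
      (∀ i : N, ∃ r, i ∈ Ngrp r) ∧
      IsEquilibrium v p X ∧
      (∀ i e, v i e / p e ≤ 1) ∧
      (∀ i : N, ∃ e : M, v i e / p e = 1) ∧
      (∀ r r' : Fin R, r < r' → ∀ i ∈ Ngrp r, ∀ j ∈ Ngrp r', ∀ e ∈ X j, v i e = 1) ∧
      (∀ e : M, (∀ i, v i e = 1) → ∃ i ∈ Ngrp ⟨0, hR⟩, e ∈ X i) ∧
      (∀ r : Fin R, ∀ i ∈ Ngrp r, ∀ j ∈ Ngrp r, ∀ e ∈ X j,
        (∑ a ∈ (X j).erase e, v j a) / w j ≤ (∑ a ∈ X i, v i a) / w i) := by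
  classical
  have hk0 : 0 < k := by linarith
  let big : M → Prop := fun e => ∃ i, v i e = k
  let q : M → ℝ := fun e => if big e then k else 0
  let p : M → ℝ := fun e => if big e then k else 1
  have hqp : ∀ e, q e ≤ p e := fun e => by
    by_cases h : big e <;> simp [q, p, h]
  have hp1 : ∀ e, 1 ≤ p e := fun e => by
    by_cases h : big e <;> simp [p, h, hk.le]
  have hsmall : ∀ i e, ¬ big e → v i e = 1 := fun i e h =>
    (hv i e).resolve_right fun hi => h ⟨i, hi⟩
  have hvp : ∀ i e, v i e ≤ p e := fun i e => by
    by_cases h : big e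
    · rcases hv i e with h' | h' <;> simp [p, h, h', hk.le]
    · simp [p, h, hsmall i e h]
  -- A potential-minimizing assignment of the large goods
  have hne₀ : {a : M → N | ∀ e, big e → v (a e) e = k}.Nonempty := by
    refine ⟨fun e => if h : big e then h.choose else Classical.arbitrary N, fun e he => ?_⟩
    simp only [dif_pos he]
    exact he.choose_spec
  obtain ⟨a₀, ha₀, hmin₀⟩ := Set.exists_min_image _
    (fun a : M → N => transferPotential w k (ownerLoad q a)) (Set.toFinite _) hne₀
  obtain ⟨R, hR, f, hfsurj, hfr, hfscc⟩ :=
    exists_rank_of_relation fun i j : N => ∃ e, a₀ e = j ∧ v i e = k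
  have hlarge : ∀ i j, i ≠ j → f i = f j →
      (ownerLoad q a₀ j - k) / w j ≤ ownerLoad q a₀ i / w i := by
    intro i j hij hf
    obtain ⟨b, hb, hload⟩ := exists_shift_along_path (fun i e => v i e = k) (q := q) (c := k)
      (fun i e h => if_pos ⟨i, h⟩) ∅ a₀ ha₀
      (Relation.ReflTransGen.mono (fun x y h => ⟨h, Set.notMem_empty _⟩) _ _ (hfscc i j hf)) hij
    exact div_le_div_of_transferPotential_le hk0 hij hload (hmin₀ b hb)
  -- A potential-minimizing assignment of the small goods inside the first group
  obtain ⟨i₀, hi₀⟩ := hfsurj ⟨0, hR⟩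
  have hne₁ : {a : M → N | ∀ e, (big e → a e = a₀ e) ∧ (¬ big e → f (a e) = ⟨0, hR⟩)}.Nonempty :=
    ⟨fun e => if big e then a₀ e else i₀, fun e => ⟨fun h => by simp [h], fun h => by simp [h, hi₀]⟩⟩
  obtain ⟨a, ha, hmin⟩ := Set.exists_min_image _
    (fun a : M → N => transferPotential w 1 (ownerLoad p a)) (Set.toFinite _) hne₁
  have hva : ∀ e, v (a e) e = p e := fun e => by
    by_cases h : big e
    · rw [(ha e).1 h, ha₀ e h]
      simp [p, h]
    · simp [p, h, hsmall _ e h]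
  have hsmallmove : ∀ i e, ¬ big e → f i = ⟨0, hR⟩ → i ≠ a e →
      (ownerLoad p a (a e) - 1) / w (a e) ≤ ownerLoad p a i / w i := by
    intro i e he hi hne
    refine div_le_div_of_transferPotential_le one_pos hne
      (V' := ownerLoad p (Function.update a e i)) (fun l => ?_) (hmin _ fun x => ?_)
    · rw [ownerLoad_update]
      simp [p, he]
    · by_cases hx : x = e
      · subst hx
        simp [he, hi]
      · simpa [hx] using ha x
  have hqa : ∀ i, ownerLoad q a i = ownerLoad q a₀ i := fun i => by
    rw [ownerLoad, ownerLoad, sum_filter, sum_filter]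
    refine sum_congr rfl fun e _ => ?_
    by_cases h : big e
    · rw [(ha e).1 h]
    · simp [q, h]
  have hqpload : ∀ i, ownerLoad q a i ≤ ownerLoad p a i := fun i => sum_le_sum fun e _ => hqp e
  have hval : ∀ i, ∑ x with a x = i, v i x = ownerLoad p a i := fun i => by
    refine sum_congr (by congr) fun e he => ?_
    rw [← hva, (mem_filter.1 he).2]
  refine ⟨fun i => {e | a e = i}, p, R, hR, fun r => {i | f i = r}, ⟨?_, ?_⟩, ?_, ?_, ?_, ?_,
    ?_, ?_, ?_, ?_, ?_, ?_⟩
  · intro i j hij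
    refine disjoint_filter.2 fun e _ h h' => hij (h.symm.trans h')
  · exact fun e => ⟨a e, by simp⟩
  · intro e
    by_cases h : big e <;> simp [p, h]
  · intro r
    obtain ⟨i, hi⟩ := hfsurj r
    exact ⟨i, by simp [hi]⟩
  · intro r r' hr
    exact disjoint_filter.2 fun e _ h h' => hr (h.symm.trans h')
  · exact fun i => ⟨f i, by simp⟩
  · intro i e he e'
    obtain rfl : a e = i := by simpa using he
    rw [hva, div_self (by linarith [hp1 e])]
    exact div_le_one_of_le₀ (hvp _ _) (by linarith [hp1 e'])
  · exact fun i e => div_le_one_of_le₀ (hvp _ _) (by linarith [hp1 e])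
  · intro i
    obtain ⟨e, he⟩ := hgood i
    refine ⟨e, ?_⟩
    suffices h : v i e = p e by rw [h, div_self (by linarith [hp1 e])]
    rcases he with he | he
    · rw [he, show p e = k from if_pos ⟨i, he⟩]
    · rw [he, show p e = 1 from if_neg fun ⟨l, hl⟩ => by linarith [he l]]
  · intro r r' hr i hi j hj e he
    simp only [mem_filter, mem_univ, true_and] at hi hj he
    refine (hv i e).resolve_right fun hie => ?_
    have := hfr i j ⟨e, by rw [← (ha e).1 ⟨i, hie⟩, he], hie⟩
    rw [hi, hj] at this
    exact absurd hr this.not_gt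
  · intro e he
    refine ⟨a e, ?_, by simp⟩
    simpa using (ha e).2 fun ⟨l, hl⟩ => by linarith [he l]
  · intro r i hi j hj e he
    simp only [mem_filter, mem_univ, true_and] at hi hj
    have hej : a e = j := by simpa using he
    have herase : ∑ x ∈ ({x | a x = j} : Finset M).erase e, v j x = ownerLoad p a j - p e := by
      rw [← hval, ← add_sum_erase _ _ he, ← hva, hej]
      ring
    rw [herase, hval]
    by_cases hij : i = j
    · subst hij
      gcongr
      · exact (hw i).le
      · linarith [hp1 e]
    by_cases hs : ∃ x, a x = j ∧ ¬ big x
    · obtain ⟨x, rfl, hx⟩ := hs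
      refine le_trans ?_ (hsmallmove i x hx (by rw [hi, ← hj, (ha x).2 hx]) hij)
      gcongr
      · exact (hw _).le
      · exact hp1 e
    · push Not at hs
      have hpe : p e = k := if_pos (hs e hej)
      have hload : ownerLoad p a j = ownerLoad q a₀ j := by
        rw [← hqa]
        refine sum_congr rfl fun x hx => ?_
        simp [p, q, hs x (mem_filter.1 hx).2]
      rw [hpe, hload]
      refine (hlarge i j hij (hi.trans hj.symm)).trans ?_
      rw [← hqa]
      gcongr
      · exact (hw i).le
      · exact hqpload i
end

section
/- Let N be a finite nonempty set of agents with weights w_i > 0, M a finite set of goods, for each agent i an additive valuation v_i with v_i(e) > 0 for every good e, k > 0 a real number, and (X, p) a Fisher market equilibrium. Let i, j be agents and e' ∈ X_j a good such that α_i ≥ k·α_{i,e} for every good e ∈ X_j ∖ {e'}, and p(X_i)/w_i ≥ p(X_j ∖ {e'})/(k·w_j). Then v_i(X_i)/w_i ≥ v_i(X_j ∖ {e'})/w_j. -/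
open Finset

/-- If, in an equilibrium, agent `i`'s MBB ratio is at least `k` times her
bang-per-buck ratio on all goods of `X_j ∖ {e'}`, and her spending is at least
`p(X_j ∖ {e'})/(k·w_j)`, then she is WEFX toward `j` up to good `e'`. -/
theorem spending_to_value_bound {N M : Type*} [Fintype N] [Fintype M] [DecidableEq M] [Nonempty N]
    (v : N → M → ℝ) (hv : ∀ i e, 0 < v i e)
    (w : N → ℝ) (hw : ∀ i, 0 < w i)
    (k : ℝ) (hk : 0 < k)
    (X : N → Finset M) (hX : IsAllocation X)
    (p : M → ℝ) (hp : ∀ e, 0 < p e)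
    (heq : IsEquilibrium v p X)
    (i j : N) (e' : M) (he' : e' ∈ X j)
    (halpha : ∀ e ∈ (X j).erase e', k * (v i e / p e) ≤ ⨆ e'' : M, v i e'' / p e'')
    (hprice : (∑ a ∈ (X j).erase e', p a) / (k * w j) ≤ (∑ a ∈ X i, p a) / w i) :
    (∑ a ∈ (X j).erase e', v i a) / w j ≤ (∑ a ∈ X i, v i a) / w i := by
  set α : ℝ := ⨆ e'' : M, v i e'' / p e''
  have hα_nonneg : 0 ≤ α := Real.iSup_nonneg fun e => (div_pos (hv i e) (hp e)).le
  have hown : ∑ a ∈ X i, v i a = α * ∑ a ∈ X i, p a := by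
    rw [mul_sum]
    refine sum_congr rfl fun e he => ?_
    have : Nonempty M := ⟨e⟩
    have hαe : α = v i e / p e :=
      le_antisymm (ciSup_le (heq i e he))
        (le_ciSup (f := fun e'' => v i e'' / p e'') (Set.finite_range _).bddAbove e)
    rw [hαe, div_mul_cancel₀ _ (hp e).ne']
  have hother : k * ∑ a ∈ (X j).erase e', v i a ≤ α * ∑ a ∈ (X j).erase e', p a := by
    rw [mul_sum, mul_sum]
    refine sum_le_sum fun e he => ?_
    have h := halpha e he
    rwa [← mul_div_assoc, div_le_iff₀ (hp e)] at h
  calc (∑ a ∈ (X j).erase e', v i a) / w j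
      = (k * ∑ a ∈ (X j).erase e', v i a) / (k * w j) := (mul_div_mul_left _ _ hk.ne').symm
    _ ≤ (α * ∑ a ∈ (X j).erase e', p a) / (k * w j) :=
        div_le_div_of_nonneg_right hother (mul_pos hk (hw j)).le
    _ = α * ((∑ a ∈ (X j).erase e', p a) / (k * w j)) := mul_div_assoc _ _ _
    _ ≤ α * ((∑ a ∈ X i, p a) / w i) := mul_le_mul_of_nonneg_left hprice hα_nonneg
    _ = (∑ a ∈ X i, v i a) / w i := by rw [hown, mul_div_assoc]
end

section
/- For every bivalued instance with equal weights w_i = 1/|N| there exists an allocation X that is both EFX and fPO; that is, v_i(X_i) ≥ v_i(X_j ∖ {e}) for all agents i, j and every good e ∈ X_j, and no fractional allocation dominates X. -/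
open Finset

open Relation

namespace Bivalued

section Allocation

variable {N M : Type*} [Fintype M]

open Classical in
/-- The bundle of agent `i` when the owner of each good is given by `f`. -/
noncomputable def bundle (f : M → N) (i : N) : Finset M := univ.filter fun e => f e = i

lemma mem_bundle {f : M → N} {i : N} {e : M} : e ∈ bundle f i ↔ f e = i := by
  simp [bundle]

/-- The utility of agent `i` when the owner of each good is given by `f`. -/
noncomputable def utility (v : N → M → ℝ) (f : M → N) (i : N) : ℝ := ∑ e ∈ bundle f i, v i e

/-- Every good is owned by an agent with the largest weighted value for it. -/
def Supported (v : N → M → ℝ) (lam : N → ℝ) (f : M → N) : Prop :=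
  ∀ e b, lam b * v b e ≤ lam (f e) * v (f e) e

/-- Agent `a` owns a good of weighted value `q` whose weighted value for `b` is also `q`. -/
def Step (v : N → M → ℝ) (lam : N → ℝ) (f : M → N) (q : ℝ) (a b : N) : Prop :=
  ∃ g, f g = a ∧ lam a * v a g = q ∧ lam b * v b g = q

lemma bundle_update [DecidableEq M] [DecidableEq N] (f : M → N) (g : M) (c i : N) :
    bundle (Function.update f g c) i =
      if i = c then insert g (bundle f i) else (bundle f i).erase g := by
  ext e
  by_cases h : e = g
  · by_cases h' : i = c
    · simp [mem_bundle, h, h']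
    · simp [mem_bundle, h, h', Ne.symm h']
  · by_cases h' : i = c <;> simp [mem_bundle, h, h']

lemma utility_update_target [DecidableEq M] (v : N → M → ℝ) {f : M → N} {g : M} {c : N} (h : f g ≠ c) :
    utility v (Function.update f g c) c = utility v f c + v c g := by
  classical
  have hg : g ∉ bundle f c := by simpa [mem_bundle] using h
  rw [utility, bundle_update, if_pos rfl, sum_insert hg, add_comm, utility]

lemma utility_update_source [DecidableEq M] (v : N → M → ℝ) {f : M → N} {g : M} {c : N} (h : f g ≠ c) :
    utility v (Function.update f g c) (f g) = utility v f (f g) - v (f g) g := by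
  classical
  have hg : g ∈ bundle f (f g) := by simp [mem_bundle]
  rw [utility, bundle_update, if_neg h, sum_erase_eq_sub hg, utility]

lemma utility_update_of_ne [DecidableEq M] (v : N → M → ℝ) {f : M → N} {g : M} {c i : N} (hc : i ≠ c)
    (hg : i ≠ f g) : utility v (Function.update f g c) i = utility v f i := by
  classical
  have hg' : g ∉ bundle f i := by simpa [mem_bundle] using hg.symm
  rw [utility, bundle_update, if_neg hc, erase_eq_of_notMem hg', utility]

/-- A path between distinct vertices may be chosen never to return to its origin. -/
lemma exists_step_avoiding_source {α : Type*} {r : α → α → Prop} {j i : α}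
    (h : ReflTransGen r j i) (hij : j ≠ i) :
    ∃ c, r j c ∧ ReflTransGen (fun a b => r a b ∧ a ≠ j) c i := by
  induction h with
  | refl => exact absurd rfl hij
  | @tail b i _ hbi ih =>
    by_cases hb : j = b
    · subst hb
      exact ⟨i, hbi, .refl⟩
    · obtain ⟨c, hjc, hc⟩ := ih hb
      exact ⟨c, hjc, hc.tail ⟨hbi, Ne.symm hb⟩⟩

/-- Goods of weighted value `q` can be passed along a path, without changing the utilities of the
intermediate agents. -/
lemma exists_transfer (v : N → M → ℝ) (lam : N → ℝ) (q : ℝ) (A : Finset N) :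
    ∀ (f : M → N) (j i : N), Supported v lam f → j ≠ i →
      ReflTransGen (fun a b => Step v lam f q a b ∧ a ∈ A) j i →
      ∃ f' : M → N, Supported v lam f' ∧
        lam j * utility v f' j = lam j * utility v f j - q ∧
        lam i * utility v f' i = lam i * utility v f i + q ∧
        ∀ a, a ≠ j → a ≠ i → lam a * utility v f' a = lam a * utility v f a := by
  classical
  induction A using Finset.strongInduction with
  | H A ih =>
    intro f j i hf hji hpath
    obtain ⟨c, ⟨⟨g, rfl, hgq, hcq⟩, hjA⟩, hrest⟩ := exists_step_avoiding_source hpath hji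
    by_cases hcj : f g = c
    · subst hcj
      rcases hrest.cases_head with h | ⟨_, h, _⟩
      · exact absurd h hji
      · exact absurd rfl h.2
    have hf₁ : Supported v lam (Function.update f g c) := by
      intro e b
      by_cases he : e = g
      · subst he
        rw [Function.update_self, hcq, ← hgq]
        exact hf e b
      · rw [Function.update_of_ne he]
        exact hf e b
    have hsource := utility_update_source v hcj
    have htarget := utility_update_target v hcj
    by_cases hci : c = i
    · subst hci
      refine ⟨_, hf₁, ?_, ?_, fun a ha ha' => ?_⟩
      · rw [hsource, mul_sub, hgq]
      · rw [htarget, mul_add, hcq]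
      · rw [utility_update_of_ne v ha' ha]
    · obtain ⟨f', hf', hc', hi', ho'⟩ := ih (A.erase (f g)) (erase_ssubset hjA)
        (Function.update f g c) c i hf₁ hci (ReflTransGen.mono (fun a b hab => by
          obtain ⟨⟨⟨g', hg', h₁, h₂⟩, haA⟩, ha⟩ := hab
          have hne : g' ≠ g := by
            rintro rfl
            exact ha hg'.symm
          exact ⟨⟨g', by rw [Function.update_of_ne hne, hg'], h₁, h₂⟩, mem_erase.2 ⟨ha, haA⟩⟩) _ _ hrest)
      refine ⟨f', hf', ?_, ?_, fun a ha ha' => ?_⟩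
      · rw [ho' _ hcj hji, hsource, mul_sub, hgq]
      · rw [hi', utility_update_of_ne v (Ne.symm hci) hji.symm]
      · by_cases hac : a = c
        · subst hac
          rw [hc', htarget, mul_add, hcq, add_sub_cancel_right]
        · rw [ho' a hac ha', utility_update_of_ne v hac ha]

/-- Bundles of a supported allocation are worth no more to others than to their owners. -/
lemma weighted_utility_lt_of_envy {v : N → M → ℝ} {lam : N → ℝ} {f : M → N} {i j : N} {e : M}
    [DecidableEq M] (hf : Supported v lam f) (hi : 0 < lam i) (he : f e = j)
    (henvy : utility v f i < ∑ a ∈ (bundle f j).erase e, v i a) :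
    lam i * utility v f i < lam j * utility v f j - lam j * v j e := by
  have h : ∑ a ∈ (bundle f j).erase e, lam i * v i a ≤
      ∑ a ∈ (bundle f j).erase e, lam j * v j a := by
    refine sum_le_sum fun a ha => ?_
    have := hf a i
    rwa [mem_bundle.1 (mem_of_mem_erase ha)] at this
  rw [← mul_sum, ← mul_sum, sum_erase_eq_sub (f := v j) (mem_bundle.2 he), mul_sub] at h
  exact (mul_lt_mul_of_pos_left henvy hi).trans_le h

lemma isAllocation_bundle (f : M → N) : IsAllocation (bundle f) := by
  refine ⟨fun i j hij => disjoint_left.2 fun e hi hj => hij ?_, fun e => ⟨f e, mem_bundle.2 rfl⟩⟩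
  rw [← mem_bundle.1 hi, mem_bundle.1 hj]

/-- An allocation supported by positive weights is fractionally Pareto optimal. -/
lemma Supported.isfPO [Fintype N] {v : N → M → ℝ} {lam : N → ℝ} {f : M → N}
    (hf : Supported v lam f) (hlam : ∀ i, 0 < lam i) : IsfPO v (bundle f) := by
  classical
  rintro ⟨x, ⟨hx, hx₁⟩, hle, i₀, hlt⟩
  have hstrict : ∑ i, lam i * ∑ e ∈ bundle f i, v i e < ∑ i, lam i * ∑ e, x i e * v i e :=
    sum_lt_sum (fun i _ => mul_le_mul_of_nonneg_left (hle i) (hlam i).le)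
      ⟨i₀, mem_univ _, mul_lt_mul_of_pos_left hlt (hlam i₀)⟩
  have hupper : ∑ i, lam i * ∑ e, x i e * v i e ≤ ∑ e, lam (f e) * v (f e) e := by
    simp_rw [mul_sum]
    rw [sum_comm]
    refine sum_le_sum fun e _ => ?_
    calc ∑ i, lam i * (x i e * v i e) ≤ ∑ i, x i e * (lam (f e) * v (f e) e) := by
          refine sum_le_sum fun i _ => ?_
          have := mul_le_mul_of_nonneg_left (hf e i) (hx i e).1
          linarith
      _ = lam (f e) * v (f e) e := by rw [← sum_mul, hx₁, one_mul]
  have hvalue : ∑ i, lam i * ∑ e ∈ bundle f i, v i e = ∑ e, lam (f e) * v (f e) e := by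
    simp_rw [mul_sum]
    rw [← sum_fiberwise univ f fun e => lam (f e) * v (f e) e]
    refine sum_congr rfl fun i _ => sum_congr (by ext; simp [bundle]) fun e he => ?_
    rw [mem_bundle.1 he]
  linarith

end Allocation

section Weights

variable {N : Type*}

open Classical in
/-- The weight `k` on the agents in `R`, and `1` on the others. -/
noncomputable def weight (k : ℝ) (R : Set N) (i : N) : ℝ := if i ∈ R then k else 1

lemma weight_of_mem {k : ℝ} {R : Set N} {i : N} (h : i ∈ R) : weight k R i = k := if_pos h

lemma weight_of_notMem {k : ℝ} {R : Set N} {i : N} (h : i ∉ R) : weight k R i = 1 := if_neg h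

lemma weight_congr {k : ℝ} {R R' : Set N} {i : N} (h : i ∈ R ↔ i ∈ R') :
    weight k R i = weight k R' i := by
  unfold weight
  congr 1
  exact propext h

lemma one_le_weight {k : ℝ} (hk : 1 < k) (R : Set N) (i : N) : 1 ≤ weight k R i := by
  unfold weight
  split_ifs <;> linarith

lemma weight_mono {k : ℝ} (hk : 1 < k) {R R' : Set N} (h : R ⊆ R') (i : N) :
    weight k R i ≤ weight k R' i := by
  by_cases hi : i ∈ R
  · rw [weight_of_mem hi, weight_of_mem (h hi)]
  · rw [weight_of_notMem hi]
    exact one_le_weight hk R' i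

end Weights

section Optimality

variable {N M : Type*}

/-- For all supporting weights with values in `{1, k}`, passing a good along a path does not
benefit a poorer agent. -/
def PathBalanced [Fintype M] (v : N → M → ℝ) (k : ℝ) (f : M → N) : Prop :=
  ∀ R : Set N, R.Nonempty → Supported v (weight k R) f → ∀ q, 0 < q → ∀ a b,
    ReflTransGen (Step v (weight k R) f q) a b →
      weight k R a * utility v f a - q ≤ weight k R b * utility v f b

/-- A positive substitute for utilities which penalises zero utility heavily. -/
noncomputable def penalized (D u : ℝ) : ℝ := if u = 0 then D⁻¹ else u

lemma penalized_mul_lt {D x y s t a : ℝ} (hs : 0 < s) (ht : 0 < t) (ha : 0 < a)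
    (hy : 0 ≤ y) (hxD : x < D) {x' y' : ℝ} (hx' : s * x' = s * x - a) (hy' : t * y' = t * y + a)
    (hx1 : x' = 0 ∨ 1 ≤ x') (hy1 : y' = 0 ∨ 1 ≤ y') (hlt : t * y < s * x - a) :
    penalized D x * penalized D y < penalized D x' * penalized D y' := by
  have hsx' : 0 < s * x' := by
    have := mul_nonneg ht.le hy
    linarith
  have hx'pos : 0 < x' := pos_of_mul_pos_right hsx' hs.le
  have hty' : 0 < t * y' := by
    have := mul_nonneg ht.le hy
    linarith
  have hy'pos : 0 < y' := pos_of_mul_pos_right hty' ht.le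
  have hxpos : 0 < x := by
    have : 0 < s * x := by linarith
    exact pos_of_mul_pos_right this hs.le
  have hx1' : 1 ≤ x' := hx1.resolve_left hx'pos.ne'
  have hy1' : 1 ≤ y' := hy1.resolve_left hy'pos.ne'
  simp only [penalized, hxpos.ne', hx'pos.ne', hy'pos.ne', if_false]
  split_ifs with h
  · have hD : 0 < D := hxpos.trans hxD
    have : x * D⁻¹ < 1 := by rwa [← div_eq_mul_inv, div_lt_one hD]
    nlinarith
  · have h₁ : (s * x) * (t * y) < (s * x') * (t * y') := by
      rw [hx', hy']
      nlinarith
    have h₂ : (s * t) * (x * y) < (s * t) * (x' * y') := by linarith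
    exact lt_of_mul_lt_mul_left h₂ (mul_pos hs ht).le

variable {v : N → M → ℝ} {k : ℝ}

lemma one_le_value (hk : 1 < k) (hv : ∀ i e, v i e = 1 ∨ v i e = k) (i : N) (e : M) :
    1 ≤ v i e := by
  rcases hv i e with h | h <;> linarith

lemma value_le (hk : 1 < k) (hv : ∀ i e, v i e = 1 ∨ v i e = k) (i : N) (e : M) :
    v i e ≤ k := by
  rcases hv i e with h | h <;> linarith

variable [Fintype M]

lemma utility_nonneg (hk : 1 < k) (hv : ∀ i e, v i e = 1 ∨ v i e = k) (f : M → N) (i : N) :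
    0 ≤ utility v f i :=
  sum_nonneg fun e _ => zero_le_one.trans (one_le_value hk hv i e)

lemma card_le_utility (hk : 1 < k) (hv : ∀ i e, v i e = 1 ∨ v i e = k) (f : M → N) (i : N) :
    (#(bundle f i) : ℝ) ≤ utility v f i := by
  have := card_nsmul_le_sum (bundle f i) (v i) 1 fun e _ => one_le_value hk hv i e
  simpa [utility] using this

lemma utility_le_card_mul (hk : 1 < k) (hv : ∀ i e, v i e = 1 ∨ v i e = k) (f : M → N) (i : N) :
    utility v f i ≤ #(bundle f i) * k := by
  have := sum_le_card_nsmul (bundle f i) (v i) k fun e _ => value_le hk hv i e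
  simpa [utility] using this

lemma utility_eq_zero_or_one_le (hk : 1 < k) (hv : ∀ i e, v i e = 1 ∨ v i e = k) (f : M → N)
    (i : N) : utility v f i = 0 ∨ 1 ≤ utility v f i := by
  rcases (bundle f i).eq_empty_or_nonempty with h | h
  · left
    rw [utility, h, sum_empty]
  · right
    have h₁ : (1 : ℝ) ≤ #(bundle f i) := by exact_mod_cast h.card_pos
    exact h₁.trans (card_le_utility hk hv f i)

/-- A maximiser of the penalised Nash welfare among supported allocations is balanced. -/
lemma exists_supported_pathBalanced [Fintype N] [Nonempty N] (hk : 1 < k)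
    (hv : ∀ i e, v i e = 1 ∨ v i e = k) :
    ∃ f : M → N, (∃ R : Set N, R.Nonempty ∧ Supported v (weight k R) f) ∧ PathBalanced v k f := by
  classical
  set D : ℝ := Fintype.card M * k + 1
  have hDpos : 0 < D := by positivity
  let welfare : (M → N) → ℝ := fun f => ∏ i, penalized D (utility v f i)
  have hinit : ∃ f : M → N, ∃ R : Set N, R.Nonempty ∧ Supported v (weight k R) f := by
    choose f hf using fun e => Finite.exists_max fun i => v i e
    refine ⟨f, Set.univ, Set.univ_nonempty, fun e b => ?_⟩
    rw [weight_of_mem (Set.mem_univ _), weight_of_mem (Set.mem_univ _)]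
    exact mul_le_mul_of_nonneg_left (hf e b) (by linarith)
  obtain ⟨f, hf, hmax⟩ := Set.exists_max_image
    {f : M → N | ∃ R : Set N, R.Nonempty ∧ Supported v (weight k R) f} welfare
    (Set.toFinite _) hinit
  refine ⟨f, hf, fun R hR hsupp q hq a b hpath => ?_⟩
  by_contra! hlt
  have hab : a ≠ b := by
    rintro rfl
    linarith
  have hw : ∀ i, 0 < weight k R i := fun i => zero_lt_one.trans_le (one_le_weight hk R i)
  obtain ⟨f', hf', ha', hb', ho'⟩ := exists_transfer v (weight k R) q univ f a b hsupp hab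
    (ReflTransGen.mono (fun _ _ h => ⟨h, mem_univ _⟩) _ _ hpath)
  have hcard : utility v f a < D := by
    have h₁ := utility_le_card_mul hk hv f a
    have h₂ : (#(bundle f a) : ℝ) ≤ Fintype.card M := by exact_mod_cast card_le_univ _
    have h₃ : (#(bundle f a) : ℝ) * k ≤ Fintype.card M * k :=
      mul_le_mul_of_nonneg_right h₂ (by linarith)
    linarith
  have hpair := penalized_mul_lt (hw a) (hw b) hq (utility_nonneg hk hv f b) hcard ha' hb'
    (utility_eq_zero_or_one_le hk hv f' a) (utility_eq_zero_or_one_le hk hv f' b) hlt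
  have hsplit : ∀ h : M → N, welfare h = penalized D (utility v h a) * penalized D (utility v h b) *
      ∏ i ∈ (univ.erase a).erase b, penalized D (utility v h i) := fun h => by
    rw [mul_assoc, mul_prod_erase _ (fun i => penalized D (utility v h i))
      (mem_erase.2 ⟨hab.symm, mem_univ b⟩), mul_prod_erase _ (fun i => penalized D (utility v h i)) (mem_univ a)]
  have hrest : ∏ i ∈ (univ.erase a).erase b, penalized D (utility v f' i) =
      ∏ i ∈ (univ.erase a).erase b, penalized D (utility v f i) :=
    prod_congr rfl fun i hi => by
      rw [mem_erase, mem_erase] at hi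
      rw [mul_left_cancel₀ (hw i).ne' (ho' i hi.2.1 hi.1)]
  have hpos : 0 < ∏ i ∈ (univ.erase a).erase b, penalized D (utility v f i) :=
    prod_pos fun i _ => by
      unfold penalized
      split_ifs with h
      · exact inv_pos.2 hDpos
      · exact (utility_nonneg hk hv f i).lt_of_ne' h
  have hle := hmax f' ⟨R, hR, hf'⟩
  rw [hsplit, hsplit, hrest] at hle
  exact absurd (lt_of_mul_lt_mul_right (hle.trans_lt (mul_lt_mul_of_pos_right hpair hpos)) hpos.le)
    (lt_irrefl _)

end Optimality

section EnvyFree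

variable {N M : Type*} {v : N → M → ℝ} {k : ℝ} {f : M → N} {R : Set N}

/-- Every good has price at least `k`. -/
lemma le_price (hk : 1 < k) (hv : ∀ i e, v i e = 1 ∨ v i e = k) (hR : R.Nonempty)
    (hf : Supported v (weight k R) f) (e : M) : k ≤ weight k R (f e) * v (f e) e := by
  obtain ⟨r, hr⟩ := hR
  have h := hf e r
  rw [weight_of_mem hr] at h
  have := one_le_value hk hv r e
  nlinarith

lemma value_eq_of_owner_notMem (hk : 1 < k) (hv : ∀ i e, v i e = 1 ∨ v i e = k) (hR : R.Nonempty)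
    (hf : Supported v (weight k R) f) {e : M} (h : f e ∉ R) : v (f e) e = k := by
  have := le_price hk hv hR hf e
  rw [weight_of_notMem h, one_mul] at this
  exact le_antisymm (value_le hk hv _ e) this

lemma utility_eq_card_mul [Fintype M] {j : N} (h : ∀ e, f e = j → v j e = k) :
    utility v f j = #(bundle f j) * k := by
  rw [utility, sum_congr rfl fun e he => h e (mem_bundle.1 he), sum_const, nsmul_eq_mul]

/-- A good which an agent in `R` owns but values at `1` can be passed to any agent in `R`. -/
lemma step_of_value_eq_one (hk : 1 < k) (hv : ∀ i e, v i e = 1 ∨ v i e = k)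
    (hf : Supported v (weight k R) f) {t r : N} {e : M} (ht : t ∈ R) (hr : r ∈ R) (he : f e = t)
    (h : v t e = 1) : Step v (weight k R) f k t r := by
  refine ⟨e, he, by rw [weight_of_mem ht, h, mul_one], ?_⟩
  have hle := hf e r
  rw [he, weight_of_mem ht, weight_of_mem hr, h] at hle
  have := le_of_mul_le_mul_left hle (by linarith)
  rw [weight_of_mem hr, le_antisymm this (one_le_value hk hv r e), mul_one]

/-- A good owned outside `R` can be passed to any agent in `R`. -/
lemma step_of_owner_notMem (hk : 1 < k) (hv : ∀ i e, v i e = 1 ∨ v i e = k) (hR : R.Nonempty)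
    (hf : Supported v (weight k R) f) {j r : N} {e : M} (hj : j ∉ R) (hr : r ∈ R) (he : f e = j) :
    Step v (weight k R) f k j r := by
  subst he
  have hval := value_eq_of_owner_notMem hk hv hR hf hj
  refine ⟨e, rfl, by rw [weight_of_notMem hj, hval, one_mul], le_antisymm ?_ ?_⟩
  · have := hf e r
    rwa [weight_of_notMem hj, hval, one_mul] at this
  · rw [weight_of_mem hr]
    have := one_le_value hk hv r e
    nlinarith

/-- Envy up to a good of price `q` is excluded along paths of price `q' ≤ q`. -/
lemma PathBalanced.not_envy [Fintype M] [DecidableEq M] (hbal : PathBalanced v k f) (hk : 1 < k)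
    (hR : R.Nonempty) (hf : Supported v (weight k R) f) {i j : N} {e : M} (he : f e = j)
    (henvy : utility v f i < ∑ a ∈ (bundle f j).erase e, v i a) {q : ℝ} (hq : 0 < q)
    (hqe : q ≤ weight k R j * v j e) : ¬ ReflTransGen (Step v (weight k R) f q) j i := by
  intro hpath
  have h₁ := hbal R hR hf q hq j i hpath
  have h₂ := weighted_utility_lt_of_envy hf
    (zero_lt_one.trans_le (one_le_weight hk R i)) he henvy
  linarith

/-- The weights of all agents reachable from `j` along goods of price `k * k` can be lowered
simultaneously when these agents only own goods which they value at `k`. -/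
lemma Supported.lower (hk : 1 < k) (hv : ∀ i e, v i e = 1 ∨ v i e = k)
    (hf : Supported v (weight k R) f) {j : N} (hj : j ∈ R)
    (hval : ∀ t ∈ R, ReflTransGen (Step v (weight k R) f (k * k)) j t →
      ∀ e, f e = t → v t e = k) :
    Supported v (weight k (R \ {t | ReflTransGen (Step v (weight k R) f (k * k)) j t})) f := by
  set T : Set N := {t | ReflTransGen (Step v (weight k R) f (k * k)) j t}
  have hTR : T ⊆ R := by
    intro t ht
    rcases ReflTransGen.cases_tail ht with h | ⟨_, _, g, _, _, h⟩
    · rwa [h]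
    · by_contra htR
      rw [weight_of_notMem htR, one_mul] at h
      have := value_le hk hv t g
      nlinarith
  intro e b
  by_cases ho : f e ∈ T
  · have hoe : v (f e) e = k := hval _ (hTR ho) ho e rfl
    have hod : f e ∉ R \ T := fun h => h.2 ho
    rw [weight_of_notMem hod, hoe, one_mul]
    by_cases hb : b ∈ R \ T
    · rw [weight_of_mem hb]
      rcases hv b e with h | h
      · rw [h, mul_one]
      · refine absurd (ReflTransGen.tail ho ⟨e, rfl, ?_, ?_⟩) hb.2
        · rw [weight_of_mem (hTR ho), hoe]
        · rw [weight_of_mem hb.1, h]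
    · rw [weight_of_notMem hb, one_mul]
      exact value_le hk hv b e
  · have hsame : weight k (R \ T) (f e) = weight k R (f e) :=
      weight_congr (and_iff_left ho)
    rw [hsame]
    exact (mul_le_mul_of_nonneg_right (weight_mono hk Set.sdiff_subset b)
      (zero_le_one.trans (one_le_value hk hv b e))).trans (hf e b)

/-- The weights of all agents from which `i` is reachable along goods of price `k` can be raised
simultaneously when none of these agents is in `R`. -/
lemma Supported.raise (hk : 1 < k) (hv : ∀ i e, v i e = 1 ∨ v i e = k) (hR : R.Nonempty)
    (hf : Supported v (weight k R) f) {i : N}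
    (hdisj : ∀ r ∈ R, ¬ ReflTransGen (Step v (weight k R) f k) r i) :
    Supported v (weight k (R ∪ {s | ReflTransGen (Step v (weight k R) f k) s i})) f := by
  set S : Set N := {s | ReflTransGen (Step v (weight k R) f k) s i}
  intro e b
  have howner : weight k R (f e) * v (f e) e ≤ weight k (R ∪ S) (f e) * v (f e) e :=
    mul_le_mul_of_nonneg_right (weight_mono hk Set.subset_union_left _)
      (zero_le_one.trans (one_le_value hk hv _ e))
  by_cases hb : b ∈ S
  · have hbR : b ∉ R := fun h => hdisj b h hb
    rw [weight_of_mem (Set.mem_union_right R hb)]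
    rcases hv b e with h | h
    · rw [h, mul_one]
      exact (le_price hk hv hR hf e).trans howner
    · rw [h]
      have hprice : f e ∉ S → weight k R (f e) * v (f e) e ≠ k := fun ho hp =>
        ho (ReflTransGen.head ⟨e, rfl, hp, by rw [weight_of_notMem hbR, h, one_mul]⟩ hb)
      by_cases ho : f e ∈ S
      · have hoR : f e ∉ R := fun h => hdisj _ h ho
        rw [weight_of_mem (Set.mem_union_right R ho), value_eq_of_owner_notMem hk hv hR hf hoR]
      · by_cases hoR : f e ∈ R
        · rw [weight_of_mem (Set.mem_union_left S hoR)]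
          rcases hv (f e) e with h' | h'
          · exact absurd (by rw [weight_of_mem hoR, h', mul_one]) (hprice ho)
          · rw [h']
        · refine absurd ?_ (hprice ho)
          rw [weight_of_notMem hoR, value_eq_of_owner_notMem hk hv hR hf hoR, one_mul]
  · have hsame : weight k (R ∪ S) b = weight k R b :=
      weight_congr (or_iff_left hb)
    rw [hsame]
    exact (hf e b).trans howner

variable [Fintype M] [DecidableEq M] {i j : N} {e : M}

lemma PathBalanced.not_envy_of_mem_of_notMem (hbal : PathBalanced v k f) (hk : 1 < k)
    (hv : ∀ i e, v i e = 1 ∨ v i e = k) (hf : Supported v (weight k R) f) (hi : i ∈ R) (hj : j ∉ R)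
    (he : f e = j) : ¬ utility v f i < ∑ a ∈ (bundle f j).erase e, v i a := by
  intro henvy
  have hR : R.Nonempty := ⟨i, hi⟩
  exact hbal.not_envy hk hR hf he henvy (by linarith) (he ▸ le_price hk hv hR hf e)
    (.single (step_of_owner_notMem hk hv hR hf hj hi he))

lemma PathBalanced.not_envy_of_mem_of_mem (hbal : PathBalanced v k f) (hk : 1 < k)
    (hv : ∀ i e, v i e = 1 ∨ v i e = k) (hf : Supported v (weight k R) f) (hi : i ∈ R) (hj : j ∈ R)
    (he : f e = j) : ¬ utility v f i < ∑ a ∈ (bundle f j).erase e, v i a := by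
  intro henvy
  have hR : R.Nonempty := ⟨i, hi⟩
  have hk0 : 0 < k := by linarith
  have hprice : k ≤ weight k R j * v j e := he ▸ le_price hk hv hR hf e
  have hown : ∀ a, f a = j → v j a = k := fun a ha =>
    (hv j a).resolve_left fun h => hbal.not_envy hk hR hf he henvy hk0 hprice
      (.single (step_of_value_eq_one hk hv hf hj hi ha h))
  have hother : ∀ a, f a = j → v i a = 1 := fun a ha =>
    (hv i a).resolve_right fun h => hbal.not_envy hk hR hf he henvy (mul_pos hk0 hk0)
      (by rw [weight_of_mem hj, hown e he])
      (.single ⟨a, ha, by rw [weight_of_mem hj, hown a ha], by rw [weight_of_mem hi, h]⟩)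
  have hcard : utility v f i < #(bundle f j) - 1 := by
    rw [sum_congr rfl fun a ha => hother a (mem_bundle.1 (mem_of_mem_erase ha)), sum_const,
      nsmul_one, cast_card_erase_of_mem (mem_bundle.2 he)] at henvy
    exact henvy
  have hreach : ∀ t ∈ R, ReflTransGen (Step v (weight k R) f (k * k)) j t →
      (#(bundle f j) - 1) * k ≤ utility v f t := fun t ht hjt => by
    have := hbal R hR hf _ (mul_pos hk0 hk0) j t hjt
    rw [weight_of_mem hj, weight_of_mem ht, utility_eq_card_mul hown] at this
    refine le_of_mul_le_mul_left ?_ hk0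
    linarith
  have hiT : ¬ ReflTransGen (Step v (weight k R) f (k * k)) j i := fun h => by
    have h₁ := hreach i hi h
    have h₂ := utility_nonneg hk hv f i
    nlinarith
  refine hbal.not_envy_of_mem_of_notMem hk hv
    (hf.lower hk hv hj fun t ht hjt a ha => (hv t a).resolve_left fun h => ?_) ⟨hi, hiT⟩
    (fun h => h.2 .refl) he henvy
  have h₁ := hbal R hR hf k hk0 t i (.single (step_of_value_eq_one hk hv hf ht hi ha h))
  rw [weight_of_mem hi, weight_of_mem ht] at h₁
  have h₂ : utility v f t - 1 ≤ utility v f i := by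
    refine le_of_mul_le_mul_left ?_ hk0
    linarith
  have h₃ := hreach t ht hjt
  have h₄ := utility_le_card_mul hk hv f i
  have h₅ : (#(bundle f i) : ℝ) + 1 ≤ #(bundle f j) - 1 := by
    have h : (#(bundle f i) : ℝ) + 1 < #(bundle f j) := by
      linarith [card_le_utility hk hv f i]
    have h' : #(bundle f i) + 1 + 1 ≤ #(bundle f j) := by exact_mod_cast h
    have h'' : (#(bundle f i) : ℝ) + 1 + 1 ≤ #(bundle f j) := by exact_mod_cast h'
    linarith
  nlinarith

/-- If no agent in `R` reaches `i`, then the weight of `i` can be raised, which excludes envy. -/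
lemma PathBalanced.not_envy_of_not_reachable (hbal : PathBalanced v k f) (hk : 1 < k)
    (hv : ∀ i e, v i e = 1 ∨ v i e = k) (hR : R.Nonempty) (hf : Supported v (weight k R) f)
    (hdisj : ∀ r ∈ R, ¬ ReflTransGen (Step v (weight k R) f k) r i) (he : f e = j) :
    ¬ utility v f i < ∑ a ∈ (bundle f j).erase e, v i a := by
  have hraise := hf.raise hk hv hR hdisj
  have hi : i ∈ R ∪ {s | ReflTransGen (Step v (weight k R) f k) s i} := Or.inr .refl
  by_cases hj : j ∈ R ∪ {s | ReflTransGen (Step v (weight k R) f k) s i}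
  · exact hbal.not_envy_of_mem_of_mem hk hv hraise hi hj he
  · exact hbal.not_envy_of_mem_of_notMem hk hv hraise hi hj he

lemma PathBalanced.not_envy_of_owner_notMem (hbal : PathBalanced v k f) (hk : 1 < k)
    (hv : ∀ i e, v i e = 1 ∨ v i e = k) (hR : R.Nonempty) (hf : Supported v (weight k R) f)
    (hj : j ∉ R) (he : f e = j) : ¬ utility v f i < ∑ a ∈ (bundle f j).erase e, v i a := by
  by_cases hreach : ∃ r ∈ R, ReflTransGen (Step v (weight k R) f k) r i
  · obtain ⟨r, hr, hri⟩ := hreach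
    intro henvy
    exact hbal.not_envy hk hR hf he henvy (by linarith) (he ▸ le_price hk hv hR hf e)
      (.head (step_of_owner_notMem hk hv hR hf hj hr he) hri)
  · push Not at hreach
    exact hbal.not_envy_of_not_reachable hk hv hR hf hreach he

lemma PathBalanced.not_envy_of_notMem_of_mem (hbal : PathBalanced v k f) (hk : 1 < k)
    (hv : ∀ i e, v i e = 1 ∨ v i e = k) (hf : Supported v (weight k R) f)
    (hi : i ∉ R) (hj : j ∈ R) (he : f e = j) :
    ¬ utility v f i < ∑ a ∈ (bundle f j).erase e, v i a := by
  intro henvy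
  have hR : R.Nonempty := ⟨j, hj⟩
  have hk0 : 0 < k := by linarith
  by_cases hreach : ∃ r ∈ R, ReflTransGen (Step v (weight k R) f k) r i
  swap
  · push Not at hreach
    exact hbal.not_envy_of_not_reachable hk hv hR hf hreach he henvy
  obtain ⟨r, hr, hri⟩ := hreach
  have hown : ∀ a, f a = j → v j a = k := fun a ha =>
    (hv j a).resolve_left fun h => hbal.not_envy hk hR hf he henvy hk0
      (he ▸ le_price hk hv hR hf e) (.head (step_of_value_eq_one hk hv hf hj hr ha h) hri)
  have hui : utility v f i = #(bundle f i) * k := utility_eq_card_mul fun a ha => by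
    subst ha
    exact value_eq_of_owner_notMem hk hv hR hf hi
  have hcard : (#(bundle f i) : ℝ) + 1 ≤ #(bundle f j) - 1 := by
    have h : ∑ a ∈ (bundle f j).erase e, v i a ≤ #((bundle f j).erase e) • k :=
      sum_le_card_nsmul _ _ _ fun a _ => value_le hk hv i a
    rw [card_erase_of_mem (mem_bundle.2 he), nsmul_eq_mul] at h
    have h' : (#(bundle f i) : ℝ) < (#(bundle f j) - 1 : ℕ) :=
      lt_of_mul_lt_mul_right (hui ▸ henvy.trans_le h) hk0.le
    have h'' : #(bundle f i) + 1 + 1 ≤ #(bundle f j) := by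
      have : #(bundle f i) < #(bundle f j) - 1 := by exact_mod_cast h'
      omega
    have : (#(bundle f i) : ℝ) + 1 + 1 ≤ #(bundle f j) := by exact_mod_cast h''
    linarith
  have hcard0 : (0 : ℝ) ≤ #(bundle f i) := Nat.cast_nonneg _
  have hconflict : ∀ t ∈ R, ReflTransGen (Step v (weight k R) f (k * k)) j t →
      ¬ ReflTransGen (Step v (weight k R) f k) t i := fun t ht hjt hti => by
    have h₁ := hbal R hR hf _ (mul_pos hk0 hk0) j t hjt
    have h₂ := hbal R hR hf k hk0 t i hti
    rw [weight_of_mem hj, utility_eq_card_mul hown] at h₁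
    rw [weight_of_notMem hi, hui] at h₂
    have h₃ : k * ((#(bundle f j) - 1) * k) ≤ k * (#(bundle f i) + 1) := by linarith
    have h₄ := le_of_mul_le_mul_left h₃ hk0
    nlinarith
  have hrT : r ∈ R \ {t | ReflTransGen (Step v (weight k R) f (k * k)) j t} :=
    ⟨hr, fun h => hconflict r hr h hri⟩
  have hlower := hf.lower hk hv hj fun t ht hjt a ha => (hv t a).resolve_left fun h =>
    hconflict t ht hjt (.head (step_of_value_eq_one hk hv hf ht hr ha h) hri)
  exact hbal.not_envy_of_owner_notMem hk hv ⟨r, hrT⟩ hlower (fun h => h.2 .refl) he henvy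

end EnvyFree

end Bivalued

open Bivalued in
/-- For every (unweighted) bivalued instance there exists an allocation that is
both EFX and fPO. -/
theorem efx_fpo_exists {N M : Type*} [Fintype N] [Fintype M] [DecidableEq M] [Nonempty N]
    (k : ℝ) (hk : 1 < k)
    (v : N → M → ℝ) (hv : ∀ i e, v i e = 1 ∨ v i e = k) :
    ∃ X : N → Finset M, IsAllocation X ∧
      (∀ i j : N, ∀ e ∈ X j, (∑ a ∈ (X j).erase e, v i a) ≤ ∑ a ∈ X i, v i a) ∧
      IsfPO v X := by
  obtain ⟨f, ⟨R, hR, hf⟩, hbal⟩ := exists_supported_pathBalanced hk hv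
  refine ⟨bundle f, isAllocation_bundle f, fun i j e he => not_lt.1 ?_,
    hf.isfPO fun i => zero_lt_one.trans_le (one_le_weight hk R i)⟩
  rw [mem_bundle] at he
  by_cases hj : j ∈ R
  · by_cases hi : i ∈ R
    · exact hbal.not_envy_of_mem_of_mem hk hv hf hi hj he
    · exact hbal.not_envy_of_notMem_of_mem hk hv hf hi hj he
  · exact hbal.not_envy_of_owner_notMem hk hv hR hf hj he
end
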